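/- Let n ≥ 2, I = [0,1], and let (X,x₀) be any well-pointed space. For 0 ≤ i ≤ n set B_i(X) = C⁰(I^n, ∂I^i × I^{n−i}; X), the relative labelled configuration space of the n-cube relative to ∂I^i × I^{n−i}. Then for every 1 ≤ i ≤ n−1 there is a weak homotopy equivalence (scanning in the (i+1)-st coordinate) B_i(X) → Ω B_{i+1}(X) to the based loop space of B_{i+1}(X). -/

import Mathlib

open scoped unitInterval Topology
open Metric Set

noncomputable section

universe uWP

/-! ### Ordered configuration spaces -/

/-- The ordered configuration space `C⁰_k(M)`: `k`-tuples of pairwise distinct points of `M`,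
topologized as a subspace of `M^k`. -/
def OrdConfig (M : Type*) [TopologicalSpace M] (k : ℕ) : Type _ :=
  {p : Fin k → M // Function.Injective p}

instance (M : Type*) [TopologicalSpace M] (k : ℕ) : TopologicalSpace (OrdConfig M k) :=
  inferInstanceAs (TopologicalSpace {p : Fin k → M // Function.Injective p})

/-- The action of the symmetric group `Σ_k` on the ordered configuration space,
permuting the coordinates. -/
def OrdConfig.perm {M : Type*} [TopologicalSpace M] {k : ℕ} (e : Equiv.Perm (Fin k))
    (p : OrdConfig M k) : OrdConfig M k :=
  ⟨p.1 ∘ e, p.2.comp e.injective⟩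

/-! ### Labelled configuration spaces -/

/-- The "pre-configuration space": disjoint union over `k` of `C⁰_k(M) × X^k`. -/
def LabelPre (M X : Type*) [TopologicalSpace M] [TopologicalSpace X] : Type _ :=
  Σ k : ℕ, OrdConfig M k × (Fin k → X)

instance (M X : Type*) [TopologicalSpace M] [TopologicalSpace X] :
    TopologicalSpace (LabelPre M X) :=
  inferInstanceAs (TopologicalSpace (Σ k : ℕ, OrdConfig M k × (Fin k → X)))

/-- The relation generating the equivalence defining `C⁰(M;X)`: permuting points together
with their labels, and deleting points labelled by the base point `x₀`. -/
inductive LabelRel (M X : Type*) [TopologicalSpace M] [TopologicalSpace X] (x₀ : X) :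
    LabelPre M X → LabelPre M X → Prop
  | perm {k : ℕ} (c : OrdConfig M k) (l : Fin k → X) (e : Equiv.Perm (Fin k)) :
      LabelRel M X x₀ ⟨k, c, l⟩ ⟨k, OrdConfig.perm e c, l ∘ e⟩
  | delete {k : ℕ} (c : OrdConfig M (k + 1)) (l : Fin (k + 1) → X) (i : Fin (k + 1))
      (h : l i = x₀) :
      LabelRel M X x₀ ⟨k + 1, c, l⟩
        ⟨k, ⟨c.1 ∘ i.succAbove, c.2.comp Fin.succAbove_right_injective⟩, l ∘ i.succAbove⟩

/-- The labelled configuration space `C⁰(M;X)`, with the quotient topology. -/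
def LabeledConfig (M X : Type*) [TopologicalSpace M] [TopologicalSpace X] (x₀ : X) :=
  Quot (LabelRel M X x₀)

instance (M X : Type*) [TopologicalSpace M] [TopologicalSpace X] (x₀ : X) :
    TopologicalSpace (LabeledConfig M X x₀) :=
  inferInstanceAs (TopologicalSpace (Quot (LabelRel M X x₀)))

/-- The empty configuration. -/
def LabelPre.empty (M X : Type*) [TopologicalSpace M] [TopologicalSpace X] : LabelPre M X :=
  ⟨0, ⟨Fin.elim0, fun i => i.elim0⟩, Fin.elim0⟩

/-- The class of the empty configuration; the base point of `C⁰(M;X)`. -/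
def LabeledConfig.empty (M X : Type*) [TopologicalSpace M] [TopologicalSpace X] (x₀ : X) :
    LabeledConfig M X x₀ :=
  Quot.mk _ (LabelPre.empty M X)

/-- The label of a pre-configuration `a` at a point `m` of `M`: the label of the point of the
configuration located at `m`, if there is one, and the base point `x₀` otherwise. -/
noncomputable def labelAt {M X : Type*} [TopologicalSpace M] [TopologicalSpace X] (x₀ : X)
    (a : LabelPre M X) (m : M) : X :=
  haveI := Classical.propDecidable (∃ i, a.2.1.1 i = m)
  if h : ∃ i, a.2.1.1 i = m then a.2.2 h.choose else x₀

/-- Two labelled configurations agree off `N` if they have representatives whose labelled points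
outside of `N` coincide. -/
def AgreeOff {M X : Type*} [TopologicalSpace M] [TopologicalSpace X] (x₀ : X) (N : Set M)
    (a b : LabeledConfig M X x₀) : Prop :=
  ∃ a' b' : LabelPre M X, a = Quot.mk _ a' ∧ b = Quot.mk _ b' ∧
    ∀ m ∉ N, labelAt x₀ a' m = labelAt x₀ b' m

/-- The relative labelled configuration space `C⁰(M,N;X)`: the quotient of `C⁰(M;X)`
identifying two labelled configurations whenever they agree on `M ∖ N`. -/
def RelConfig (M : Type*) [TopologicalSpace M] (N : Set M) (X : Type*) [TopologicalSpace X]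
    (x₀ : X) : Type _ :=
  Quot (AgreeOff (M := M) (X := X) x₀ N)

instance (M : Type*) [TopologicalSpace M] (N : Set M) (X : Type*) [TopologicalSpace X] (x₀ : X) :
    TopologicalSpace (RelConfig M N X x₀) :=
  inferInstanceAs (TopologicalSpace (Quot _))

/-- The base point of `C⁰(M,N;X)`: the class of the empty configuration. -/
def RelConfig.base (M : Type*) [TopologicalSpace M] (N : Set M) (X : Type*) [TopologicalSpace X]
    (x₀ : X) : RelConfig M N X x₀ :=
  Quot.mk _ (LabeledConfig.empty M X x₀)

/-! ### Well-pointedness -/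

/-- `(X, x₀)` is well-pointed if the inclusion `{x₀} ↪ X` is a cofibration, i.e. satisfies the
homotopy extension property. -/
def IsWellPointed (X : Type uWP) [TopologicalSpace X] (x₀ : X) : Prop :=
  ∀ (Y : Type uWP) (_ : TopologicalSpace Y) (f : C(X, Y)) (p : C(I, Y)),
    p 0 = f x₀ → ∃ G : C(I × X, Y), (∀ x, G (0, x) = f x) ∧ ∀ t, G (t, x₀) = p t

/-! ### Cubes, suspensions and loop spaces -/

/-- The `n`-cube `I^n`. -/
def NCube (n : ℕ) : Type :=
  Fin n → I

instance (n : ℕ) : TopologicalSpace (NCube n) :=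
  inferInstanceAs (TopologicalSpace (Fin n → I))

/-- The boundary `∂I^n` of the `n`-cube. -/
def NCube.boundary (n : ℕ) : Set (NCube n) :=
  {t | ∃ i, t i = 0 ∨ t i = 1}

/-- The subset of `I^n × X` collapsed in the definition of the reduced suspension:
`(∂I^n × X) ∪ (I^n × {x₀})`. -/
def SuspCollapse (n : ℕ) (X : Type*) [TopologicalSpace X] (x₀ : X) : Set (NCube n × X) :=
  (NCube.boundary n ×ˢ (univ : Set X)) ∪ ((univ : Set (NCube n)) ×ˢ ({x₀} : Set X))

/-- The `n`-fold reduced suspension `Σⁿ X = (I^n × X)/((∂I^n × X) ∪ (I^n × {x₀}))`. -/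
def Susp (n : ℕ) (X : Type*) [TopologicalSpace X] (x₀ : X) :=
  Quot (fun a b : NCube n × X => a ∈ SuspCollapse n X x₀ ∧ b ∈ SuspCollapse n X x₀)

instance (n : ℕ) (X : Type*) [TopologicalSpace X] (x₀ : X) : TopologicalSpace (Susp n X x₀) :=
  inferInstanceAs (TopologicalSpace (Quot _))

/-- The base point of the reduced suspension: the class of the collapsed subset. -/
def Susp.base (n : ℕ) (X : Type*) [TopologicalSpace X] (x₀ : X) : Susp n X x₀ :=
  Quot.mk _ (fun _ => 0, x₀)

/-- The `n`-fold based loop space `Ωⁿ(Y,y₀)`, modelled as the space of continuous maps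
`I^n → Y` sending `∂I^n` to the base point, with the compact-open topology. -/
def NLoop (n : ℕ) (Y : Type*) [TopologicalSpace Y] (y₀ : Y) :=
  {f : C(NCube n, Y) // ∀ t ∈ NCube.boundary n, f t = y₀}

instance (n : ℕ) (Y : Type*) [TopologicalSpace Y] (y₀ : Y) : TopologicalSpace (NLoop n Y y₀) :=
  inferInstanceAs (TopologicalSpace {f : C(NCube n, Y) // ∀ t ∈ NCube.boundary n, f t = y₀})

/-! ### Weak homotopy equivalences -/

/-- The map induced on path components by a continuous map. -/
def ZerothHomotopy.inducedMap {X Y : Type*} [TopologicalSpace X] [TopologicalSpace Y]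
    (f : C(X, Y)) : ZerothHomotopy X → ZerothHomotopy Y :=
  @Quotient.map _ _ (pathSetoid X) (pathSetoid Y) f
    (fun _ _ h => Nonempty.map (fun p => p.map f.continuous) h)

/-- The map induced by a continuous map on generalized loops. -/
def GenLoop.inducedMap {N X Y : Type*} [TopologicalSpace X] [TopologicalSpace Y] {x : X}
    (f : C(X, Y)) (p : GenLoop N X x) : GenLoop N Y (f x) :=
  ⟨f.comp p.1, fun y hy => by
    simp only [ContinuousMap.comp_apply]
    rw [p.2 y hy]⟩

/-- The map induced by a continuous map on homotopy groups. -/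
def HomotopyGroup.inducedMap (N : Type*) {X Y : Type*} [TopologicalSpace X] [TopologicalSpace Y]
    (x : X) (f : C(X, Y)) : HomotopyGroup N X x → HomotopyGroup N Y (f x) :=
  Quotient.map (GenLoop.inducedMap f)
    (fun _ _ h => Nonempty.map (fun H => H.compContinuousMap f) h)

/-- A continuous map is a weak homotopy equivalence if it induces a bijection on path
components and isomorphisms on all homotopy groups at every base point. -/
def IsWeakHomotopyEquiv {X Y : Type*} [TopologicalSpace X] [TopologicalSpace Y]
    (f : C(X, Y)) : Prop :=
  Function.Bijective (ZerothHomotopy.inducedMap f) ∧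
    ∀ (n : ℕ) (x : X), Function.Bijective (HomotopyGroup.inducedMap (Fin n) x f)


/-- The subset `∂I^i × I^{n-i}` of the `n`-cube: points with some coordinate among the
first `i` equal to `0` or `1`. -/
def PartialBoundary (n i : ℕ) : Set (NCube n) :=
  {t | ∃ j : Fin n, (j : ℕ) < i ∧ (t j = 0 ∨ t j = 1)}

set_option linter.unusedSectionVars false

/-! ### Finite configurations with vanishing weights -/

/-- Finite subsets of `Z` on which `pos` is injective and the weight `w` is positive; a point
disappears when its weight tends to zero. -/
@[ext] structure Conf {Z D : Type*} (pos : Z → D) (w : Z → ℝ) where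
  pts : Set Z
  fin : pts.Finite
  inj : InjOn pos pts
  wpos : ∀ z ∈ pts, 0 < w z

namespace Conf

variable {Z D Z' D' T : Type*} [TopologicalSpace Z] [TopologicalSpace Z'] [TopologicalSpace T]
  {pos : Z → D} {w : Z → ℝ} {pos' : Z' → D'} {w' : Z' → ℝ}

instance : TopologicalSpace (Conf pos w) :=
  TopologicalSpace.generateFrom
    ({ S | ∃ U : Set Z, IsOpen U ∧ S = { c | (c.pts ∩ U).Nonempty } } ∪
      { S | ∃ (A : Set Z) (n : ℕ) (δ : ℝ), IsClosed A ∧ 0 < δ ∧ (∀ z ∈ A, δ ≤ w z) ∧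
        S = { c | (c.pts ∩ A).ncard ≤ n } })

theorem eventually_hit {c₀ : Conf pos w} {U : Set Z} (hU : IsOpen U)
    (h : (c₀.pts ∩ U).Nonempty) : ∀ᶠ c : Conf pos w in 𝓝 c₀, (c.pts ∩ U).Nonempty := by
  have : IsOpen { c : Conf pos w | (c.pts ∩ U).Nonempty } :=
    TopologicalSpace.isOpen_generateFrom_of_mem (Or.inl ⟨U, hU, rfl⟩)
  exact this.mem_nhds h

theorem eventually_ncard_le {c₀ : Conf pos w} {A : Set Z} (hA : IsClosed A) {δ : ℝ} (hδ : 0 < δ)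
    (hw : ∀ z ∈ A, δ ≤ w z) :
    ∀ᶠ c : Conf pos w in 𝓝 c₀, (c.pts ∩ A).ncard ≤ (c₀.pts ∩ A).ncard := by
  have : IsOpen { c : Conf pos w | (c.pts ∩ A).ncard ≤ (c₀.pts ∩ A).ncard } :=
    TopologicalSpace.isOpen_generateFrom_of_mem (Or.inr ⟨A, _, δ, hA, hδ, hw, rfl⟩)
  exact this.mem_nhds (le_refl (c₀.pts ∩ A).ncard)

theorem eventually_disjoint {c₀ : Conf pos w} {A : Set Z} (hA : IsClosed A) {δ : ℝ} (hδ : 0 < δ)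
    (hw : ∀ z ∈ A, δ ≤ w z) (h : c₀.pts ∩ A = ∅) :
    ∀ᶠ c : Conf pos w in 𝓝 c₀, c.pts ∩ A = ∅ := by
  filter_upwards [eventually_ncard_le (c₀ := c₀) hA hδ hw] with c hc
  rw [h, ncard_empty, Nat.le_zero] at hc
  exact (ncard_eq_zero (c.fin.inter_of_left A)).1 hc

/-- Near `c₀`, the points of weight at least `δ` are close to those of `c₀`. -/
theorem eventually_track [TopologicalSpace D] [T2Space D] (hpos : Continuous pos)
    (hw : Continuous w) (c₀ : Conf pos w) {δ : ℝ} (hδ : 0 < δ) (hne : ∀ z ∈ c₀.pts, w z ≠ δ)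
    (N : Z → Set Z) (hN : ∀ z ∈ c₀.pts, N z ∈ 𝓝 z) :
    ∀ᶠ c : Conf pos w in 𝓝 c₀, ∃ g : Z → Z,
      c.pts ∩ {z | δ ≤ w z} = g '' (c₀.pts ∩ {z | δ ≤ w z}) ∧
        ∀ z ∈ c₀.pts ∩ {z | δ ≤ w z}, g z ∈ N z := by
  classical
  set S := c₀.pts ∩ {z | δ ≤ w z} with hS
  have hSf : S.Finite := c₀.fin.inter_of_left _
  obtain ⟨V, hV, hVd⟩ := (c₀.fin.image pos).t2_separation
  have hUex : ∀ z : Z, ∃ U : Set Z, IsOpen U ∧ (z ∈ S → z ∈ U) ∧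
      (z ∈ S → U ⊆ N z ∩ {z | δ < w z} ∩ pos ⁻¹' V (pos z)) := by
    intro z
    by_cases hz : z ∈ S
    · have h1 : N z ∩ {z | δ < w z} ∩ pos ⁻¹' V (pos z) ∈ 𝓝 z :=
        Filter.inter_mem (Filter.inter_mem (hN z hz.1)
          ((isOpen_lt continuous_const hw).mem_nhds (lt_of_le_of_ne hz.2 (hne z hz.1).symm)))
          (((hV (pos z)).2.preimage hpos).mem_nhds (hV (pos z)).1)
      obtain ⟨U, hU, hUo, hzU⟩ := mem_nhds_iff.1 h1
      exact ⟨U, hUo, fun _ => hzU, fun _ => hU⟩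
    · exact ⟨∅, isOpen_empty, fun h => (hz h).elim, fun h => (hz h).elim⟩
  choose U hUo hUm hUs using hUex
  have e1 : ∀ᶠ c : Conf pos w in 𝓝 c₀, ∀ z ∈ S, (c.pts ∩ U z).Nonempty :=
    (Filter.eventually_all_finite hSf).2 fun z hz =>
      eventually_hit (hUo z) ⟨z, hz.1, hUm z hz⟩
  have e2 := eventually_ncard_le (c₀ := c₀) (isClosed_le continuous_const hw) hδ
    (fun z (hz : δ ≤ w z) => hz)
  filter_upwards [e1, e2] with c h1 h2
  choose! g hg using h1
  have hinj : InjOn g S := by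
    intro a ha b hb hab
    by_contra hne'
    have hp : pos a ≠ pos b := fun h => hne' (c₀.inj ha.1 hb.1 h)
    have := hVd (mem_image_of_mem pos ha.1) (mem_image_of_mem pos hb.1) hp
    refine Set.disjoint_left.1 this (hUs a ha (hg a ha).2).2 ?_
    rw [hab]
    exact (hUs b hb (hg b hb).2).2
  refine ⟨g, ?_, fun z hz => (hUs z hz (hg z hz).2).1.1⟩
  symm
  apply Set.eq_of_subset_of_ncard_le _ _ (c.fin.inter_of_left _)
  · rintro _ ⟨z, hz, rfl⟩
    exact ⟨(hg z hz).1, le_of_lt (show δ < w (g z) from (hUs z hz (hg z hz).2).1.2)⟩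
  · rw [hinj.ncard_image]
    exact h2

theorem continuousAt_of_track {f : T → Conf pos w} {t₀ : T}
    (h : ∀ δ₀ > 0, ∃ δ > 0, δ < δ₀ ∧ ∀ N : Z → Set Z, (∀ z ∈ (f t₀).pts, N z ∈ 𝓝 z) →
      ∀ᶠ t in 𝓝 t₀, ∃ g : Z → Z,
      (f t).pts ∩ {z | δ ≤ w z} = g '' ((f t₀).pts ∩ {z | δ ≤ w z}) ∧
        ∀ z ∈ (f t₀).pts ∩ {z | δ ≤ w z}, g z ∈ N z) : ContinuousAt f t₀ := by
  classical
  refine TopologicalSpace.tendsto_nhds_generateFrom_iff.2 ?_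
  rintro S (⟨U, hU, rfl⟩ | ⟨A, n, δ₀, hA, hδ₀, hAw, rfl⟩) hm
  · obtain ⟨z, hz, hzU⟩ := hm
    obtain ⟨δ, hδ, hδ0, hd⟩ := h (w z) ((f t₀).wpos z hz)
    filter_upwards [hd (fun x => if x = z then U else univ) (by
      intro x _
      split_ifs with hx
      · exact hx ▸ hU.mem_nhds hzU
      · exact Filter.univ_mem)] with t ⟨g, hg, hgN⟩
    have hz' : z ∈ (f t₀).pts ∩ {z | δ ≤ w z} := ⟨hz, hδ0.le⟩
    have h1 := hgN z hz'
    rw [if_pos rfl] at h1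
    have h2 : g z ∈ (f t).pts ∩ {z | δ ≤ w z} := hg.symm ▸ mem_image_of_mem g hz'
    exact ⟨g z, h2.1, h1⟩
  · obtain ⟨δ, hδ, hδ0, hd⟩ := h δ₀ hδ₀
    filter_upwards [hd (fun x => if x ∈ A then univ else Aᶜ) (by
      intro x _
      split_ifs with hx
      · exact Filter.univ_mem
      · exact hA.isOpen_compl.mem_nhds hx)] with t ⟨g, hg, hgN⟩
    have hsub : (f t).pts ∩ A ⊆ g '' ((f t₀).pts ∩ A) := by
      rintro x ⟨hx, hxA⟩
      have : x ∈ (f t).pts ∩ {z | δ ≤ w z} := ⟨hx, hδ0.le.trans (hAw x hxA)⟩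
      rw [hg] at this
      obtain ⟨y, hy, rfl⟩ := this
      refine ⟨y, ⟨hy.1, ?_⟩, rfl⟩
      by_contra hyA
      have h1 := hgN y hy
      rw [if_neg hyA] at h1
      exact h1 hxA
    have hf := (f t₀).fin.inter_of_left A
    exact (ncard_le_ncard hsub (hf.image g)).trans ((ncard_image_le hf).trans hm)

theorem exists_small_ne {S : Set ℝ} (hS : S.Finite) {a : ℝ} (ha : 0 < a) :
    ∃ δ > 0, δ < a ∧ δ ∉ S := by
  obtain ⟨δ, hδ, hn⟩ := ((Ioo_infinite ha).sdiff hS).nonempty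
  exact ⟨δ, hδ.1, hδ.2, hn⟩

/-- Continuity of a family of configurations obtained from another one by moving the points by
`ψ` and changing the weights to `v`. -/
theorem continuousAt_push [TopologicalSpace D] [T2Space D] (hpos : Continuous pos)
    (hw : Continuous w) {u : T → Conf pos w} {f : T → Conf pos' w'} {ψ : T → Z → Z'}
    {v : T → Z → ℝ} {t₀ : T} (hu : ContinuousAt u t₀)
    (hpts : ∀ t, (f t).pts = ψ t '' {z ∈ (u t).pts | 0 < v t z})
    (hv : ∀ t, ∀ z ∈ (u t).pts, 0 < v t z → w' (ψ t z) = v t z)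
    (hinj : InjOn (ψ t₀) {z ∈ (u t₀).pts | 0 < v t₀ z})
    (hψc : ∀ z ∈ (u t₀).pts, 0 < v t₀ z → ContinuousAt (fun p : T × Z => ψ p.1 p.2) (t₀, z))
    (hvc : ∀ z ∈ (u t₀).pts, ContinuousAt (fun p : T × Z => v p.1 p.2) (t₀, z))
    (hctl : ∀ δ > 0, ∃ δ' > 0, ∀ᶠ t in 𝓝 t₀, ∀ z, δ ≤ v t z → δ' ≤ w z) :
    ContinuousAt f t₀ := by
  classical
  refine continuousAt_of_track fun δ₀ hδ₀ => ?_
  obtain ⟨δ, hδ, hδ0, hδn⟩ := exists_small_ne ((u t₀).fin.image (v t₀)) hδ₀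
  refine ⟨δ, hδ, hδ0, fun N hN => ?_⟩
  obtain ⟨δ₁, hδ₁, hctl⟩ := hctl δ hδ
  obtain ⟨δ', hδ', hδ1, hδn'⟩ := exists_small_ne ((u t₀).fin.image w) hδ₁
  have hne : ∀ z ∈ (u t₀).pts, v t₀ z ≠ δ := fun z hz h => hδn ⟨z, hz, h⟩
  have hloc : ∀ z : Z, ∃ (A : Set T) (B : Set Z), z ∈ (u t₀).pts → A ∈ 𝓝 t₀ ∧ B ∈ 𝓝 z ∧
      ∀ t ∈ A, ∀ x ∈ B, (δ ≤ v t₀ z → δ ≤ v t x ∧ ψ t x ∈ N (ψ t₀ z)) ∧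
        (v t₀ z < δ → v t x < δ) := by
    intro z
    by_cases hz : z ∈ (u t₀).pts
    · rcases lt_or_ge (v t₀ z) δ with h | h
      · have := (hvc z hz).eventually (gt_mem_nhds h)
        rw [nhds_prod_eq] at this
        obtain ⟨A, hA, B, hB, hAB⟩ := Filter.eventually_prod_iff.1 this
        exact ⟨{t | A t}, {x | B x}, fun _ => ⟨hA, hB, fun t ht x hx =>
          ⟨fun h' => absurd h' (not_le.2 h), fun _ => hAB ht hx⟩⟩⟩
      · have h' := lt_of_le_of_ne h (hne z hz).symm
        have h0 : 0 < v t₀ z := hδ.trans h'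
        have h1 := (hvc z hz).eventually (lt_mem_nhds h')
        have h2 : ∀ᶠ p : T × Z in 𝓝 (t₀, z), ψ p.1 p.2 ∈ N (ψ t₀ z) := by
          apply (hψc z hz h0).eventually
          exact hN _ (by rw [hpts]; exact mem_image_of_mem _ ⟨hz, h0⟩)
        have := h1.and h2
        rw [nhds_prod_eq] at this
        obtain ⟨A, hA, B, hB, hAB⟩ := Filter.eventually_prod_iff.1 this
        exact ⟨{t | A t}, {x | B x}, fun _ => ⟨hA, hB, fun t ht x hx =>
          ⟨fun _ => ⟨(hAB ht hx).1.le, (hAB ht hx).2⟩, fun h'' => absurd h (not_le.2 h'')⟩⟩⟩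
    · exact ⟨∅, ∅, fun h => (hz h).elim⟩
  choose A B hAB using hloc
  have e1 : ∀ᶠ t in 𝓝 t₀, ∀ z ∈ (u t₀).pts, t ∈ A z :=
    (Filter.eventually_all_finite (u t₀).fin).2 fun z hz => (hAB z hz).1
  have e2 := hu.eventually (eventually_track hpos hw (u t₀) hδ'
    (fun z hz h => hδn' ⟨z, hz, h⟩) B fun z hz => (hAB z hz).2.1)
  have key : ∀ t, (f t).pts ∩ {z | δ ≤ w' z} = ψ t '' {z ∈ (u t).pts | δ ≤ v t z} := by
    intro t
    rw [hpts]
    ext x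
    constructor
    · rintro ⟨⟨z, ⟨hz, h0⟩, rfl⟩, hx⟩
      exact ⟨z, ⟨hz, by rw [← hv t z hz h0]; exact hx⟩, rfl⟩
    · rintro ⟨z, ⟨hz, h0⟩, rfl⟩
      have h1 : 0 < v t z := hδ.trans_le h0
      exact ⟨⟨z, ⟨hz, h1⟩, rfl⟩, show δ ≤ w' _ by rw [hv t z hz h1]; exact h0⟩
  have hc0 := hctl.self_of_nhds
  filter_upwards [e1, e2, hctl] with t h1 ⟨g, hg, hgB⟩ h3
  have hsel : ∀ x : Z', ∃ y : Z', x ∈ ψ t₀ '' {z ∈ (u t₀).pts | δ ≤ v t₀ z} →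
      ∃ z ∈ (u t₀).pts, δ ≤ v t₀ z ∧ ψ t₀ z = x ∧ y = ψ t (g z) := by
    intro x
    by_cases hx : x ∈ ψ t₀ '' {z ∈ (u t₀).pts | δ ≤ v t₀ z}
    · obtain ⟨z, ⟨hz, hz'⟩, rfl⟩ := hx
      exact ⟨_, fun _ => ⟨z, hz, hz', rfl, rfl⟩⟩
    · exact ⟨x, fun h => (hx h).elim⟩
  choose G hG using hsel
  have hw0 : ∀ z ∈ (u t₀).pts, δ ≤ v t₀ z → z ∈ (u t₀).pts ∩ {z | δ' ≤ w z} := fun z hz h =>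
    ⟨hz, hδ1.le.trans (hc0 z h)⟩
  refine ⟨G, ?_, ?_⟩
  · rw [key, key]
    ext y
    constructor
    · rintro ⟨z, ⟨hz, hvz⟩, rfl⟩
      have hz' : z ∈ (u t).pts ∩ {z | δ' ≤ w z} := ⟨hz, hδ1.le.trans (h3 z hvz)⟩
      rw [hg] at hz'
      obtain ⟨z₀, hz₀, rfl⟩ := hz'
      have hl := (hAB z₀ hz₀.1).2.2 t (h1 z₀ hz₀.1) (g z₀) (hgB z₀ hz₀)
      have hd : δ ≤ v t₀ z₀ := by
        by_contra h
        exact absurd hvz (not_le.2 (hl.2 (not_le.1 h)))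
      refine ⟨ψ t₀ z₀, ⟨z₀, ⟨hz₀.1, hd⟩, rfl⟩, ?_⟩
      obtain ⟨z₁, hz₁, hd₁, he, hy⟩ := hG (ψ t₀ z₀) ⟨z₀, ⟨hz₀.1, hd⟩, rfl⟩
      rw [hy, hinj ⟨hz₁, hδ.trans_le hd₁⟩ ⟨hz₀.1, hδ.trans_le hd⟩ he]
    · rintro ⟨x, hx, rfl⟩
      obtain ⟨z, hz, hd, he, hy⟩ := hG x hx
      have hz' := hw0 z hz hd
      have hl := (hAB z hz).2.2 t (h1 z hz) (g z) (hgB z hz')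
      have hgz : g z ∈ (u t).pts ∩ {z | δ' ≤ w z} := hg ▸ mem_image_of_mem g hz'
      exact ⟨g z, ⟨hgz.1, (hl.1 hd).1⟩, hy.symm⟩
  · intro x hx
    rw [key] at hx
    obtain ⟨z, hz, hd, he, hy⟩ := hG x hx
    have hl := (hAB z hz).2.2 t (h1 z hz) (g z) (hgB z (hw0 z hz hd))
    rw [hy, ← he]
    exact (hl.1 hd).2

/-- Restricting a family of configurations to a set `S` whose frontier it avoids. -/
theorem continuousAt_restrict {w' : Z → ℝ} [TopologicalSpace D] [T2Space D] (hpos : Continuous pos)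
    (hw : Continuous w) (hw' : Continuous w') {u : T → Conf pos w} {f : T → Conf pos w'}
    (S : Set Z) {t₀ : T} (hu : ContinuousAt u t₀)
    (hpts : ∀ t, (f t).pts = {z ∈ (u t).pts | z ∈ S ∧ 0 < w' z})
    (hS : ∀ z ∈ (u t₀).pts, S ∈ 𝓝 z ∨ Sᶜ ∈ 𝓝 z)
    (hctl : ∀ δ > 0, ∃ δ' > 0, ∀ z ∈ S, δ ≤ w' z → δ' ≤ w z) :
    ContinuousAt f t₀ := by
  classical
  refine continuousAt_push (ψ := fun _ z => z) (v := fun _ z => if z ∈ S then w' z else 0)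
    hpos hw hu ?_ ?_ (fun x _ y _ h => h) ?_ ?_ ?_
  · intro t
    rw [hpts]
    ext z
    simp only [image_id']
    constructor
    · rintro ⟨h1, h2, h3⟩
      exact ⟨h1, by rwa [if_pos h2]⟩
    · rintro ⟨h1, h2⟩
      by_cases hz : z ∈ S
      · rw [if_pos hz] at h2
        exact ⟨h1, hz, h2⟩
      · rw [if_neg hz] at h2
        exact (lt_irrefl _ h2).elim
  · intro t z _ h
    by_cases hz : z ∈ S
    · rw [if_pos hz]
    · rw [if_neg hz] at h
      exact (lt_irrefl _ h).elim
  · intro z _ _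
    exact continuous_snd.continuousAt
  · intro z hz
    rcases hS z hz with h | h
    · have : (fun p : T × Z => if p.2 ∈ S then w' p.2 else 0) =ᶠ[𝓝 (t₀, z)]
          fun p => w' p.2 := by
        filter_upwards [continuous_snd.continuousAt.preimage_mem_nhds h] with p hp
        exact if_pos hp
      exact (hw'.comp continuous_snd).continuousAt.congr this.symm
    · have : (fun p : T × Z => if p.2 ∈ S then w' p.2 else 0) =ᶠ[𝓝 (t₀, z)]
          fun _ => 0 := by
        filter_upwards [continuous_snd.continuousAt.preimage_mem_nhds h] with p hp
        exact if_neg hp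
      exact continuousAt_const.congr this.symm
  · intro δ hδ
    obtain ⟨δ', h', h⟩ := hctl δ hδ
    refine ⟨δ', h', Filter.Eventually.of_forall fun t z hz => ?_⟩
    by_cases hzS : z ∈ S
    · rw [if_pos hzS] at hz
      exact h z hzS hz
    · rw [if_neg hzS] at hz
      exact (lt_irrefl _ (hδ.trans_le hz)).elim

/-- Continuity of a union of two families of configurations. -/
theorem continuousAt_union [TopologicalSpace D] [T2Space D] (hpos : Continuous pos)
    (hw : Continuous w) {c₁ c₂ f : T → Conf pos w} {t₀ : T} (h₁ : ContinuousAt c₁ t₀)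
    (h₂ : ContinuousAt c₂ t₀) (hf : ∀ t, (f t).pts = (c₁ t).pts ∪ (c₂ t).pts)
    (hd : Disjoint (c₁ t₀).pts (c₂ t₀).pts) : ContinuousAt f t₀ := by
  classical
  refine continuousAt_of_track fun δ₀ hδ₀ => ?_
  obtain ⟨δ, hδ, hδ0, hδn⟩ := exists_small_ne ((f t₀).fin.image w) hδ₀
  refine ⟨δ, hδ, hδ0, fun N hN => ?_⟩
  rw [hf] at hδn hN
  filter_upwards [h₁.eventually (eventually_track hpos hw (c₁ t₀) hδ
      (fun z hz h => hδn ⟨z, Or.inl hz, h⟩) N fun z hz => hN z (Or.inl hz)),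
    h₂.eventually (eventually_track hpos hw (c₂ t₀) hδ
      (fun z hz h => hδn ⟨z, Or.inr hz, h⟩) N fun z hz => hN z (Or.inr hz))]
    with t ⟨g₁, hg₁, hN₁⟩ ⟨g₂, hg₂, hN₂⟩
  refine ⟨fun z => if z ∈ (c₁ t₀).pts then g₁ z else g₂ z, ?_, ?_⟩
  · rw [hf, hf, union_inter_distrib_right, union_inter_distrib_right, image_union, hg₁, hg₂]
    congr 1
    · refine image_congr fun z hz => ?_
      rw [if_pos hz.1]
    · refine image_congr fun z hz => ?_
      rw [if_neg (fun h => Set.disjoint_left.1 hd h hz.1)]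
  · rintro z ⟨hz, hzd⟩
    rw [hf] at hz
    dsimp only
    split_ifs with h
    · exact hN₁ z ⟨h, hzd⟩
    · exact hN₂ z ⟨hz.resolve_left h, hzd⟩

/-- The configuration of the points of `c` lying in `S`, with a new weight. -/
def restrict (w' : Z → ℝ) (S : Set Z) (c : Conf pos w) : Conf pos w' where
  pts := {z ∈ c.pts | z ∈ S ∧ 0 < w' z}
  fin := c.fin.subset fun _ h => h.1
  inj := c.inj.mono fun _ h => h.1
  wpos := fun _ h => h.2.2

theorem mem_restrict {w' : Z → ℝ} {S : Set Z} {c : Conf pos w} {z : Z} :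
    z ∈ (restrict w' S c).pts ↔ z ∈ c.pts ∧ z ∈ S ∧ 0 < w' z := Iff.rfl

open Classical in
/-- The points of positive weight of a finite set (empty if this is not a configuration). -/
def ofSet (pos : Z → D) (w : Z → ℝ) (S : Set Z) : Conf pos w :=
  if h : S.Finite ∧ InjOn pos S then
    ⟨{z ∈ S | 0 < w z}, h.1.subset fun _ h => h.1, h.2.mono fun _ h => h.1, fun _ h => h.2⟩
  else ⟨∅, finite_empty, injOn_empty _, fun _ h => h.elim⟩

theorem ofSet_pts {S : Set Z} (h : S.Finite) (h' : InjOn pos S) :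
    (ofSet pos w S).pts = {z ∈ S | 0 < w z} := by
  rw [ofSet, dif_pos ⟨h, h'⟩]

/-- The empty configuration. -/
def empty : Conf pos w := ⟨∅, finite_empty, injOn_empty _, fun _ h => h.elim⟩

@[simp] theorem empty_pts : (empty : Conf pos w).pts = ∅ := rfl

end Conf

/-! ### Homotopy extension for balls -/

theorem exists_glue {T F : Type*} [TopologicalSpace T] [TopologicalSpace F] {A B : Set T}
    (hA : IsClosed A) (hB : IsClosed B) (hAB : ∀ x, x ∈ A ∨ x ∈ B) (f : C(A, F)) (g : C(B, F))
    (h : ∀ x (ha : x ∈ A) (hb : x ∈ B), f ⟨x, ha⟩ = g ⟨x, hb⟩) :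
    ∃ G : C(T, F), (∀ x (hx : x ∈ A), G x = f ⟨x, hx⟩) ∧ ∀ x (hx : x ∈ B), G x = g ⟨x, hx⟩ := by
  classical
  let G : T → F := fun x => if hx : x ∈ A then f ⟨x, hx⟩ else
    g ⟨x, (hAB x).resolve_left hx⟩
  have h1 : ∀ x (hx : x ∈ A), G x = f ⟨x, hx⟩ := fun x hx => dif_pos hx
  have h2 : ∀ x (hx : x ∈ B), G x = g ⟨x, hx⟩ := by
    intro x hx
    by_cases hxA : x ∈ A
    · rw [h1 x hxA, h]
    · exact dif_neg hxA
  have c1 : ContinuousOn G A := by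
    rw [continuousOn_iff_continuous_domRestrict]
    convert f.continuous using 1
    ext x
    exact h1 x x.2
  have c2 : ContinuousOn G B := by
    rw [continuousOn_iff_continuous_domRestrict]
    convert g.continuous using 1
    ext x
    exact h2 x x.2
  have hu : A ∪ B = univ := eq_univ_of_forall hAB
  refine ⟨⟨G, ?_⟩, h1, h2⟩
  rw [← continuousOn_univ, ← hu]
  exact c1.union_of_isClosed c2 hA hB

/-- The closed unit ball. -/
abbrev Bal (V : Type*) [NormedAddCommGroup V] : Type _ := closedBall (0 : V) 1

/-- The unit sphere. -/
abbrev Sph (V : Type*) [NormedAddCommGroup V] : Type _ := sphere (0 : V) 1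

/-- The inclusion of the sphere in the ball. -/
def sphIncl (V : Type*) [NormedAddCommGroup V] : C(Sph V, Bal V) :=
  ⟨fun k => ⟨k.1, sphere_subset_closedBall k.2⟩, by fun_prop⟩

section

variable {V : Type*} [NormedAddCommGroup V]

theorem Bal.norm_le (v : Bal V) : ‖v.1‖ ≤ 1 := mem_closedBall_zero_iff.1 v.2

theorem Sph.norm_eq (v : Sph V) : ‖v.1‖ = 1 := mem_sphere_zero_iff_norm.1 v.2

variable [NormedSpace ℝ V]

/-- The radial retraction onto the ball. -/
def balClamp (V : Type*) [NormedAddCommGroup V] [NormedSpace ℝ V] : C(V, Bal V) :=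
  ⟨fun v => ⟨(max 1 ‖v‖)⁻¹ • v, by
    have h : (0 : ℝ) < max 1 ‖v‖ := lt_max_of_lt_left one_pos
    rw [mem_closedBall_zero_iff, norm_smul, norm_inv, Real.norm_of_nonneg h.le,
      inv_mul_le_iff₀ h, mul_one]
    exact le_max_right _ _⟩, by
    refine Continuous.subtype_mk (Continuous.smul (Continuous.inv₀ (by fun_prop) ?_)
      continuous_id) _
    intro v
    exact (lt_max_of_lt_left one_pos).ne'⟩

theorem balClamp_of_norm_le {v : V} (h : ‖v‖ ≤ 1) :
    balClamp V v = ⟨v, by simpa using h⟩ := by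
  apply Subtype.ext
  simp [balClamp, max_eq_left h]

theorem balClamp_coe (v : Bal V) : balClamp V v.1 = v := balClamp_of_norm_le v.norm_le

variable {F : Type*} [TopologicalSpace F]

/-- Homotopy extension property of the sphere in the ball. -/
theorem exists_hep (g : C(Bal V, F)) (H : C(I × Sph V, F))
    (h0 : ∀ k, H (0, k) = g (sphIncl V k)) :
    ∃ G : C(I × Bal V, F), (∀ v, G (0, v) = g v) ∧ ∀ t k, G (t, sphIncl V k) = H (t, k) := by
  let A : Set (I × Bal V) := {p | ‖p.2.1‖ ≤ (2 - p.1.1) / 2}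
  let B : Set (I × Bal V) := {p | (2 - p.1.1) / 2 ≤ ‖p.2.1‖}
  have hI : ∀ t : I, (0 : ℝ) < 2 - t.1 := fun t => by linarith [t.2.2]
  have hB0 : ∀ p : B, 0 < ‖p.1.2.1‖ := fun p =>
    lt_of_lt_of_le (by linarith [hI p.1.1]) (show (2 - p.1.1.1) / 2 ≤ ‖p.1.2.1‖ from p.2)
  let f1 : C(A, F) := g.comp ⟨fun p => balClamp V ((2 / (2 - p.1.1.1)) • p.1.2.1), by
    refine (balClamp V).continuous.comp (Continuous.smul ?_ (by fun_prop))
    exact continuous_const.div (by fun_prop) fun p => (hI p.1.1).ne'⟩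
  let f2 : C(B, F) := H.comp ⟨fun p => (projIcc 0 1 zero_le_one (2 - (2 - p.1.1.1) / ‖p.1.2.1‖),
      ⟨‖p.1.2.1‖⁻¹ • p.1.2.1, by
        rw [mem_sphere_zero_iff_norm, norm_smul, norm_inv, norm_norm,
          inv_mul_cancel₀ (hB0 p).ne']⟩), by
    refine Continuous.prodMk ?_ (Continuous.subtype_mk (Continuous.smul
      (Continuous.inv₀ (by fun_prop) fun p => (hB0 p).ne') (by fun_prop)) _)
    refine continuous_projIcc.comp (continuous_const.sub (Continuous.div (by fun_prop)
      (by fun_prop) fun p => (hB0 p).ne'))⟩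
  obtain ⟨G, h1, h2⟩ := exists_glue (A := A) (B := B)
    (isClosed_le (by fun_prop) (by fun_prop)) (isClosed_le (by fun_prop) (by fun_prop))
    (fun p => le_total ‖p.2.1‖ ((2 - p.1.1) / 2)) f1 f2 (by
      intro p ha hb
      have he : ‖p.2.1‖ = (2 - p.1.1) / 2 := le_antisymm ha hb
      have hp := hI p.1
      have e1 : projIcc (0 : ℝ) 1 zero_le_one (2 - (2 - p.1.1) / ‖p.2.1‖) = 0 := by
        have : (2 - p.1.1) / ((2 - p.1.1) / 2) = 2 := by field_simp
        rw [he, this, sub_self]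
        exact projIcc_of_le_left zero_le_one le_rfl
      have e2 : ‖p.2.1‖⁻¹ = 2 / (2 - p.1.1) := by rw [he, inv_div]
      show g _ = H (_, _)
      dsimp only
      rw [e1, h0]
      congr 1
      have e3 : ‖(2 / (2 - p.1.1)) • p.2.1‖ ≤ 1 := by
        rw [← e2, norm_smul, norm_inv, norm_norm, inv_mul_cancel₀ (hB0 ⟨p, hb⟩).ne']
      refine (balClamp_of_norm_le e3).trans ?_
      apply Subtype.ext
      show _ = ‖p.2.1‖⁻¹ • p.2.1
      rw [e2])
  refine ⟨G, fun v => ?_, fun t k => ?_⟩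
  · rw [h1 _ (show ‖v.1‖ ≤ (2 - ((0 : I) : ℝ)) / 2 by simpa using v.norm_le)]
    show g (balClamp V ((2 / (2 - ((0 : I) : ℝ))) • v.1)) = g v
    congr 1
    simp only [Icc.coe_zero, sub_zero, ne_eq, OfNat.ofNat_ne_zero, not_false_eq_true, div_self,
      one_smul]
    exact balClamp_coe v
  · have hk : ‖(sphIncl V k).1‖ = 1 := k.norm_eq
    rw [h2 _ (show (2 - t.1) / 2 ≤ ‖(sphIncl V k).1‖ by rw [hk]; linarith [t.2.1])]
    show H (_, _) = _
    dsimp only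
    congr 2
    · rw [hk, div_one, sub_sub_cancel]
      exact projIcc_val zero_le_one t
    · apply Subtype.ext
      show ‖(sphIncl V k).1‖⁻¹ • (sphIncl V k).1 = k.1
      rw [hk, inv_one, one_smul]
      rfl

/-- The restriction to the sphere of a homotopy of maps on the ball can be deformed. -/
theorem exists_deform_trace (Γ : C(I × Bal V, F)) (W : C(I × I × Sph V, F))
    (hW : ∀ t k, W (0, t, k) = Γ (t, sphIncl V k))
    (hW0 : ∀ μ k, W (μ, 0, k) = Γ (0, sphIncl V k))
    (hW1 : ∀ μ k, W (μ, 1, k) = Γ (1, sphIncl V k)) :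
    ∃ Γ' : C(I × Bal V, F), (∀ v, Γ' (0, v) = Γ (0, v)) ∧ (∀ v, Γ' (1, v) = Γ (1, v)) ∧
      ∀ t k, Γ' (t, sphIncl V k) = W (1, t, k) := by
  let toI : C(ℝ, I) := ⟨fun x => projIcc 0 1 zero_le_one ((x + 1) / 2), by fun_prop⟩
  have bal1 : ∀ p : Bal (V × ℝ), ‖p.1.1‖ ≤ 1 := fun p => (norm_fst_le p.1).trans p.norm_le
  let g : C(Bal (V × ℝ), F) := Γ.comp ⟨fun p => (toI p.1.2, ⟨p.1.1, by simpa using bal1 p⟩),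
    by fun_prop⟩
  let A : Set (I × Sph (V × ℝ)) := {p | ‖p.2.1.1‖ = 1}
  let B : Set (I × Sph (V × ℝ)) := {p | ‖p.2.1.2‖ = 1}
  have hs : ∀ p : Sph (V × ℝ), ‖p.1.1‖ = 1 ∨ ‖p.1.2‖ = 1 := by
    intro p
    have := p.norm_eq
    rw [Prod.norm_def] at this
    rcases max_choice ‖p.1.1‖ ‖p.1.2‖ with h | h
    · left; rw [← h]; exact this
    · right; rw [← h]; exact this
  let f1 : C(A, F) := W.comp ⟨fun p =>
    (p.1.1, toI p.1.2.1.2, ⟨p.1.2.1.1, mem_sphere_zero_iff_norm.2 p.2⟩),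
    by fun_prop⟩
  let f2 : C(B, F) := g.comp ⟨fun p => sphIncl (V × ℝ) p.1.2, by fun_prop⟩
  obtain ⟨H, h1, h2⟩ := exists_glue (A := A) (B := B)
    (isClosed_eq (by fun_prop) (by fun_prop)) (isClosed_eq (by fun_prop) (by fun_prop))
    (fun p => hs p.2) f1 f2 (by
      intro p ha hb
      show W (p.1, toI p.2.1.2, _) = Γ (toI p.2.1.2, _)
      have hb' : |p.2.1.2| = 1 := hb
      rcases eq_or_eq_neg_of_abs_eq hb' with h | h
      · have : toI p.2.1.2 = 1 := by
          rw [h]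
          exact projIcc_of_right_le zero_le_one (by norm_num)
        rw [this, hW1]; rfl
      · have : toI p.2.1.2 = 0 := by
          rw [h]
          exact projIcc_of_le_left zero_le_one (by norm_num)
        rw [this, hW0]; rfl)
  obtain ⟨G, hG0, hG1⟩ := exists_hep g H (by
    intro k
    rcases hs k with h | h
    · rw [h1 (0, k) h]
      show W (0, toI k.1.2, _) = _
      rw [hW]; rfl
    · rw [h2 (0, k) h]; rfl)
  have hn : ∀ (t : I) (v : V), ‖v‖ ≤ 1 → ‖(v, 2 * t.1 - 1)‖ ≤ 1 := by
    intro t v hv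
    rw [Prod.norm_def, max_le_iff]
    exact ⟨hv, abs_le.2 ⟨by linarith [t.2.1], by linarith [t.2.2]⟩⟩
  have htoI : ∀ t : I, toI (2 * t.1 - 1) = t := by
    intro t
    show projIcc (0 : ℝ) 1 zero_le_one ((2 * t.1 - 1 + 1) / 2) = t
    rw [sub_add_cancel, mul_div_cancel_left₀ _ two_ne_zero, projIcc_val]
  refine ⟨⟨fun p => G (1, balClamp _ (p.2.1, 2 * p.1.1 - 1)), by fun_prop⟩, ?_, ?_, ?_⟩
  · intro v
    show G (1, balClamp _ (v.1, 2 * ((0 : I) : ℝ) - 1)) = _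
    rw [balClamp_of_norm_le (hn 0 v.1 v.norm_le)]
    have hsph : ‖(v.1, 2 * ((0 : I) : ℝ) - 1)‖ = 1 := by
      rw [Prod.norm_def]; simpa using v.norm_le
    have := hG1 1 ⟨_, mem_sphere_zero_iff_norm.2 hsph⟩
    refine this.trans ?_
    rw [h2 _ (by show ‖2 * ((0 : I) : ℝ) - 1‖ = 1; norm_num)]
    show Γ (toI (2 * ((0 : I) : ℝ) - 1), v) = _
    rw [htoI]
  · intro v
    show G (1, balClamp _ (v.1, 2 * ((1 : I) : ℝ) - 1)) = _
    rw [balClamp_of_norm_le (hn 1 v.1 v.norm_le)]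
    have hsph : ‖(v.1, 2 * ((1 : I) : ℝ) - 1)‖ = 1 := by
      rw [Prod.norm_def]; norm_num; simpa using v.norm_le
    have := hG1 1 ⟨_, mem_sphere_zero_iff_norm.2 hsph⟩
    refine this.trans ?_
    rw [h2 _ (by show ‖2 * ((1 : I) : ℝ) - 1‖ = 1; norm_num)]
    show Γ (toI (2 * ((1 : I) : ℝ) - 1), v) = _
    rw [htoI]
  · intro t k
    show G (1, balClamp _ (k.1, 2 * t.1 - 1)) = _
    rw [balClamp_of_norm_le (hn t k.1 k.norm_eq.le)]
    have hsph : ‖(k.1, 2 * t.1 - 1)‖ = 1 := by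
      refine le_antisymm (hn t k.1 k.norm_eq.le) ?_
      exact k.norm_eq.symm.le.trans (norm_fst_le (k.1, 2 * t.1 - 1))
    have := hG1 1 ⟨_, mem_sphere_zero_iff_norm.2 hsph⟩
    refine this.trans ?_
    rw [h1 _ (by exact k.norm_eq)]
    show W (1, toI (2 * t.1 - 1), k) = _
    rw [htoI]

theorem exists_deform_path {S : Type*} [TopologicalSpace S] {x y : S} (P : C(S × Sph V, F))
    {p q : Path x y} (hpq : p.Homotopic q) (Γ : C(I × Bal V, F))
    (h : ∀ t k, Γ (t, sphIncl V k) = P (p t, k)) :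
    ∃ Γ' : C(I × Bal V, F), (∀ v, Γ' (0, v) = Γ (0, v)) ∧ (∀ v, Γ' (1, v) = Γ (1, v)) ∧
      ∀ t k, Γ' (t, sphIncl V k) = P (q t, k) := by
  obtain ⟨K⟩ := hpq
  obtain ⟨Γ', h0, h1, h2⟩ := exists_deform_trace Γ
    (P.comp ⟨fun x => (K (x.1, x.2.1), x.2.2), by fun_prop⟩) (by intro t k; simp [h])
    (by intro t k; simp [h]) (by intro t k; simp [h])
  refine ⟨Γ', h0, h1, fun t k => ?_⟩
  rw [h2]
  simp

theorem exists_concat {K S K' : Type*} [TopologicalSpace K] [TopologicalSpace K']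
    [TopologicalSpace S] {x y z : S} (ι : K' → K) (P : S × K' → F) (p : Path x y) (q : Path y z)
    (Γ Γ' : C(I × K, F)) (h : ∀ v, Γ (1, v) = Γ' (0, v)) (h1 : ∀ t k, Γ (t, ι k) = P (p t, k))
    (h2 : ∀ t k, Γ' (t, ι k) = P (q t, k)) :
    ∃ Δ : C(I × K, F), (∀ v, Δ (0, v) = Γ (0, v)) ∧ (∀ v, Δ (1, v) = Γ' (1, v)) ∧
      ∀ t k, Δ (t, ι k) = P (p.trans q t, k) := by
  let f0 : C(K, F) := ⟨fun v => Γ (0, v), by fun_prop⟩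
  let f1 : C(K, F) := ⟨fun v => Γ (1, v), by fun_prop⟩
  let f2 : C(K, F) := ⟨fun v => Γ' (1, v), by fun_prop⟩
  let H1 : f0.Homotopy f1 := ⟨Γ, fun _ => rfl, fun _ => rfl⟩
  let H2 : f1.Homotopy f2 := ⟨Γ', fun v => (h v).symm, fun _ => rfl⟩
  refine ⟨(H1.trans H2).toContinuousMap, fun v => (H1.trans H2).map_zero_left v,
    fun v => (H1.trans H2).map_one_left v, fun t k => ?_⟩
  show H1.trans H2 (t, ι k) = _
  rw [ContinuousMap.Homotopy.trans_apply, Path.trans_apply]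
  split_ifs with ht
  · exact h1 _ _
  · exact h2 _ _

theorem unitInterval.path_homotopic {x y : I} (p q : Path x y) : p.Homotopic q := by
  have : ContractibleSpace I := (convex_Icc (0 : ℝ) 1).contractibleSpace ⟨0, by simp⟩
  exact SimplyConnectedSpace.paths_homotopic p q

/-- The identity path of the unit interval. -/
def unitInterval.idPath : Path (0 : I) 1 := ⟨ContinuousMap.id I, rfl, rfl⟩

variable {F₁ F₂ : Type*} [TopologicalSpace F₁] [TopologicalSpace F₂]

/-- The restriction of a parametrized map to a parameter. -/
def slice {T S : Type*} [TopologicalSpace T] [TopologicalSpace S] (f : C(S × T, F)) (s : S) :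
    C(T, F) :=
  f.comp ⟨fun x => (s, x), by fun_prop⟩

@[simp] theorem slice_apply {T S : Type*} [TopologicalSpace T] [TopologicalSpace S]
    (f : C(S × T, F)) (s : S) (x : T) : slice f s x = f (s, x) := rfl

/-- The map `b` on the ball lifts, up to homotopy relative to the sphere, through the family of
maps `f`, with prescribed values `a` on the sphere. -/
def Fillable (f : C(Bal V × F₁, F₂)) (a : C(Sph V, F₁)) (b : C(Bal V, F₂)) : Prop :=
  ∃ (a' : C(Bal V, F₁)) (Γ : C(I × Bal V, F₂)), (∀ k, a' (sphIncl V k) = a k) ∧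
    (∀ v, Γ (0, v) = b v) ∧ (∀ v, Γ (1, v) = f (v, a' v)) ∧
    ∀ t k, Γ (t, sphIncl V k) = b (sphIncl V k)

theorem Fillable.of_square (f : C(I × Bal V × F₁, F₂)) (a : C(I × Sph V, F₁))
    (b : C(I × Bal V, F₂)) (h : ∀ t k, b (t, sphIncl V k) = f (t, sphIncl V k, a (t, k)))
    (hf : Fillable (slice f 1) (slice a 1) (slice b 1)) :
    Fillable (slice f 0) (slice a 0) (slice b 0) := by
  obtain ⟨a₁, Γ₁, ha₁, hΓ0, hΓ1, hΓ⟩ := hf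
  simp only [slice_apply] at ha₁ hΓ0 hΓ1 hΓ
  obtain ⟨A, hA0, hA⟩ := exists_hep a₁ (a.comp ⟨fun p => (unitInterval.symm p.1, p.2), by fun_prop⟩)
    (by intro k; simp [ha₁])
  let Γ₂ : C(I × Bal V, F₂) := ⟨fun p => f (unitInterval.symm p.1, p.2, A p), by fun_prop⟩
  let P : C(I × Sph V, F₂) := ⟨fun p => f (p.1, sphIncl V p.2, a p), by fun_prop⟩
  obtain ⟨Δ, hΔ0, hΔ1, hΔ⟩ := exists_concat (sphIncl V) P unitInterval.idPath
    (Path.refl 1) b Γ₁ (fun v => (hΓ0 v).symm) (fun t k => h t k)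
    (fun t k => (hΓ t k).trans (h 1 k))
  obtain ⟨E, hE0, hE1, hE⟩ := exists_concat (sphIncl V) P (unitInterval.idPath.trans
    (Path.refl 1)) unitInterval.idPath.symm Δ Γ₂ (fun v => by
      rw [hΔ1, hΓ1, ← hA0]; simp [Γ₂]) hΔ (fun t k => by
      simp only [ContinuousMap.coe_mk, hA, ContinuousMap.comp_apply, Γ₂]; rfl)
  obtain ⟨E', hE'0, hE'1, hE'⟩ := exists_deform_path P
    (unitInterval.path_homotopic _ (Path.refl 0)) E hE
  refine ⟨slice A 1, E', fun k => ?_, fun v => ?_, fun v => ?_, fun t k => ?_⟩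
  · simp [hA]
  · rw [hE'0, hE0, hΔ0]; rfl
  · rw [hE'1, hE1]
    simp [Γ₂]
  · rw [hE']
    exact (h 0 k).symm

/-- Every lifting problem against the family of maps `f` has a solution up to homotopy. -/
def Fills (f : C(Bal V × F₁, F₂)) : Prop :=
  ∀ (a : C(Sph V, F₁)) (b : C(Bal V, F₂)), (∀ k, b (sphIncl V k) = f (sphIncl V k, a k)) →
    Fillable f a b

theorem Fills.of_homotopy (f : C(I × Bal V × F₁, F₂)) (h : Fills (slice f 1)) :
    Fills (slice f 0) := by
  intro a b hab
  obtain ⟨B, hB0, hB⟩ := exists_hep b ⟨fun p : I × Sph V => f (p.1, sphIncl V p.2, a p.2),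
    by fun_prop⟩ (fun k => (hab k).symm)
  have hb : slice B 0 = b := by ext v; exact hB0 v
  have := Fillable.of_square f (⟨fun p => a p.2, by fun_prop⟩) B (fun t k => hB t k) (by
    refine h _ _ fun k => ?_
    simp [hB])
  rw [hb] at this
  exact this

theorem Fills.of_homeomorph (e : F₁ ≃ₜ F₂) :
    Fills (⟨fun p : Bal V × F₁ => e p.2, by fun_prop⟩ : C(Bal V × F₁, F₂)) := by
  intro a b hab
  refine ⟨⟨fun v => e.symm (b v), by fun_prop⟩, ⟨fun p => b p.2, by fun_prop⟩, fun k => ?_,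
    fun v => rfl, fun v => ?_, fun t k => rfl⟩
  · simp [hab]
  · simp

end

/-! ### Configurations with levels -/

section Levels

variable {A Q : Type*} [TopologicalSpace A] [TopologicalSpace Q] [T2Space Q]

/-- The position of a point with a level. -/
abbrev lpos (pos : A → Q) : ℝ × A → ℝ × Q := fun z => (z.1, pos z.2)

/-- Weight for which levels are irrelevant. -/
abbrev wC (ω : A → ℝ) : ℝ × A → ℝ := fun z => ω z.2

/-- Weight for which points vanish at level `1`. -/
abbrev wE (ω : A → ℝ) : ℝ × A → ℝ := fun z => min (ω z.2) (1 - z.1)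

/-- Weight for which points vanish at levels `0` and `1`. -/
abbrev wY (ω : A → ℝ) : ℝ × A → ℝ := fun z => min (ω z.2) (min z.1 (1 - z.1))

/-- Configurations with arbitrary levels. -/
abbrev CConf (pos : A → Q) (ω : A → ℝ) := Conf (lpos pos) (wC ω)

/-- Configurations with levels less than `1`. -/
abbrev EConf (pos : A → Q) (ω : A → ℝ) := Conf (lpos pos) (wE ω)

/-- Configurations with levels between `0` and `1`. -/
abbrev YConf (pos : A → Q) (ω : A → ℝ) := Conf (lpos pos) (wY ω)

/-- Two configurations have the same points above level `η`. -/
def Lifts (η : ℝ) (c d : Set (ℝ × A)) : Prop := ∀ z : ℝ × A, η < z.1 → (z ∈ c ↔ z ∈ d)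

theorem Lifts.mono {η η' : ℝ} {c d : Set (ℝ × A)} (h : Lifts η c d) (hη : η ≤ η') :
    Lifts η' c d := fun z hz => h z (hη.trans_lt hz)

/-- The set of points avoids the level `L`. -/
def Avoids (L : ℝ) (c : Set (ℝ × A)) : Prop := ∀ z ∈ c, z.1 ≠ L

theorem Lifts.avoids {η L : ℝ} {c d : Set (ℝ × A)} (h : Lifts η c d) (hL : η < L)
    (hd : Avoids L d) : Avoids L c := fun z hz hzL => hd z ((h z (hzL ▸ hL)).1 hz) hzL

variable {pos : A → Q} {ω : A → ℝ}

theorem wC_pos_of_wE {z : ℝ × A} (h : 0 < wE ω z) : 0 < wC ω z := (lt_min_iff.1 h).1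

theorem wE_pos_of_wY {z : ℝ × A} (h : 0 < wY ω z) : 0 < wE ω z := by
  obtain ⟨h1, h2⟩ := lt_min_iff.1 h
  exact lt_min h1 (lt_min_iff.1 h2).2

variable {T : Type*} [TopologicalSpace T]

theorem nhds_dichotomy_lt {L : ℝ} {z : ℝ × A} (h : z.1 ≠ L) :
    {z : ℝ × A | z.1 < L} ∈ 𝓝 z ∨ {z : ℝ × A | z.1 < L}ᶜ ∈ 𝓝 z := by
  rcases lt_or_gt_of_ne h with h | h
  · exact Or.inl ((isOpen_lt continuous_fst continuous_const).mem_nhds h)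
  · refine Or.inr (Filter.mem_of_superset
      ((isOpen_lt continuous_const continuous_fst).mem_nhds h) ?_)
    intro x (hx : L < x.1)
    exact not_lt.2 hx.le

theorem nhds_dichotomy_gt {L : ℝ} {z : ℝ × A} (h : z.1 ≠ L) :
    {z : ℝ × A | L < z.1} ∈ 𝓝 z ∨ {z : ℝ × A | L < z.1}ᶜ ∈ 𝓝 z := by
  rcases lt_or_gt_of_ne h with h | h
  · refine Or.inr (Filter.mem_of_superset
      ((isOpen_lt continuous_fst continuous_const).mem_nhds h) ?_)
    intro x (hx : x.1 < L)
    exact not_lt.2 hx.le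
  · exact Or.inl ((isOpen_lt continuous_const continuous_fst).mem_nhds h)

theorem continuous_lpos (hpos : Continuous pos) : Continuous (lpos pos) := by fun_prop

/-- The join of the part of `c` below level `L` and the part of `y` above. -/
def cutJoin {w w' : ℝ × A → ℝ} (L : ℝ) (c : Conf (lpos pos) w) (y : Conf (lpos pos) w')
    (w'' : ℝ × A → ℝ) : Conf (lpos pos) w'' :=
  Conf.ofSet _ _ ({z ∈ c.pts | z.1 < L} ∪ {z ∈ y.pts | L < z.1})

theorem injOn_cut {w w' : ℝ × A → ℝ} (L : ℝ) (c : Conf (lpos pos) w) (y : Conf (lpos pos) w') :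
    InjOn (lpos pos) ({z ∈ c.pts | z.1 < L} ∪ {z ∈ y.pts | L < z.1}) := by
  rintro a (⟨ha, ha'⟩ | ⟨ha, ha'⟩) b (⟨hb, hb'⟩ | ⟨hb, hb'⟩) h
  · exact c.inj ha hb h
  · have : a.1 = b.1 := (Prod.ext_iff.1 (show (a.1, pos a.2) = (b.1, pos b.2) from h)).1
    exact absurd (ha'.trans (this ▸ hb')) (lt_irrefl _)
  · have : a.1 = b.1 := (Prod.ext_iff.1 (show (a.1, pos a.2) = (b.1, pos b.2) from h)).1
    exact absurd (hb'.trans (this ▸ ha')) (lt_irrefl _)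
  · exact y.inj ha hb h

theorem cutJoin_pts {w w' w'' : ℝ × A → ℝ} (L : ℝ) (c : Conf (lpos pos) w)
    (y : Conf (lpos pos) w') :
    (cutJoin L c y w'').pts =
      {z ∈ {z ∈ c.pts | z.1 < L} ∪ {z ∈ y.pts | L < z.1} | 0 < w'' z} :=
  Conf.ofSet_pts ((c.fin.subset fun _ h => h.1).union (y.fin.subset fun _ h => h.1))
    (injOn_cut L c y)

theorem continuousAt_cutJoin {w w' w'' : ℝ × A → ℝ} (hpos : Continuous pos) (hw : Continuous w)
    (hw' : Continuous w') (hw'' : Continuous w'') {L : ℝ} {c : T → Conf (lpos pos) w}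
    {y : T → Conf (lpos pos) w'} {t₀ : T} (hc : ContinuousAt c t₀) (hy : ContinuousAt y t₀)
    (hcL : Avoids L (c t₀).pts) (hyL : Avoids L (y t₀).pts)
    (h₁ : ∀ δ > 0, ∃ δ' > 0, ∀ z : ℝ × A, z.1 < L → δ ≤ w'' z → δ' ≤ w z)
    (h₂ : ∀ δ > 0, ∃ δ' > 0, ∀ z : ℝ × A, L < z.1 → δ ≤ w'' z → δ' ≤ w' z) :
    ContinuousAt (fun t => cutJoin L (c t) (y t) w'') t₀ := by
  refine Conf.continuousAt_union (continuous_lpos hpos) hw''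
    (c₁ := fun t => (c t).restrict w'' {z | z.1 < L})
    (c₂ := fun t => (y t).restrict w'' {z | L < z.1}) ?_ ?_ ?_ ?_
  · exact Conf.continuousAt_restrict (continuous_lpos hpos) hw hw'' {z | z.1 < L} hc
      (fun t => rfl) (fun z hz => nhds_dichotomy_lt (hcL z hz)) h₁
  · exact Conf.continuousAt_restrict (continuous_lpos hpos) hw' hw'' {z | L < z.1} hy
      (fun t => rfl) (fun z hz => nhds_dichotomy_gt (hyL z hz)) h₂
  · intro t
    rw [cutJoin_pts]
    ext z
    constructor
    · rintro ⟨⟨h1, h2⟩ | ⟨h1, h2⟩, h3⟩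
      · exact Or.inl ⟨h1, h2, h3⟩
      · exact Or.inr ⟨h1, h2, h3⟩
    · rintro (⟨h1, h2, h3⟩ | ⟨h1, h2, h3⟩)
      · exact ⟨Or.inl ⟨h1, h2⟩, h3⟩
      · exact ⟨Or.inr ⟨h1, h2⟩, h3⟩
  · refine Set.disjoint_left.2 ?_
    rintro z ⟨_, h2, _⟩ ⟨_, h5, _⟩
    exact absurd (lt_trans (show z.1 < L from h2) h5) (lt_irrefl _)

theorem wE_le_wY {L δ : ℝ} (z : ℝ × A) (hz : L < z.1) (h : δ ≤ wE ω z) :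
    min δ L ≤ wY ω z := by
  obtain ⟨h1, h2⟩ := le_min_iff.1 h
  exact le_min ((min_le_left _ _).trans h1)
    (le_min ((min_le_right _ _).trans hz.le) ((min_le_left _ _).trans h2))

/-! ### Moving lifts along a homotopy -/

/-- Linear interpolation in the unit interval. -/
def unitInterval.lerp (s a b : I) : I :=
  ⟨(1 - s.1) * a.1 + s.1 * b.1, (convex_Icc (0 : ℝ) 1) a.2 b.2
    (sub_nonneg.2 s.2.2) s.2.1 (by ring)⟩

open unitInterval (lerp)

@[fun_prop] theorem unitInterval.continuous_lerp {f g h : T → I} (hf : Continuous f)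
    (hg : Continuous g) (hh : Continuous h) : Continuous fun t => lerp (f t) (g t) (h t) := by
  unfold lerp
  fun_prop

@[simp] theorem unitInterval.lerp_zero (a b : I) : lerp 0 a b = a := by
  apply Subtype.ext; simp [lerp]

@[simp] theorem unitInterval.lerp_one (a b : I) : lerp 1 a b = b := by
  apply Subtype.ext; simp [lerp]

/-- Locally, points avoid many levels. -/
def Sparse (y : T → YConf pos ω) : Prop :=
  ∀ p, ∀ a b : ℝ, 0 < a → a < b → b < 1 → ∃ L, a < L ∧ L < b ∧ ∀ᶠ q in 𝓝 p, Avoids L (y q).pts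

theorem Sparse.comp {T' : Type*} [TopologicalSpace T'] {y : T → YConf pos ω} (hy : Sparse y)
    {f : T' → T} (hf : Continuous f) : Sparse fun t => y (f t) := by
  intro p a b h0 h1 h2
  obtain ⟨L, ha, hb, h⟩ := hy (f p) a b h0 h1 h2
  exact ⟨L, ha, hb, hf.continuousAt.eventually h⟩

theorem cutJoin_lifts {w : ℝ × A → ℝ} (L : ℝ) (c : Conf (lpos pos) w) (y : YConf pos ω) :
    Lifts L (cutJoin L c y (wE ω)).pts y.pts := by
  intro z hz
  rw [cutJoin_pts]
  constructor
  · rintro ⟨⟨h1, h2⟩ | ⟨h1, h2⟩, h3⟩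
    · exact absurd (hz.trans h2) (lt_irrefl _)
    · exact h1
  · intro h
    exact ⟨Or.inr ⟨h, hz⟩, wE_pos_of_wY (y.wpos z h)⟩

theorem cutJoin_eq_self {η L : ℝ} {c : EConf pos ω} {y : YConf pos ω} (h : Lifts η c.pts y.pts)
    (hη : η < L) (hL : Avoids L y.pts) : cutJoin L c y (wE ω) = c := by
  apply Conf.ext
  rw [cutJoin_pts]
  ext z
  constructor
  · rintro ⟨⟨h1, h2⟩ | ⟨h1, h2⟩, h3⟩
    · exact h1
    · exact (h z (hη.trans h2)).2 h1
  · intro hz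
    refine ⟨?_, c.wpos z hz⟩
    rcases lt_trichotomy z.1 L with h1 | h1 | h1
    · exact Or.inl ⟨hz, h1⟩
    · exact absurd h1 (h.avoids hη hL z hz)
    · exact Or.inr ⟨(h z (hη.trans h1)).1 hz, h1⟩

theorem continuous_wC (hω : Continuous ω) : Continuous (wC ω) := by fun_prop
theorem continuous_wE (hω : Continuous ω) : Continuous (wE ω) := by fun_prop
theorem continuous_wY (hω : Continuous ω) : Continuous (wY ω) := by fun_prop

theorem continuousAt_cutJoin_EY (hpos : Continuous pos) (hω : Continuous ω) {L : ℝ} (h0 : 0 < L)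
    {c : T → EConf pos ω} {y : T → YConf pos ω} {t₀ : T} (hc : ContinuousAt c t₀)
    (hy : ContinuousAt y t₀) (hcL : Avoids L (c t₀).pts) (hyL : Avoids L (y t₀).pts) :
    ContinuousAt (fun t => cutJoin L (c t) (y t) (wE ω)) t₀ :=
  continuousAt_cutJoin hpos (continuous_wE hω) (continuous_wY hω) (continuous_wE hω) hc hy hcL hyL
    (fun δ hδ => ⟨δ, hδ, fun _ _ h => h⟩)
    (fun δ hδ => ⟨min δ L, lt_min hδ h0, fun z hz h => wE_le_wY z hz h⟩)

theorem exists_advance {K : Type*} [TopologicalSpace K] [CompactSpace K] [T2Space K]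
    (hpos : Continuous pos) (hω : Continuous ω)
    (h : C(I × K, YConf pos ω)) (hs : Sparse h) (t₀ : I) {a b : ℝ} (ha : 0 < a) (hab : a < b)
    (hb : b < 1) :
    ∃ J ∈ 𝓝 t₀, ∀ t ∈ J, ∀ t' ∈ J, ∀ e : C(K, EConf pos ω),
      (∀ k, Lifts a (e k).pts (h (t, k)).pts) → ∃ e' : C(K, EConf pos ω),
        (∀ k, Lifts b (e' k).pts (h (t', k)).pts) ∧
        ∀ k, (∀ s, h (s, k) = h (0, k)) → e' k = e k := by
  classical
  have h1 : ∀ k : K, ∃ (L : ℝ) (J : Set I) (U : Set K), a < L ∧ L < b ∧ J ∈ 𝓝 t₀ ∧ U ∈ 𝓝 k ∧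
      ∀ t ∈ J, ∀ x ∈ U, Avoids L (h (t, x)).pts := by
    intro k
    obtain ⟨L, h1, h2, h3⟩ := hs (t₀, k) a b ha hab hb
    rw [nhds_prod_eq] at h3
    obtain ⟨J, hJ, U, hU, hJU⟩ := Filter.eventually_prod_iff.1 h3
    exact ⟨L, {t | J t}, {x | U x}, h1, h2, hJ, hU, fun t ht x hx => hJU ht hx⟩
  choose L J U haL hLb hJ hU hJU using h1
  obtain ⟨s, hsU⟩ := CompactSpace.elim_nhds_subcover (fun k => interior (U k))
    fun k => interior_mem_nhds.2 (hU k)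
  have hJ' : (⋂ k ∈ s, J k) ∈ 𝓝 t₀ := (Filter.biInter_finset_mem s).2 fun k _ => hJ k
  obtain ⟨ε, hε, hεJ⟩ := Metric.mem_nhds_iff.1 hJ'
  refine ⟨ball t₀ ε, ball_mem_nhds _ hε, fun t ht t' ht' e he => ?_⟩
  have hlerp : ∀ r : I, lerp r t t' ∈ ball t₀ ε := by
    intro r
    exact (convex_ball (t₀ : ℝ) ε) (show t.1 ∈ ball (t₀ : ℝ) ε from ht) ht'
      (sub_nonneg.2 r.2.2) r.2.1 (by ring)
  let V : ℝ → Set K := fun l => ⋃ k ∈ s.filter (fun k => L k = l), interior (U k)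
  have hVo : ∀ l, IsOpen (V l) := fun l =>
    isOpen_biUnion fun k _ => isOpen_interior
  have hVL : ∀ l, ∀ k ∈ V l, ∀ τ ∈ ball t₀ ε, Avoids l (h (τ, k)).pts := by
    intro l k hk τ hτ
    simp only [V, mem_iUnion, Finset.mem_filter] at hk
    obtain ⟨k', ⟨hk's, rfl⟩, hk⟩ := hk
    exact hJU k' τ (mem_iInter₂.1 (hεJ hτ) k' hk's) k (interior_subset hk)
  have hVc : (univ : Set K) ⊆ ⋃ l, V l := by
    intro k _
    have : k ∈ ⋃ x ∈ s, interior (U x) := by rw [hsU]; trivial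
    obtain ⟨x, hx, hk⟩ := mem_iUnion₂.1 this
    exact mem_iUnion.2 ⟨L x, mem_iUnion₂.2 ⟨x, Finset.mem_filter.2 ⟨hx, rfl⟩, hk⟩⟩
  obtain ⟨f, hf⟩ := PartitionOfUnity.exists_isSubordinate isClosed_univ V hVo hVc
  let r : Finset ℝ → K → I := fun S k => projIcc 0 1 zero_le_one (∑ l ∈ S, f l k)
  have hr : ∀ S, Continuous (r S) := fun S => continuous_projIcc.comp
    (continuous_finsetSum S fun l _ => (f l).continuous)
  have key : ∀ S : Finset ℝ, S ⊆ s.image L → ∃ (e' : C(K, EConf pos ω)) (η : ℝ), a ≤ η ∧ η < b ∧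
      (∀ m, a < m → (∀ l ∈ S, l < m) → η < m) ∧
      (∀ k, Lifts η (e' k).pts (h (lerp (r S k) t t', k)).pts) ∧
      ∀ k, (∀ s, h (s, k) = h (0, k)) → e' k = e k := by
    intro S
    induction S using Finset.induction_on_max with
    | empty =>
      refine fun _ => ⟨e, a, le_rfl, hab, fun m hm _ => hm, fun k => ?_, fun _ _ => rfl⟩
      have : r ∅ k = 0 := by simp [r]
      rw [this, unitInterval.lerp_zero]
      exact he k
    | insert m S hm ih =>
      intro hS
      obtain ⟨e₁, η, haη, hηb, hη, hl, hk⟩ := ih ((Finset.subset_insert _ _).trans hS)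
      obtain ⟨k₀, -, rfl⟩ := Finset.mem_image.1 (hS (Finset.mem_insert_self _ _))
      set m := L k₀
      have hηm : η < m := hη m (haL k₀) hm
      have hmS : m ∉ S := fun h => lt_irrefl _ (hm m h)
      let y : K → YConf pos ω := fun k => h (lerp (r (insert m S) k) t t', k)
      have hyc : Continuous y := by
        have := hr (insert m S)
        fun_prop
      let e₂ : K → EConf pos ω := fun k => cutJoin m (e₁ k) (y k) (wE ω)
      have heq : ∀ k ∈ V m, f m k = 0 → e₂ k = e₁ k := by
        intro k hk hfk
        have hrk : r (insert m S) k = r S k := by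
          simp only [r]
          rw [Finset.sum_insert hmS, hfk, zero_add]
        refine cutJoin_eq_self (η := η) ?_ hηm (hVL m k hk _ (hlerp _))
        simp only [y]
        rw [hrk]
        exact hl k
      have he₂ : ∀ k ∈ V m, ContinuousAt e₂ k := by
        intro k hk
        refine continuousAt_cutJoin_EY hpos hω (ha.trans (haL k₀)) e₁.continuous.continuousAt
          hyc.continuousAt ?_ (hVL m k hk _ (hlerp _))
        exact (hl k).avoids hηm (hVL m k hk _ (hlerp _))
      let e₃ : K → EConf pos ω := fun k => if k ∈ tsupport (f m) then e₂ k else e₁ k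
      have he₃ : Continuous e₃ := by
        refine continuous_iff_continuousAt.2 fun k => ?_
        by_cases hk : k ∈ tsupport (f m)
        · have hkV : k ∈ V m := hf m hk
          refine (he₂ k hkV).congr ?_
          filter_upwards [(hVo m).mem_nhds hkV] with x hx
          simp only [e₃]
          split_ifs with hxs
          · rfl
          · exact heq x hx (image_eq_zero_of_notMem_tsupport hxs)
        · refine (e₁.continuous.continuousAt (x := k)).congr ?_
          filter_upwards [(isClosed_tsupport (f m)).isOpen_compl.mem_nhds hk] with x hx
          simp only [e₃]
          rw [if_neg hx]
      refine ⟨⟨e₃, he₃⟩, m, (haL k₀).le, hLb k₀, fun m' _ h => h m (Finset.mem_insert_self _ _),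
        fun k => ?_, fun k hck => ?_⟩
      · change Lifts m (if k ∈ tsupport (f m) then e₂ k else e₁ k).pts (y k).pts
        split_ifs with hxs
        · exact cutJoin_lifts m _ _
        · have hrk : r (insert m S) k = r S k := by
            simp only [r]
            rw [Finset.sum_insert hmS, image_eq_zero_of_notMem_tsupport hxs, zero_add]
          simp only [y]
          rw [hrk]
          exact (hl k).mono hηm.le
      · change (if k ∈ tsupport (f m) then e₂ k else e₁ k) = e k
        split_ifs with hxs
        · rw [← hk k hck]
          refine cutJoin_eq_self (η := η) ?_ hηm (hVL m k (hf m hxs) _ (hlerp _))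
          simp only [y]
          rw [hck, ← hck (lerp (r S k) t t')]
          exact hl k
        · exact hk k hck
  obtain ⟨e', η, -, hηb, -, hl, hc⟩ := key _ subset_rfl
  refine ⟨e', fun k => ?_, hc⟩
  have h1 : ∑ l ∈ s.image L, f l k = 1 := by
    rw [← f.sum_eq_one (mem_univ k)]
    refine (finsum_eq_sum_of_support_subset _ ?_).symm
    intro l hl
    have hkV : k ∈ V l := hf l (subset_tsupport _ hl)
    obtain ⟨x, hx, -⟩ := mem_iUnion₂.1 hkV
    exact Finset.mem_coe.2 (Finset.mem_image.2 ⟨x, (Finset.mem_filter.1 hx).1,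
      (Finset.mem_filter.1 hx).2⟩)
  have h2 : r (s.image L) k = 1 := by
    simp only [r]
    rw [h1]
    exact projIcc_of_right_le zero_le_one le_rfl
  have := hl k
  rw [h2, unitInterval.lerp_one] at this
  exact this.mono hηb.le

end Levels

section Small

variable {A Q : Type*} [TopologicalSpace A] [TopologicalSpace Q] [T2Space Q]
  {pos : A → Q} {ω : A → ℝ} {T : Type*} [TopologicalSpace T]

/-- The configuration obtained by applying `θ` to levels. -/
def levelMap {w : ℝ × A → ℝ} (θ : ℝ → ℝ) (c : Conf (lpos pos) w) (w' : ℝ × A → ℝ) :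
    Conf (lpos pos) w' :=
  Conf.ofSet _ _ ((fun z : ℝ × A => (θ z.1, z.2)) '' c.pts)

theorem levelMap_pts {w w' : ℝ × A → ℝ} {θ : ℝ → ℝ} {c : Conf (lpos pos) w}
    (hθ : InjOn θ (Prod.fst '' c.pts)) :
    (levelMap θ c w').pts = {z ∈ (fun z : ℝ × A => (θ z.1, z.2)) '' c.pts | 0 < w' z} := by
  refine Conf.ofSet_pts (c.fin.image _) ?_
  rintro _ ⟨a, ha, rfl⟩ _ ⟨b, hb, rfl⟩ h
  obtain ⟨h1, h2⟩ := Prod.ext_iff.1 (show (θ a.1, pos a.2) = (θ b.1, pos b.2) from h)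
  have := hθ ⟨a, ha, rfl⟩ ⟨b, hb, rfl⟩ h1
  rw [c.inj ha hb (Prod.ext this h2)]

theorem continuousAt_levelMap {w w' : ℝ × A → ℝ} (hpos : Continuous pos) (hw : Continuous w)
    (hw' : Continuous w') {θ : T → ℝ → ℝ} {c : T → Conf (lpos pos) w} {t₀ : T}
    (hc : ContinuousAt c t₀) (hθ : ∀ z ∈ (c t₀).pts, ContinuousAt (fun p : T × ℝ => θ p.1 p.2)
      (t₀, z.1))
    (hinj : ∀ t, InjOn (θ t) (Prod.fst '' (c t).pts))
    (hctl : ∀ δ > 0, ∃ δ' > 0, ∀ᶠ t in 𝓝 t₀, ∀ z : ℝ × A, δ ≤ w' (θ t z.1, z.2) → δ' ≤ w z) :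
    ContinuousAt (fun t => levelMap (θ t) (c t) w') t₀ := by
  have hψ : ∀ z ∈ (c t₀).pts, ContinuousAt (fun p : T × (ℝ × A) => (θ p.1 p.2.1, p.2.2))
      (t₀, z) := by
    intro z hz
    refine ContinuousAt.prodMk ?_ (by fun_prop)
    exact ContinuousAt.comp (f := fun p : T × (ℝ × A) => (p.1, p.2.1))
      (x := (t₀, z)) (hθ z hz) (by fun_prop)
  refine Conf.continuousAt_push (ψ := fun t z => (θ t z.1, z.2))
    (v := fun t z => w' (θ t z.1, z.2)) (continuous_lpos hpos) hw hc ?_ (fun _ _ _ _ => rfl) ?_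
    (fun z hz _ => hψ z hz) (fun z hz => hw'.continuousAt.comp (hψ z hz)) hctl
  · intro t
    rw [levelMap_pts (hinj t)]
    ext z
    constructor
    · rintro ⟨⟨x, hx, rfl⟩, h⟩
      exact ⟨x, ⟨hx, h⟩, rfl⟩
    · rintro ⟨x, ⟨hx, h⟩, rfl⟩
      exact ⟨⟨x, hx, rfl⟩, h⟩
  · rintro a ⟨ha, -⟩ b ⟨hb, -⟩ h
    obtain ⟨h1, h2⟩ := Prod.ext_iff.1 h
    exact Prod.ext (hinj t₀ ⟨a, ha, rfl⟩ ⟨b, hb, rfl⟩ h1) h2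

/-- Every configuration can be moved to the empty one, without introducing new levels. -/
def Vanishes (pos : A → Q) (ω : A → ℝ) : Prop :=
  ∀ c : CConf pos ω, ∃ μ : C(I, CConf pos ω), (μ 0).pts = ∅ ∧ μ 1 = c ∧
    ∀ τ, ∀ z ∈ (μ τ).pts, ∃ z' ∈ c.pts, z.1 = z'.1

/-- Configurations with levels less than `L`. -/
abbrev BConf (pos : A → Q) (ω : A → ℝ) (L : ℝ) := {c : CConf pos ω // ∀ z ∈ c.pts, z.1 < L}

/-- Configurations with levels between `ℓ` and `L`. -/
abbrev MConf (pos : A → Q) (ω : A → ℝ) (ℓ L : ℝ) :=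
  {c : CConf pos ω // ∀ z ∈ c.pts, ℓ < z.1 ∧ z.1 < L}

theorem injOn_join {ℓ L : ℝ} (d : BConf pos ω ℓ) (m : MConf pos ω ℓ L) :
    InjOn (lpos pos) (d.1.pts ∪ m.1.pts) := by
  rintro a (ha | ha) b (hb | hb) h
  · exact d.1.inj ha hb h
  · have h1 := (Prod.ext_iff.1 (show (a.1, pos a.2) = (b.1, pos b.2) from h)).1
    linarith [d.2 a ha, (m.2 b hb).1]
  · have h1 := (Prod.ext_iff.1 (show (a.1, pos a.2) = (b.1, pos b.2) from h)).1
    linarith [d.2 b hb, (m.2 a ha).1]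
  · exact m.1.inj ha hb h

theorem join_pts {ℓ L : ℝ} (d : BConf pos ω ℓ) (m : MConf pos ω ℓ L) :
    (Conf.ofSet (lpos pos) (wC ω) (d.1.pts ∪ m.1.pts)).pts = d.1.pts ∪ m.1.pts := by
  rw [Conf.ofSet_pts (d.1.fin.union m.1.fin) (injOn_join d m)]
  ext z
  exact ⟨fun h => h.1, fun h => ⟨h, h.elim (d.1.wpos z) (m.1.wpos z)⟩⟩

/-- The union of a configuration with levels less than `ℓ` and one with levels between
`ℓ` and `L`. -/
def joinMap (hpos : Continuous pos) (hω : Continuous ω) {ℓ L : ℝ} (hℓ : ℓ < L) :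
    C(BConf pos ω ℓ × MConf pos ω ℓ L, BConf pos ω L) where
  toFun p := ⟨Conf.ofSet _ _ (p.1.1.pts ∪ p.2.1.pts), by
    rw [join_pts]
    rintro z (h | h)
    · exact (p.1.2 z h).trans hℓ
    · exact (p.2.2 z h).2⟩
  continuous_toFun := by
    refine Continuous.subtype_mk (continuous_iff_continuousAt.2 fun p => ?_) _
    refine Conf.continuousAt_union (continuous_lpos hpos) (continuous_wC hω)
      (c₁ := fun p : BConf pos ω ℓ × MConf pos ω ℓ L => p.1.1) (c₂ := fun p => p.2.1)
      (by fun_prop) (by fun_prop) (fun p => join_pts p.1 p.2) ?_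
    refine Set.disjoint_left.2 fun z h h' => ?_
    exact absurd ((p.1.2 z h).trans (p.2.2 z h').1) (lt_irrefl _)

@[simp] theorem joinMap_pts (hpos : Continuous pos) (hω : Continuous ω) {ℓ L : ℝ} (hℓ : ℓ < L)
    (p : BConf pos ω ℓ × MConf pos ω ℓ L) :
    (joinMap hpos hω hℓ p).1.pts = p.1.1.pts ∪ p.2.1.pts := join_pts _ _

/-- Shifting the levels. -/
def shiftConf (c : CConf pos ω) (τ : ℝ) : CConf pos ω := levelMap (· + τ) c (wC ω)

theorem shiftConf_pts (c : CConf pos ω) (τ : ℝ) :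
    (shiftConf c τ).pts = (fun z : ℝ × A => (z.1 + τ, z.2)) '' c.pts := by
  rw [shiftConf, levelMap_pts (add_left_injective τ).injOn]
  ext z
  refine ⟨fun h => h.1, fun h => ⟨h, ?_⟩⟩
  obtain ⟨x, hx, rfl⟩ := h
  exact c.wpos x hx

theorem continuous_shiftConf (hpos : Continuous pos) (hω : Continuous ω) :
    Continuous fun p : CConf pos ω × ℝ => shiftConf p.1 p.2 := by
  refine continuous_iff_continuousAt.2 fun p => ?_
  refine continuousAt_levelMap hpos (continuous_wC hω) (continuous_wC hω)
    (θ := fun (p : CConf pos ω × ℝ) s => s + p.2) (c := fun p => p.1) (by fun_prop)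
    (fun z _ => by fun_prop) (fun t => (add_left_injective _).injOn)
    fun δ hδ => ⟨δ, hδ, Filter.Eventually.of_forall fun t z h => h⟩

theorem shiftConf_shiftConf (c : CConf pos ω) (τ τ' : ℝ) :
    shiftConf (shiftConf c τ) τ' = shiftConf c (τ + τ') := by
  apply Conf.ext
  simp only [shiftConf_pts, image_image, add_assoc]

theorem shiftConf_zero (c : CConf pos ω) : shiftConf c 0 = c := by
  apply Conf.ext
  simp [shiftConf_pts]

theorem shiftConf_lt {c : CConf pos ω} {ℓ : ℝ} (h : ∀ z ∈ c.pts, z.1 < ℓ) {L τ : ℝ}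
    (hτ : ℓ + τ ≤ L) : ∀ z ∈ (shiftConf c τ).pts, z.1 < L := by
  rw [shiftConf_pts]
  rintro _ ⟨z, hz, rfl⟩
  exact (add_lt_add_left (h z hz) τ).trans_le hτ

/-- The homeomorphism shifting the levels. -/
def shiftHomeo (hpos : Continuous pos) (hω : Continuous ω) (ℓ L : ℝ) :
    BConf pos ω ℓ ≃ₜ BConf pos ω L where
  toFun c := ⟨shiftConf c.1 (L - ℓ), shiftConf_lt c.2 (by simp)⟩
  invFun c := ⟨shiftConf c.1 (ℓ - L), shiftConf_lt c.2 (by simp)⟩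
  left_inv c := by
    apply Subtype.ext
    simp [shiftConf_shiftConf, shiftConf_zero]
  right_inv c := by
    apply Subtype.ext
    simp [shiftConf_shiftConf, shiftConf_zero]
  continuous_toFun := ((continuous_shiftConf hpos hω).comp
    (continuous_subtype_val.prodMk continuous_const)).subtype_mk _
  continuous_invFun := ((continuous_shiftConf hpos hω).comp
    (continuous_subtype_val.prodMk continuous_const)).subtype_mk _

variable {V : Type*} [NormedAddCommGroup V] [NormedSpace ℝ V]

/-- Scaling of the ball. -/
def balScale (V : Type*) [NormedAddCommGroup V] [NormedSpace ℝ V] : C(I × Bal V, Bal V) where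
  toFun p := ⟨p.1.1 • p.2.1, by
    rw [mem_closedBall_zero_iff, norm_smul, Real.norm_of_nonneg p.1.2.1]
    exact mul_le_one₀ p.1.2.2 (norm_nonneg _) p.2.norm_le⟩

theorem balScale_one (v : Bal V) : balScale V (1, v) = v := by
  apply Subtype.ext; simp [balScale]

theorem balScale_zero (v : Bal V) : balScale V (0, v) = ⟨0, by simp⟩ := by
  apply Subtype.ext; simp [balScale]

theorem Fills.join (hpos : Continuous pos) (hω : Continuous ω) (hvan : Vanishes pos ω) {ℓ L : ℝ}
    (hℓ : ℓ < L) (m : C(Bal V, MConf pos ω ℓ L)) :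
    Fills (⟨fun p : Bal V × BConf pos ω ℓ => joinMap hpos hω hℓ (p.2, m p.1), by fun_prop⟩ :
      C(Bal V × BConf pos ω ℓ, BConf pos ω L)) := by
  let f₁ : C(I × Bal V × BConf pos ω ℓ, BConf pos ω L) :=
    ⟨fun p => joinMap hpos hω hℓ (p.2.2, m (balScale V (unitInterval.symm p.1, p.2.1))),
      by fun_prop⟩
  obtain ⟨μ, hμ0, hμ1, hμ⟩ := hvan (m ⟨0, by simp⟩).1
  let μ' : C(I, MConf pos ω ℓ L) := ⟨fun τ => ⟨μ τ, fun z hz => by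
    obtain ⟨z', hz', h⟩ := hμ τ z hz
    rw [h]
    exact (m ⟨0, by simp⟩).2 z' hz'⟩, by fun_prop⟩
  let f₂ : C(I × Bal V × BConf pos ω ℓ, BConf pos ω L) :=
    ⟨fun p => joinMap hpos hω hℓ (p.2.2, μ' (unitInterval.symm p.1)), by fun_prop⟩
  let f₃ : C(I × Bal V × BConf pos ω ℓ, BConf pos ω L) :=
    ⟨fun p => ⟨shiftConf p.2.2.1 (p.1 * (L - ℓ)), by
      rw [shiftConf_pts]
      rintro _ ⟨z, hz, rfl⟩
      have := p.2.2.2 z hz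
      have h1 : p.1.1 * (L - ℓ) ≤ L - ℓ := mul_le_of_le_one_left (by linarith) p.1.2.2
      simp only
      linarith⟩, by
      refine Continuous.subtype_mk ?_ _
      exact (continuous_shiftConf hpos hω).comp (by fun_prop :
        Continuous fun p : I × Bal V × BConf pos ω ℓ => (p.2.2.1, p.1.1 * (L - ℓ)))⟩
  have h₃ : Fills (slice f₃ 1) := by
    convert Fills.of_homeomorph (V := V) (shiftHomeo hpos hω ℓ L) using 1
    ext p : 1
    apply Subtype.ext
    simp [f₃, shiftHomeo]
  have h₂ : Fills (slice f₂ 1) := by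
    convert Fills.of_homotopy f₃ h₃ using 1
    ext p : 1
    apply Subtype.ext
    apply Conf.ext
    simp [f₂, f₃, shiftConf_zero, μ', hμ0]
  have h₁ : Fills (slice f₁ 1) := by
    convert Fills.of_homotopy f₂ h₂ using 1
    ext p : 1
    simp only [slice_apply, f₁, f₂, ContinuousMap.coe_mk, unitInterval.symm_one,
      unitInterval.symm_zero, balScale_zero]
    congr 2
    exact Subtype.ext hμ1.symm
  convert Fills.of_homotopy f₁ h₁ using 1
  ext p : 1
  simp [f₁, balScale_one]

/-- The part below a level. -/
def cutBelow {w : ℝ × A → ℝ} (L : ℝ) (c : Conf (lpos pos) w) : CConf pos ω :=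
  c.restrict (wC ω) {z | z.1 < L}

theorem continuousAt_cutBelow (hpos : Continuous pos) (hω : Continuous ω) {L : ℝ} (hL : L < 1)
    {e : T → EConf pos ω} {t₀ : T} (he : ContinuousAt e t₀) (h : Avoids L (e t₀).pts) :
    ContinuousAt (fun t => (cutBelow L (e t) : CConf pos ω)) t₀ := by
  refine Conf.continuousAt_restrict (continuous_lpos hpos) (continuous_wE hω) (continuous_wC hω)
    {z | z.1 < L} he (fun t => rfl) (fun z hz => nhds_dichotomy_lt (h z hz)) ?_
  intro δ hδ
  refine ⟨min δ (1 - L), lt_min hδ (by linarith), fun z (hz : z.1 < L) h => ?_⟩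
  exact min_le_min h (by linarith)

theorem exists_lower_of_avoids (hpos : Continuous pos) (hω : Continuous ω)
    (hvan : Vanishes pos ω) {η s ℓ L : ℝ} (hℓ0 : 0 < ℓ) (hℓ : ℓ < L) (hL : L < 1) (hη : η < ℓ)
    (hs : s < L) (y : C(Bal V, YConf pos ω)) (hyℓ : ∀ v, Avoids ℓ (y v).pts)
    (hyL : ∀ v, Avoids L (y v).pts) (e₀ : C(Bal V, EConf pos ω))
    (he₀ : ∀ v, Lifts s (e₀ v).pts (y v).pts) (g : C(I × Sph V, EConf pos ω))
    (hg0 : ∀ k, g (0, k) = e₀ (sphIncl V k))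
    (hg : ∀ t k, Lifts s (g (t, k)).pts (y (sphIncl V k)).pts)
    (hg1 : ∀ k, Lifts η (g (1, k)).pts (y (sphIncl V k)).pts) :
    ∃ G : C(I × Bal V, EConf pos ω), (∀ v, G (0, v) = e₀ v) ∧
      (∀ t k, G (t, sphIncl V k) = g (t, k)) ∧
      (∀ t v, Lifts L (G (t, v)).pts (y v).pts) ∧
      ∀ v, Lifts ℓ (G (1, v)).pts (y v).pts := by
  let m : C(Bal V, MConf pos ω ℓ L) := ⟨fun v => ⟨(y v).restrict (wC ω) {z | ℓ < z.1 ∧ z.1 < L},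
    fun z hz => hz.2.1⟩, by
    refine Continuous.subtype_mk (continuous_iff_continuousAt.2 fun v => ?_) _
    refine Conf.continuousAt_restrict (continuous_lpos hpos) (continuous_wY hω) (continuous_wC hω)
      {z | ℓ < z.1 ∧ z.1 < L} y.continuous.continuousAt (fun t => rfl) (fun z hz => ?_) ?_
    · rcases nhds_dichotomy_gt (hyℓ v z hz) with h1 | h1
      · rcases nhds_dichotomy_lt (hyL v z hz) with h2 | h2
        · exact Or.inl (Filter.inter_mem h1 h2)
        · exact Or.inr (Filter.mem_of_superset h2 fun x hx h => hx h.2)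
      · exact Or.inr (Filter.mem_of_superset h1 fun x hx h => hx h.1)
    · intro δ hδ
      refine ⟨min δ (min ℓ (1 - L)), lt_min hδ (lt_min hℓ0 (by linarith)), ?_⟩
      rintro z ⟨h1, h2⟩ h
      exact min_le_min h (min_le_min h1.le (by linarith))⟩
  let b₀ : C(Bal V, BConf pos ω L) := ⟨fun v => ⟨cutBelow L (e₀ v), fun z hz => hz.2.1⟩, by
    refine Continuous.subtype_mk (continuous_iff_continuousAt.2 fun v => ?_) _
    exact continuousAt_cutBelow hpos hω hL e₀.continuous.continuousAt ((he₀ v).avoids hs (hyL v))⟩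
  let H : C(I × Sph V, BConf pos ω L) := ⟨fun p => ⟨cutBelow L (g p), fun z hz => hz.2.1⟩, by
    refine Continuous.subtype_mk (continuous_iff_continuousAt.2 fun p => ?_) _
    exact continuousAt_cutBelow hpos hω hL g.continuous.continuousAt
      ((hg p.1 p.2).avoids hs (hyL _))⟩
  let a : C(Sph V, BConf pos ω ℓ) := ⟨fun k => ⟨cutBelow ℓ (g (1, k)), fun z hz => hz.2.1⟩, by
    refine Continuous.subtype_mk (continuous_iff_continuousAt.2 fun k => ?_) _
    exact continuousAt_cutBelow hpos hω (hℓ.trans hL) (e := fun k => g (1, k)) (by fun_prop)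
      ((hg1 k).avoids hη (hyℓ _))⟩
  obtain ⟨Γ₁, hΓ₁0, hΓ₁⟩ := exists_hep b₀ H fun k => by
    apply Subtype.ext
    simp [H, b₀, hg0]
  obtain ⟨a', Γ, -, hΓ0, hΓ1, hΓ⟩ := Fills.join hpos hω hvan hℓ m a (slice Γ₁ 1) fun k => by
    rw [slice_apply, hΓ₁]
    apply Subtype.ext
    apply Conf.ext
    simp only [ContinuousMap.coe_mk, joinMap_pts]
    ext z
    constructor
    · rintro ⟨h1, h2, h3⟩
      rcases lt_trichotomy z.1 ℓ with h4 | h4 | h4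
      · exact Or.inl ⟨h1, h4, h3⟩
      · exact absurd h4 ((hg1 k).avoids hη (hyℓ _) z h1)
      · exact Or.inr ⟨((hg1 k) z (hη.trans h4)).1 h1, ⟨h4, h2⟩, h3⟩
    · rintro (⟨h1, h2, h3⟩ | ⟨h1, ⟨h2, h4⟩, h3⟩)
      · exact ⟨h1, lt_trans h2 hℓ, h3⟩
      · exact ⟨((hg1 k) z (hη.trans h2)).2 h1, h4, h3⟩
  obtain ⟨Δ, hΔ0, hΔ1, hΔ⟩ := exists_concat (sphIncl V) H unitInterval.idPath (Path.refl 1) Γ₁ Γ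
    (fun v => (hΓ0 v).symm) (fun t k => hΓ₁ t k) (fun t k => (hΓ t k).trans (hΓ₁ 1 k))
  obtain ⟨E, hE0, hE1, hE⟩ := exists_deform_path H (unitInterval.path_homotopic _
    unitInterval.idPath) Δ hΔ
  let G : C(I × Bal V, EConf pos ω) := ⟨fun p => cutJoin L (E p).1 (y p.2) (wE ω), by
    refine continuous_iff_continuousAt.2 fun p => ?_
    exact continuousAt_cutJoin hpos (continuous_wC hω) (continuous_wY hω) (continuous_wE hω)
      (c := fun p => (E p).1) (y := fun p => y p.2)
      (by fun_prop) (by fun_prop) (fun z hz => ((E p).2 z hz).ne) (hyL _)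
      (fun δ hδ => ⟨δ, hδ, fun z _ h => h.trans (min_le_left _ _)⟩)
      (fun δ hδ => ⟨min δ L, lt_min hδ (hℓ0.trans hℓ), fun z hz h => wE_le_wY z hz h⟩)⟩
  have hcut : ∀ (e : EConf pos ω) (v : Bal V), Lifts s e.pts (y v).pts →
      cutJoin L (cutBelow L e : CConf pos ω) (y v) (wE ω) = e := by
    intro e v he
    rw [← cutJoin_eq_self he hs (hyL v)]
    apply Conf.ext
    rw [cutJoin_pts, cutJoin_pts, cutJoin_eq_self he hs (hyL v)]
    congr 1
    ext z
    have : z ∈ {z ∈ (cutBelow L e : CConf pos ω).pts | z.1 < L} ↔ z ∈ {z ∈ e.pts | z.1 < L} :=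
      ⟨fun h => ⟨h.1.1, h.2⟩, fun h => ⟨⟨h.1, h.2, wC_pos_of_wE (e.wpos z h.1)⟩, h.2⟩⟩
    simp only [mem_ofPred_eq, mem_union] at this ⊢
    rw [this]
  refine ⟨G, fun v => ?_, fun t k => ?_, fun t v => cutJoin_lifts _ _ _, fun v z hz => ?_⟩
  · change cutJoin L (E (0, v)).1 (y v) (wE ω) = _
    rw [hE0, hΔ0, hΓ₁0]
    exact hcut _ _ (he₀ v)
  · change cutJoin L (E (t, sphIncl V k)).1 (y _) (wE ω) = _
    rw [hE]
    exact hcut _ _ (hg t k)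
  · change z ∈ (cutJoin L (E (1, v)).1 (y v) (wE ω)).pts ↔ _
    rw [cutJoin_pts, hE1, hΔ1, hΓ1]
    simp only [ContinuousMap.coe_mk, joinMap_pts]
    constructor
    · rintro ⟨⟨h1 | h1, h2⟩ | ⟨h1, h2⟩, h3⟩
      · exact absurd (hz.trans ((a' v).2 z h1)) (lt_irrefl _)
      · exact h1.1
      · exact h1
    · intro h
      refine ⟨?_, wE_pos_of_wY ((y v).wpos z h)⟩
      rcases lt_trichotomy z.1 L with h4 | h4 | h4
      · exact Or.inl ⟨Or.inr ⟨h, ⟨hz, h4⟩, wC_pos_of_wE (wE_pos_of_wY ((y v).wpos z h))⟩, h4⟩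
      · exact absurd h4 (hyL v z h)
      · exact Or.inr ⟨h, h4⟩

end Small

section Halves

/-- The boundary of the cube `[-1, 1]^n`. -/
theorem Bal.norm_eq_one_iff {n : ℕ} (v : Bal (Fin n → ℝ)) : ‖v.1‖ = 1 ↔ ∃ i, |v.1 i| = 1 := by
  constructor
  · intro h
    by_contra! hc
    have : ‖v.1‖ < 1 := (pi_norm_lt_iff one_pos).2 fun i =>
      lt_of_le_of_ne ((norm_le_pi_norm v.1 i).trans v.norm_le) (hc i)
    exact this.ne h
  · rintro ⟨i, hi⟩
    exact le_antisymm v.norm_le (hi.symm.trans_le (norm_le_pi_norm v.1 i))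

theorem Bal.abs_le {n : ℕ} (v : Bal (Fin n → ℝ)) (i : Fin n) : |v.1 i| ≤ 1 :=
  (norm_le_pi_norm v.1 i).trans v.norm_le

theorem Bal.continuous_coord {n : ℕ} {T : Type*} [TopologicalSpace T] {f : T → Bal (Fin n → ℝ)}
    (hf : Continuous f) (i : Fin n) : Continuous fun t => (f t).1 i :=
  (continuous_apply i).comp (continuous_subtype_val.comp hf)

/-- Constructor for points of the cube. -/
def Bal.mk' {n : ℕ} (v : Fin n → ℝ) (h : ∀ i, |v i| ≤ 1) : Bal (Fin n → ℝ) :=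
  ⟨v, mem_closedBall_zero_iff.2 ((pi_norm_le_iff_of_nonneg zero_le_one).2 h)⟩

variable {m : ℕ}

/-- The inclusion of the middle wall in a direction. -/
def wallIncl (j : Fin (m + 1)) : C(Bal (Fin m → ℝ), Bal (Fin (m + 1) → ℝ)) where
  toFun w := Bal.mk' (j.insertNth 0 w.1) (by
    intro i
    induction i using j.succAboveCases with
    | x => simp
    | p i => simpa using w.abs_le i)
  continuous_toFun := by
    refine Continuous.subtype_mk ?_ _
    fun_prop

/-- The projection to the middle wall in a direction. -/
def wallProj (j : Fin (m + 1)) : C(Bal (Fin (m + 1) → ℝ), Bal (Fin m → ℝ)) where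
  toFun v := Bal.mk' (j.removeNth v.1) (fun i => v.abs_le _)
  continuous_toFun := by
    refine Continuous.subtype_mk ?_ _
    exact continuous_pi fun i => Bal.continuous_coord continuous_id _

theorem wallIncl_wallProj {j : Fin (m + 1)} {v : Bal (Fin (m + 1) → ℝ)} (h : v.1 j = 0) :
    wallIncl j (wallProj j v) = v := by
  apply Subtype.ext
  change j.insertNth 0 (j.removeNth v.1) = v.1
  rw [← h, Fin.insertNth_self_removeNth]

theorem norm_wallProj {j : Fin (m + 1)} {v : Bal (Fin (m + 1) → ℝ)} (h : v.1 j = 0)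
    (hv : ‖v.1‖ = 1) : ‖(wallProj j v).1‖ = 1 := by
  rw [Bal.norm_eq_one_iff] at hv ⊢
  obtain ⟨i, hi⟩ := hv
  induction i using j.succAboveCases with
  | x => simp [h] at hi
  | p i => exact ⟨i, hi⟩

theorem norm_wallIncl {j : Fin (m + 1)} {w : Bal (Fin m → ℝ)} (h : ‖w.1‖ = 1) :
    ‖(wallIncl j w).1‖ = 1 := by
  rw [Bal.norm_eq_one_iff] at h ⊢
  obtain ⟨i, hi⟩ := h
  exact ⟨j.succAbove i, by simpa [wallIncl, Bal.mk'] using hi⟩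

/-- The wall of the sphere. -/
def wallSph (j : Fin (m + 1)) : C(Sph (Fin m → ℝ), Sph (Fin (m + 1) → ℝ)) where
  toFun k := ⟨(wallIncl j (sphIncl _ k)).1, mem_sphere_zero_iff_norm.2 (norm_wallIncl k.norm_eq)⟩

theorem abs_halve {ε x : ℝ} (hε : ε = 1 ∨ ε = -1) (hx : |x| ≤ 1) : |(x + ε) / 2| ≤ 1 := by
  rw [abs_le] at hx ⊢
  rcases hε with rfl | rfl <;> constructor <;> linarith [hx.1, hx.2]

/-- The affine map onto a half of the cube. -/
def halfMap (j : Fin m) (ε : ℝ) (hε : ε = 1 ∨ ε = -1) : C(Bal (Fin m → ℝ), Bal (Fin m → ℝ)) where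
  toFun v := Bal.mk' (Function.update v.1 j ((v.1 j + ε) / 2)) (by
    intro i
    rcases eq_or_ne i j with rfl | h
    · simpa using abs_halve hε (v.abs_le i)
    · simpa [h] using v.abs_le i)
  continuous_toFun := by
    refine Continuous.subtype_mk ?_ _
    exact continuous_subtype_val.update j
      (((Bal.continuous_coord continuous_id j).add continuous_const).div_const 2)

/-- The inverse of `halfMap`. -/
def unhalf (j : Fin m) (ε : ℝ) (hε : ε = 1 ∨ ε = -1) :
    C({v : Bal (Fin m → ℝ) // 0 ≤ ε * v.1 j}, Bal (Fin m → ℝ)) where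
  toFun v := Bal.mk' (Function.update v.1.1 j (2 * v.1.1 j - ε)) (by
    intro i
    rcases eq_or_ne i j with rfl | h
    · have h1 := v.1.abs_le i
      have h2 := v.2
      simp only [Function.update_self]
      rw [abs_le] at h1 ⊢
      rcases hε with rfl | rfl <;> constructor <;> linarith [h1.1, h1.2]
    · simpa [h] using v.1.abs_le i)
  continuous_toFun := by
    refine Continuous.subtype_mk ?_ _
    exact (continuous_subtype_val.comp continuous_subtype_val).update j
      ((continuous_const.mul (Bal.continuous_coord continuous_subtype_val j)).sub continuous_const)

theorem halfMap_unhalf {j : Fin m} {ε : ℝ} {hε : ε = 1 ∨ ε = -1}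
    (v : {v : Bal (Fin m → ℝ) // 0 ≤ ε * v.1 j}) : halfMap j ε hε (unhalf j ε hε v) = v.1 := by
  apply Subtype.ext
  simp [halfMap, unhalf, Bal.mk']

theorem halfMap_apply_self {j : Fin m} {ε : ℝ} {hε : ε = 1 ∨ ε = -1} (v : Bal (Fin m → ℝ)) :
    (halfMap j ε hε v).1 j = (v.1 j + ε) / 2 := by simp [halfMap, Bal.mk']

theorem unhalf_apply_self {j : Fin m} {ε : ℝ} {hε : ε = 1 ∨ ε = -1}
    (v : {v : Bal (Fin m → ℝ) // 0 ≤ ε * v.1 j}) :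
    (unhalf j ε hε v).1 j = 2 * v.1.1 j - ε := by simp [unhalf, Bal.mk']

theorem sph_half {j : Fin m} {ε : ℝ} {hε : ε = 1 ∨ ε = -1} (k : Bal (Fin m → ℝ))
    (hk : ‖k.1‖ = 1) : (halfMap j ε hε k).1 j = 0 ∨ ‖(halfMap j ε hε k).1‖ = 1 := by
  rw [Bal.norm_eq_one_iff] at hk
  obtain ⟨i, hi⟩ := hk
  rcases eq_or_ne i j with rfl | h
  · rw [halfMap_apply_self]
    by_cases h1 : k.1 i = -ε
    · left; rw [h1]; simp
    · right
      rw [Bal.norm_eq_one_iff]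
      refine ⟨i, ?_⟩
      rw [halfMap_apply_self]
      rcases hε with rfl | rfl <;> rcases (abs_eq zero_le_one).1 hi with h | h <;>
        simp_all
  · right
    rw [Bal.norm_eq_one_iff]
    exact ⟨i, by simpa [halfMap, Bal.mk', h] using hi⟩

theorem norm_unhalf_of_zero {j : Fin m} {ε : ℝ} {hε : ε = 1 ∨ ε = -1}
    (v : {v : Bal (Fin m → ℝ) // 0 ≤ ε * v.1 j}) (h : v.1.1 j = 0) :
    ‖(unhalf j ε hε v).1‖ = 1 := by
  rw [Bal.norm_eq_one_iff]
  refine ⟨j, ?_⟩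
  rw [unhalf_apply_self, h]
  rcases hε with rfl | rfl <;> simp

theorem norm_unhalf_of_sph {j : Fin m} {ε : ℝ} {hε : ε = 1 ∨ ε = -1}
    (v : {v : Bal (Fin m → ℝ) // 0 ≤ ε * v.1 j}) (h : ‖v.1.1‖ = 1) :
    ‖(unhalf j ε hε v).1‖ = 1 := by
  rw [Bal.norm_eq_one_iff] at h ⊢
  obtain ⟨i, hi⟩ := h
  refine ⟨i, ?_⟩
  rcases eq_or_ne i j with rfl | hij
  · rw [unhalf_apply_self]
    have h2 := v.2
    rcases hε with rfl | rfl <;> rcases (abs_eq zero_le_one).1 hi with h | h <;>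
      rw [h] at h2 ⊢ <;> (try norm_num) <;> norm_num at h2
  · simpa [unhalf, Bal.mk', hij] using hi

variable {A Q : Type*} [TopologicalSpace A] [TopologicalSpace Q] [T2Space Q]
  {pos : A → Q} {ω : A → ℝ}

/-- Lifts of `y` at level `s` can be lowered to level `η'`, relative to a lowering on the
sphere. -/
def Lowers {V : Type*} [NormedAddCommGroup V] (y : C(Bal V, YConf pos ω)) (η s η' s' : ℝ) : Prop :=
  ∀ (e₀ : C(Bal V, EConf pos ω)) (g : C(I × Sph V, EConf pos ω)),
    (∀ v, Lifts s (e₀ v).pts (y v).pts) → (∀ k, g (0, k) = e₀ (sphIncl V k)) →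
    (∀ t k, Lifts s (g (t, k)).pts (y (sphIncl V k)).pts) →
    (∀ k, Lifts η (g (1, k)).pts (y (sphIncl V k)).pts) →
    ∃ G : C(I × Bal V, EConf pos ω), (∀ v, G (0, v) = e₀ v) ∧
      (∀ t k, G (t, sphIncl V k) = g (t, k)) ∧
      (∀ t v, Lifts s' (G (t, v)).pts (y v).pts) ∧
      ∀ v, Lifts η' (G (1, v)).pts (y v).pts

theorem Lowers.of_half {j : Fin (m + 1)} {y : C(Bal (Fin (m + 1) → ℝ), YConf pos ω)}
    {η s η' s' : ℝ} {ε : ℝ} (hε : ε = 1 ∨ ε = -1)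
    (h : Lowers (y.comp (halfMap j ε hε)) η s η' s')
    (e₀ : C(Bal (Fin (m + 1) → ℝ), EConf pos ω)) (g : C(I × Sph (Fin (m + 1) → ℝ), EConf pos ω))
    (G : C(I × Bal (Fin m → ℝ), EConf pos ω)) (he₀ : ∀ v, Lifts s (e₀ v).pts (y v).pts)
    (hg0 : ∀ k, g (0, k) = e₀ (sphIncl _ k))
    (hg : ∀ t k, Lifts s (g (t, k)).pts (y (sphIncl _ k)).pts)
    (hg1 : ∀ k, Lifts η (g (1, k)).pts (y (sphIncl _ k)).pts)
    (hG0 : ∀ v, G (0, v) = e₀ (wallIncl j v)) (hGk : ∀ t k, G (t, sphIncl _ k) = g (t, wallSph j k))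
    (hG : ∀ t v, Lifts s (G (t, v)).pts (y (wallIncl j v)).pts)
    (hG1 : ∀ v, Lifts η (G (1, v)).pts (y (wallIncl j v)).pts) :
    ∃ E : C(I × {v : Bal (Fin (m + 1) → ℝ) // 0 ≤ ε * v.1 j}, EConf pos ω),
      (∀ v, E (0, v) = e₀ v.1) ∧ (∀ t v (hv : v.1.1 ∈ sphere (0 : Fin (m + 1) → ℝ) 1),
        E (t, v) = g (t, ⟨v.1.1, hv⟩)) ∧
      (∀ t v, v.1.1 j = 0 → E (t, v) = G (t, wallProj j v.1)) ∧
      (∀ t v, Lifts s' (E (t, v)).pts (y v.1).pts) ∧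
      ∀ v, Lifts η' (E (1, v)).pts (y v.1).pts := by
  let α := halfMap j ε hε
  let S₀ : Set (I × Sph (Fin (m + 1) → ℝ)) := {p | (α (sphIncl _ p.2)).1 j = 0}
  let S₁ : Set (I × Sph (Fin (m + 1) → ℝ)) := {p | ‖(α (sphIncl _ p.2)).1‖ = 1}
  have hS₀ : IsClosed S₀ := isClosed_eq
    (Bal.continuous_coord (f := fun p : I × Sph (Fin (m + 1) → ℝ) => α (sphIncl _ p.2))
      (by fun_prop) j) continuous_const
  have hS₁ : IsClosed S₁ := isClosed_eq (by fun_prop) continuous_const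
  obtain ⟨g', hg'0, hg'1⟩ := exists_glue hS₀ hS₁ (fun p => sph_half (sphIncl _ p.2) p.2.norm_eq)
    ⟨fun p => G (p.1.1, wallProj j (α (sphIncl _ p.1.2))), by fun_prop⟩
    ⟨fun p => g (p.1.1, ⟨(α (sphIncl _ p.1.2)).1, mem_sphere_zero_iff_norm.2 p.2⟩), by fun_prop⟩
    (by
      intro p hp hp'
      have h1 := hGk p.1 ⟨(wallProj j (α (sphIncl _ p.2))).1,
        mem_sphere_zero_iff_norm.2 (norm_wallProj hp hp')⟩
      refine h1.trans ?_
      simp only [ContinuousMap.coe_mk]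
      congr 2
      apply Subtype.ext
      exact congrArg (fun v => v.1) (wallIncl_wallProj (j := j) hp))
  simp only [ContinuousMap.coe_mk] at hg'0 hg'1
  obtain ⟨E, hE0, hEk, hE, hE1⟩ := h (e₀.comp α) g' (fun v => he₀ _) (by
      intro k
      rcases sph_half (j := j) (hε := hε) (sphIncl _ k) k.norm_eq with hk | hk
      · rw [hg'0 (0, k) hk, hG0, wallIncl_wallProj hk]; rfl
      · rw [hg'1 (0, k) hk, hg0]; rfl) (by
      intro t k
      rcases sph_half (j := j) (hε := hε) (sphIncl _ k) k.norm_eq with hk | hk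
      · rw [hg'0 (t, k) hk]
        have := hG t (wallProj j (α (sphIncl _ k)))
        rwa [wallIncl_wallProj hk] at this
      · rw [hg'1 (t, k) hk]
        exact hg t ⟨(α (sphIncl _ k)).1, mem_sphere_zero_iff_norm.2 hk⟩) (by
      intro k
      rcases sph_half (j := j) (hε := hε) (sphIncl _ k) k.norm_eq with hk | hk
      · rw [hg'0 (1, k) hk]
        have := hG1 (wallProj j (α (sphIncl _ k)))
        rwa [wallIncl_wallProj hk] at this
      · rw [hg'1 (1, k) hk]
        exact hg1 ⟨(α (sphIncl _ k)).1, mem_sphere_zero_iff_norm.2 hk⟩)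
  have hα : ∀ v, α (unhalf j ε hε v) = v.1 := halfMap_unhalf
  refine ⟨⟨fun p => E (p.1, unhalf j ε hε p.2), by fun_prop⟩, fun v => ?_, fun t v hv => ?_,
    fun t v hv => ?_, fun t v => ?_, fun v => ?_⟩
  · change E _ = _
    rw [hE0, ContinuousMap.comp_apply, hα]
  · change E _ = _
    have h1 := hEk t ⟨(unhalf j ε hε v).1, mem_sphere_zero_iff_norm.2
      (norm_unhalf_of_sph v (mem_sphere_zero_iff_norm.1 hv))⟩
    refine h1.trans ?_
    rw [hg'1 _ (by
      change ‖(α (unhalf j ε hε v)).1‖ = 1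
      rw [hα]; exact mem_sphere_zero_iff_norm.1 hv)]
    congr 2
    apply Subtype.ext
    exact congrArg (fun v => v.1) (hα v)
  · change E _ = _
    have h1 := hEk t ⟨(unhalf j ε hε v).1, mem_sphere_zero_iff_norm.2 (norm_unhalf_of_zero v hv)⟩
    refine h1.trans ?_
    rw [hg'0 _ (by
      change (α (unhalf j ε hε v)).1 j = 0
      rw [hα]; exact hv)]
    change G (t, wallProj j (α (unhalf j ε hε v))) = _
    rw [hα]
  · have := hE t (unhalf j ε hε v)
    rwa [ContinuousMap.comp_apply, hα] at this
  · have := hE1 (unhalf j ε hε v)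
    rwa [ContinuousMap.comp_apply, hα] at this

theorem Lowers.of_halves (j : Fin (m + 1)) {y : C(Bal (Fin (m + 1) → ℝ), YConf pos ω)}
    {η s η₁ s₁ η' s' : ℝ} (hη : η ≤ η₁) (hs : s ≤ s₁)
    (hw : Lowers (y.comp (wallIncl j)) η s η₁ s₁)
    (h : ∀ ε hε, Lowers (y.comp (halfMap j ε hε)) η₁ s₁ η' s') : Lowers y η s η' s' := by
  intro e₀ g he₀ hg0 hg hg1
  obtain ⟨G, hG0, hGk, hG, hG1⟩ := hw (e₀.comp (wallIncl j))
    (g.comp ⟨fun p => (p.1, wallSph j p.2), by fun_prop⟩) (fun v => he₀ _)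
    (fun k => hg0 _) (fun t k => hg t (wallSph j k)) (fun k => hg1 (wallSph j k))
  have H := fun ε hε => (h ε hε).of_half hε e₀ g G (fun v => (he₀ v).mono hs) hg0
    (fun t k => (hg t k).mono hs) (fun k => (hg1 k).mono hη) hG0 hGk hG hG1
  obtain ⟨E, hE0, hEk, hEw, hE, hE1⟩ := H 1 (Or.inl rfl)
  obtain ⟨F, hF0, hFk, hFw, hF, hF1⟩ := H (-1) (Or.inr rfl)
  obtain ⟨D, hD, hD'⟩ := exists_glue
    (A := {p : I × Bal (Fin (m + 1) → ℝ) | 0 ≤ 1 * p.2.1 j})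
    (B := {p : I × Bal (Fin (m + 1) → ℝ) | 0 ≤ -1 * p.2.1 j})
    (isClosed_le continuous_const (continuous_const.mul (Bal.continuous_coord continuous_snd j)))
    (isClosed_le continuous_const (continuous_const.mul (Bal.continuous_coord continuous_snd j)))
    (fun p => by
      rcases le_total 0 (p.2.1 j) with h | h
      · exact Or.inl (show 0 ≤ 1 * p.2.1 j by linarith)
      · exact Or.inr (show 0 ≤ -1 * p.2.1 j by linarith))
    ⟨fun p => E (p.1.1, ⟨p.1.2, p.2⟩), by fun_prop⟩ ⟨fun p => F (p.1.1, ⟨p.1.2, p.2⟩), by fun_prop⟩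
    (fun p hp hp' => by
      have h0 : p.2.1 j = 0 := le_antisymm
        (by linarith [show 0 ≤ -1 * p.2.1 j from hp']) (by linarith [show 0 ≤ 1 * p.2.1 j from hp])
      exact (hEw p.1 ⟨p.2, hp⟩ h0).trans (hFw p.1 ⟨p.2, hp'⟩ h0).symm)
  have key : ∀ (P : I → Bal (Fin (m + 1) → ℝ) → EConf pos ω → Prop),
      (∀ t (v : {v : Bal (Fin (m + 1) → ℝ) // 0 ≤ 1 * v.1 j}), P t v.1 (E (t, v))) →
      (∀ t (v : {v : Bal (Fin (m + 1) → ℝ) // 0 ≤ -1 * v.1 j}), P t v.1 (F (t, v))) →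
      ∀ t v, P t v (D (t, v)) := by
    intro P h1 h2 t v
    rcases le_total 0 (v.1 j) with h | h
    · have : 0 ≤ 1 * v.1 j := by linarith
      rw [hD (t, v) this]; exact h1 t ⟨v, this⟩
    · have : 0 ≤ -1 * v.1 j := by linarith
      rw [hD' (t, v) this]; exact h2 t ⟨v, this⟩
  refine ⟨D, fun v => ?_, fun t k => ?_, ?_, fun v => ?_⟩
  · exact key (fun t v e => t = 0 → e = e₀ v) (fun t v ht => by rw [ht]; exact hE0 v)
      (fun t v ht => by rw [ht]; exact hF0 v) 0 v rfl
  · exact key (fun t v e => ∀ hv : v.1 ∈ sphere (0 : Fin (m + 1) → ℝ) 1, e = g (t, ⟨v.1, hv⟩))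
      (fun t v hv => hEk t v hv) (fun t v hv => hFk t v hv) t (sphIncl _ k) k.2
  · exact key (fun t v e => Lifts s' e.pts (y v).pts) hE hF
  · exact key (fun t v e => t = 1 → Lifts η' e.pts (y v).pts)
      (fun t v ht => by rw [ht]; exact hE1 v)
      (fun t v ht => by rw [ht]; exact hF1 v) 1 v rfl

end Halves

section Doubling

variable {A Q : Type*} [TopologicalSpace A] [TopologicalSpace Q] [T2Space Q]
  {pos : A → Q} {ω : A → ℝ}

theorem Lowers.of_avoids {V : Type*} [NormedAddCommGroup V] [NormedSpace ℝ V]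
    (hpos : Continuous pos)
    (hω : Continuous ω) (hvan : Vanishes pos ω) {η s ℓ L η' s' : ℝ} (hℓ0 : 0 < ℓ) (hℓ : ℓ < L)
    (hL : L < 1) (hη : η < ℓ) (hs : s < L) (hη' : ℓ ≤ η') (hs' : L ≤ s')
    {y : C(Bal V, YConf pos ω)} (hyℓ : ∀ v, Avoids ℓ (y v).pts) (hyL : ∀ v, Avoids L (y v).pts) :
    Lowers y η s η' s' := by
  intro e₀ g he₀ hg0 hg hg1
  obtain ⟨G, h0, hk, h, h1⟩ := exists_lower_of_avoids hpos hω hvan hℓ0 hℓ hL hη hs y hyℓ hyL e₀ he₀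
    g hg0 hg hg1
  exact ⟨G, h0, hk, fun t v => (h t v).mono hs', fun v => (h1 v).mono hη'⟩

/-- The affine map onto a box in the cube. -/
def boxMap {n : ℕ} (c r : Fin n → ℝ) : C(Bal (Fin n → ℝ), Bal (Fin n → ℝ)) :=
  (balClamp _).comp ⟨fun v i => c i + r i * v.1 i, continuous_pi fun i =>
    continuous_const.add (continuous_const.mul (Bal.continuous_coord continuous_id i))⟩

theorem boxMap_apply {n : ℕ} {c r : Fin n → ℝ} (h : ∀ i, |c i| + r i ≤ 1) (hr : ∀ i, 0 ≤ r i)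
    (v : Bal (Fin n → ℝ)) : (boxMap c r v).1 = fun i => c i + r i * v.1 i := by
  have : ‖fun i => c i + r i * v.1 i‖ ≤ 1 := by
    refine (pi_norm_le_iff_of_nonneg zero_le_one).2 fun i => ?_
    refine (norm_add_le _ _).trans ?_
    rw [norm_mul, Real.norm_of_nonneg (hr i)]
    have := mul_le_of_le_one_right (hr i) (v.abs_le i)
    have h2 := h i
    simp only [Real.norm_eq_abs]
    linarith
  exact congrArg Subtype.val (balClamp_of_norm_le this)

theorem boxMap_comp_halfMap {n : ℕ} (c r : Fin n → ℝ) (j : Fin n) (ε : ℝ) (hε : ε = 1 ∨ ε = -1) :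
    (boxMap c r).comp (halfMap j ε hε) =
      boxMap (Function.update c j (c j + ε * (r j / 2))) (Function.update r j (r j / 2)) := by
  ext v : 1
  simp only [boxMap, ContinuousMap.comp_apply, ContinuousMap.coe_mk]
  congr 1
  funext i
  rcases eq_or_ne i j with rfl | h
  · rw [halfMap_apply_self]
    simp only [Function.update_self]
    ring
  · simp [h, halfMap, Bal.mk']

theorem Lowers.of_sparse (hpos : Continuous pos) (hω : Continuous ω) (hvan : Vanishes pos ω)
    {n : ℕ} : ∀ (y : C(Bal (Fin n → ℝ), YConf pos ω)), Sparse y → ∀ {η s η' s' : ℝ}, 0 ≤ η →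
      η < η' → η' < s' → s' < 1 → s < s' → Lowers y η s η' s' := by
  induction n with
  | zero =>
    intro y hy η s η' s' h0 h1 h2 h3 h4
    obtain ⟨ηs, hηs, hηs'⟩ := exists_between h1
    obtain ⟨ℓ, hℓ, hℓ', ha⟩ := hy ⟨0, by simp⟩ ηs η' (h0.trans_lt hηs) hηs' (h2.trans h3)
    replace hℓ := hηs.trans hℓ
    obtain ⟨L, hL, hL', hb⟩ := hy ⟨0, by simp⟩ (max s η') s' (lt_max_of_lt_right (h0.trans_lt h1))
      (max_lt h4 h2) h3
    have hs : ∀ v : Bal (Fin 0 → ℝ), v = ⟨0, by simp⟩ := fun v =>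
      Subtype.ext (Subsingleton.elim _ _)
    have hL2 := max_lt_iff.1 hL
    refine Lowers.of_avoids hpos hω hvan (ℓ := ℓ) (L := L) (h0.trans_lt hℓ) (hℓ'.trans hL2.2)
      (hL'.trans h3) hℓ hL2.1 hℓ'.le hL'.le (fun v => ?_) (fun v => ?_)
    · rw [hs v]; exact ha.self_of_nhds
    · rw [hs v]; exact hb.self_of_nhds
  | succ m ih =>
    intro y hy η s η' s' h0 h1 h2 h3 h4
    obtain ⟨ηs, hηs, hηs'⟩ := exists_between h1
    obtain ⟨ss, hss, hss'⟩ := exists_between (max_lt h4 h2)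
    have hss2 := max_lt_iff.1 hss
    have hy1 : ∀ p, ∃ ℓ L : ℝ, ηs < ℓ ∧ ℓ < η' ∧ ss < L ∧ L < s' ∧
        ∀ᶠ q in 𝓝 p, Avoids ℓ (y q).pts ∧ Avoids L (y q).pts := by
      intro p
      obtain ⟨ℓ, hℓ, hℓ', ha⟩ := hy p ηs η' (h0.trans_lt hηs) hηs' (h2.trans h3)
      obtain ⟨L, hL, hL', hb⟩ := hy p ss s' ((h0.trans_lt h1).trans hss2.2) hss' h3
      exact ⟨ℓ, L, hℓ, hℓ', hL, hL', ha.and hb⟩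
    choose ℓ L hℓ hℓ' hL hL' hav using hy1
    obtain ⟨δ, hδ, hδp⟩ := lebesgue_number_lemma_of_metric isCompact_univ
      (c := fun p => interior {q | Avoids (ℓ p) (y q).pts ∧ Avoids (L p) (y q).pts})
      (fun p => isOpen_interior) fun p _ => mem_iUnion.2 ⟨p, mem_interior_iff_mem_nhds.2 (hav p)⟩
    obtain ⟨N, hN⟩ := exists_pow_lt_of_lt_one hδ (one_half_lt_one)
    have hsmall : ∀ (c r : Fin (m + 1) → ℝ), (∀ i, |c i| + r i ≤ 1) → (∀ i, 0 ≤ r i) →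
        (∀ i, r i < δ) → ∀ η s, 0 ≤ η → η < ηs → s < ss →
        Lowers (y.comp (boxMap c r)) η s η' s' := by
      intro c r hc hr hrδ η s hη hη' hs
      obtain ⟨p, hp⟩ := hδp (boxMap c r ⟨0, by simp⟩) (mem_univ _)
      have hb : ∀ v, boxMap c r v ∈ ball (boxMap c r ⟨0, by simp⟩) δ := by
        intro v
        rw [mem_ball, Subtype.dist_eq, boxMap_apply hc hr, boxMap_apply hc hr,
          dist_pi_lt_iff hδ]
        intro i
        simp only [Real.dist_eq, Pi.zero_apply, mul_zero, add_zero, add_sub_cancel_left, abs_mul,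
          abs_of_nonneg (hr i)]
        exact (mul_le_of_le_one_right (hr i) (v.abs_le i)).trans_lt (hrδ i)
      exact Lowers.of_avoids hpos hω hvan (h0.trans_lt (hηs.trans (hℓ p)))
        ((hℓ' p).trans (hss2.2.trans (hL p))) ((hL' p).trans h3) (hη'.trans (hℓ p))
        (hs.trans (hL p)) (hℓ' p).le (hL' p).le (fun v => (interior_subset (hp (hb v))).1)
        (fun v => (interior_subset (hp (hb v))).2)
    have key : ∀ (d : ℕ) (k : Fin (m + 1) → ℕ), ∑ i, (N - k i) = d → ∀ c : Fin (m + 1) → ℝ,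
        (∀ i, |c i| + (1 / 2 : ℝ) ^ k i ≤ 1) → ∀ η s, 0 ≤ η → η < ηs → s < ss →
        Lowers (y.comp (boxMap c fun i => (1 / 2 : ℝ) ^ k i)) η s η' s' := by
      intro d
      induction d using Nat.strong_induction_on with
      | _ d IH =>
        intro k hk c hc η s hη hη' hs
        by_cases hkN : ∀ i, N ≤ k i
        · exact hsmall c _ hc (fun i => by positivity) (fun i =>
            (pow_le_pow_of_le_one (by norm_num) (by norm_num) (hkN i)).trans_lt hN) η s hη hη' hs
        · push Not at hkN
          obtain ⟨j, hj⟩ := hkN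
          obtain ⟨η₁, hη₁, hη₁'⟩ := exists_between hη'
          obtain ⟨s₁, hs₁, hs₁'⟩ := exists_between (max_lt hs (hηs'.trans hss2.2))
          have hs₁2 := max_lt_iff.1 hs₁
          refine Lowers.of_halves j hη₁.le hs₁2.1.le (ih _ (hy.comp (by fun_prop)) hη hη₁
            (hη₁'.trans hs₁2.2) ((hs₁'.trans hss').trans h3) hs₁2.1) fun ε hε => ?_
          rw [ContinuousMap.comp_assoc, boxMap_comp_halfMap]
          have hr : Function.update (fun i => (1 / 2 : ℝ) ^ k i) j ((1 / 2 : ℝ) ^ k j / 2) =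
              fun i => (1 / 2 : ℝ) ^ (Function.update k j (k j + 1)) i := by
            funext i
            rcases eq_or_ne i j with rfl | h
            · simp [pow_succ, div_eq_mul_inv]
            · simp [h]
          rw [hr]
          refine IH _ ?_ _ rfl _ (fun i => ?_) η₁ s₁ (hη.trans hη₁.le) hη₁' hs₁'
          · rw [← hk]
            refine Finset.sum_lt_sum (fun i _ => ?_) ⟨j, Finset.mem_univ _, ?_⟩
            · rcases eq_or_ne i j with rfl | h
              · simp only [Function.update_self]; omega
              · simp [h]
            · simp only [Function.update_self]; omega
          · rcases eq_or_ne i j with rfl | h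
            · simp only [Function.update_self]
              have h1 := hc i
              have h2 : |ε * ((1 / 2 : ℝ) ^ k i / 2)| = (1 / 2 : ℝ) ^ k i / 2 := by
                rw [abs_mul, abs_of_nonneg (by positivity : (0 : ℝ) ≤ (1 / 2 : ℝ) ^ k i / 2)]
                rcases hε with rfl | rfl <;> simp
              have h3 := abs_add_le (c i) (ε * ((1 / 2 : ℝ) ^ k i / 2))
              rw [h2] at h3
              rw [pow_succ]
              linarith
            · simpa [h] using hc i
    have := key _ 0 rfl 0 (fun i => by simp) η s h0 hηs hss2.1
    have hid : boxMap (0 : Fin (m + 1) → ℝ) (fun i => (1 / 2 : ℝ) ^ (0 : Fin (m + 1) → ℕ) i) =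
        ContinuousMap.id _ := by
      ext v : 1
      apply Subtype.ext
      rw [boxMap_apply (fun i => by simp) (fun i => by simp)]
      simp
    rwa [hid, ContinuousMap.comp_id] at this

end Doubling

section Transport

variable {A Q : Type*} [TopologicalSpace A] [TopologicalSpace Q] [T2Space Q]
  {pos : A → Q} {ω : A → ℝ}

/-- Lifts can be transported along homotopies relative to the sphere. -/
theorem exists_transport (hpos : Continuous pos) (hω : Continuous ω) (hvan : Vanishes pos ω) {m : ℕ}
    (h : C(I × Bal (Fin m → ℝ), YConf pos ω)) (hs : Sparse h)
    (hk : ∀ t k, h (t, sphIncl _ k) = h (0, sphIncl _ k)) (e₀ : C(Bal (Fin m → ℝ), EConf pos ω))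
    (he₀ : ∀ v, Lifts 0 (e₀ v).pts (h (0, v)).pts) :
    ∃ e : C(Bal (Fin m → ℝ), EConf pos ω), (∀ v, Lifts (1 / 4) (e v).pts (h (1, v)).pts) ∧
      ∀ k, e (sphIncl _ k) = e₀ (sphIncl _ k) := by
  let R : I → Prop := fun t => ∃ e : C(Bal (Fin m → ℝ), EConf pos ω),
    (∀ v, Lifts (1 / 4) (e v).pts (h (t, v)).pts) ∧ ∀ k, e (sphIncl _ k) = e₀ (sphIncl _ k)
  have hR : IsLocallyConstant R := by
    refine (IsLocallyConstant.iff_eventually_eq R).2 fun t₀ => ?_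
    obtain ⟨J, hJ, hJt⟩ := exists_advance hpos hω h hs t₀ (a := 1 / 4) (b := 1 / 2)
      (by norm_num) (by norm_num) (by norm_num)
    have key : ∀ t ∈ J, ∀ t' ∈ J, R t → R t' := by
      rintro t ht t' ht' ⟨e, he, hek⟩
      obtain ⟨e', he', hek'⟩ := hJt t ht t' ht' e he
      have hb : ∀ k, e' (sphIncl _ k) = e₀ (sphIncl _ k) := fun k => by
        rw [hek' _ fun s => hk s k, hek]
      obtain ⟨G, -, hG, -, hG1⟩ := Lowers.of_sparse hpos hω hvan (slice h t')
        (hs.comp (f := fun v => (t', v)) (by fun_prop)) (η := 1 / 8) (s := 1 / 2) (η' := 1 / 4)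
        (s' := 3 / 4) (by norm_num) (by norm_num) (by norm_num) (by norm_num) (by norm_num) e'
        (e'.comp ⟨fun p => sphIncl _ p.2, by fun_prop⟩) he' (fun k => rfl)
        (fun t k => he' _) (fun k => by
          change Lifts (1 / 8) (e' (sphIncl _ k)).pts (h (t', sphIncl _ k)).pts
          rw [hb, hk]
          exact (he₀ _).mono (by norm_num))
      exact ⟨slice G 1, hG1, fun k => by rw [slice_apply, hG, ← hb]; rfl⟩
    filter_upwards [hJ] with t ht
    exact propext ⟨key t ht t₀ (mem_of_mem_nhds hJ), key t₀ (mem_of_mem_nhds hJ) t ht⟩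
  have h0 : R 0 := ⟨e₀, fun v => (he₀ v).mono (by norm_num), fun k => rfl⟩
  have h1 : R 0 = R 1 := hR.apply_eq_of_preconnectedSpace 0 1
  exact cast h1 h0

/-! ### Lifting over the cylinder -/

/-- The part of the boundary of the cylinder consisting of the bottom and the sides. -/
abbrev Cup (V : Type*) [NormedAddCommGroup V] := {p : I × Bal V // p.1 = 0 ∨ ‖p.2.1‖ = 1}

theorem exists_retraction (V : Type*) [NormedAddCommGroup V] [NormedSpace ℝ V] :
    ∃ R : C(I × Bal V, Cup V), ∀ p : Cup V, R p.1 = p := by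
  obtain ⟨R, hR0, hR⟩ := exists_hep (F := Cup V)
    ⟨fun v => ⟨(0, v), Or.inl rfl⟩, by fun_prop⟩
    ⟨fun p => ⟨(p.1, sphIncl V p.2), Or.inr p.2.norm_eq⟩, by fun_prop⟩ (fun k => rfl)
  refine ⟨R, ?_⟩
  rintro ⟨⟨t, v⟩, h⟩
  rcases h with h | h
  · obtain rfl : t = 0 := h
    exact hR0 v
  · exact hR t ⟨v.1, mem_sphere_zero_iff_norm.2 h⟩

/-- Linear interpolation in the ball. -/
def balLerp (V : Type*) [NormedAddCommGroup V] [NormedSpace ℝ V] : C(I × Bal V × Bal V, Bal V) where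
  toFun p := ⟨(1 - p.1.1) • p.2.1.1 + p.1.1 • p.2.2.1, (convex_closedBall (0 : V) 1) p.2.1.2 p.2.2.2
    (sub_nonneg.2 p.1.2.2) p.1.2.1 (by ring)⟩

open unitInterval (lerp)

theorem lerp_self (s a : I) : lerp s a a = a := by
  apply Subtype.ext; simp only [lerp]; ring

theorem balLerp_self {V : Type*} [NormedAddCommGroup V] [NormedSpace ℝ V] (s : I) (v : Bal V) :
    balLerp V (s, v, v) = v := by
  apply Subtype.ext; simp [balLerp, ← add_smul]

/-- The folding map from the cube to the cylinder. -/
def foldMap (m : ℕ) : C(Bal (Fin (m + 1) → ℝ), I × Bal (Fin m → ℝ)) where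
  toFun w := (⟨1 - |w.1 0|, sub_nonneg.2 (w.abs_le 0), sub_le_self _ (abs_nonneg _)⟩,
    wallProj 0 w)
  continuous_toFun := by
    refine Continuous.prodMk (Continuous.subtype_mk ?_ _) (by fun_prop)
    exact continuous_const.sub (Bal.continuous_coord continuous_id 0).abs

theorem foldMap_sph {m : ℕ} (k : Sph (Fin (m + 1) → ℝ)) :
    (foldMap m (sphIncl _ k)).1 = 0 ∨ ‖(foldMap m (sphIncl _ k)).2.1‖ = 1 := by
  have := (Bal.norm_eq_one_iff (sphIncl _ k)).1 k.norm_eq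
  obtain ⟨i, hi⟩ := this
  induction i using (0 : Fin (m + 1)).succAboveCases with
  | x =>
    left
    apply Subtype.ext
    simp only [foldMap, ContinuousMap.coe_mk, hi, sub_self]
    rfl
  | p i =>
    right
    rw [Bal.norm_eq_one_iff]
    exact ⟨i, hi⟩

/-- The embedding of the cylinder as the upper half of the cube. -/
def cylIncl (m : ℕ) : C(I × Bal (Fin m → ℝ), Bal (Fin (m + 1) → ℝ)) where
  toFun p := Bal.mk' (Fin.cons (1 - p.1.1) p.2.1) (by
    intro i
    induction i using Fin.cases with
    | zero =>
      simp only [Fin.cons_zero]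
      rw [abs_le]
      constructor <;> linarith [p.1.2.1, p.1.2.2]
    | succ i => simpa using p.2.abs_le i)
  continuous_toFun := by
    refine Continuous.subtype_mk (continuous_pi fun i => ?_) _
    induction i using Fin.cases with
    | zero => simp only [Fin.cons_zero]; fun_prop
    | succ i =>
      simp only [Fin.cons_succ]
      exact Bal.continuous_coord continuous_snd i

theorem foldMap_cylIncl {m : ℕ} (p : I × Bal (Fin m → ℝ)) : foldMap m (cylIncl m p) = p := by
  refine Prod.ext (Subtype.ext ?_) (Subtype.ext ?_)
  · simp [foldMap, cylIncl, Bal.mk', abs_of_nonneg (sub_nonneg.2 p.1.2.2)]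
  · funext i
    simp [foldMap, cylIncl, Bal.mk', wallProj]

theorem norm_cylIncl {m : ℕ} {p : I × Bal (Fin m → ℝ)} (h : p.1 = 0 ∨ ‖p.2.1‖ = 1) :
    ‖(cylIncl m p).1‖ = 1 := by
  rw [Bal.norm_eq_one_iff]
  rcases h with h | h
  · exact ⟨0, by simp [cylIncl, Bal.mk', h]⟩
  · rw [Bal.norm_eq_one_iff] at h
    obtain ⟨i, hi⟩ := h
    exact ⟨i.succ, by simpa [cylIncl, Bal.mk'] using hi⟩

theorem exists_cyl_lift (hpos : Continuous pos) (hω : Continuous ω) (hvan : Vanishes pos ω) {m : ℕ}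
    (h : C(I × Bal (Fin m → ℝ), YConf pos ω)) (hs : Sparse h)
    (b : C(Bal (Fin m → ℝ), EConf pos ω)) (g : C(I × Sph (Fin m → ℝ), EConf pos ω))
    (hb : ∀ v, Lifts 0 (b v).pts (h (0, v)).pts) (hg0 : ∀ k, g (0, k) = b (sphIncl _ k))
    (hg : ∀ t k, Lifts 0 (g (t, k)).pts (h (t, sphIncl _ k)).pts) :
    ∃ e : C(I × Bal (Fin m → ℝ), EConf pos ω), (∀ v, e (0, v) = b v) ∧
      (∀ t k, e (t, sphIncl _ k) = g (t, k)) ∧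
      ∀ p, Lifts (1 / 4) (e p).pts (h p).pts := by
  obtain ⟨e', he'0, he'⟩ := exists_hep b g hg0
  obtain ⟨R, hR⟩ := exists_retraction (Fin m → ℝ)
  have hcup : ∀ p : Cup (Fin m → ℝ), Lifts 0 (e' p.1).pts (h p.1).pts := by
    rintro ⟨⟨t, v⟩, hp⟩
    rcases hp with hp | hp
    · obtain rfl : t = 0 := hp
      simp only [he'0]
      exact hb v
    · have := hg t ⟨v.1, mem_sphere_zero_iff_norm.2 hp⟩
      rw [← he'] at this
      exact this
  let r : C(I × Bal (Fin (m + 1) → ℝ), I × Bal (Fin m → ℝ)) :=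
    ⟨fun p => (lerp p.1 (R (foldMap m p.2)).1.1 (foldMap m p.2).1,
      balLerp _ (p.1, (R (foldMap m p.2)).1.2, (foldMap m p.2).2)), by
      have hF : Continuous fun w => foldMap m w := (foldMap m).continuous
      generalize foldMap m = F at *
      fun_prop⟩
  have hRk : ∀ k, (R (foldMap m (sphIncl _ k))).1 = foldMap m (sphIncl _ k) := fun k =>
    congrArg Subtype.val (hR ⟨_, foldMap_sph k⟩)
  have hr0 : ∀ w, r (0, w) = (R (foldMap m w)).1 := fun w => by
    refine Prod.ext ?_ ?_
    · simp [r]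
    · apply Subtype.ext; simp [r, balLerp]
  have hr1 : ∀ w, r (1, w) = foldMap m w := fun w => by
    refine Prod.ext ?_ ?_
    · simp [r]
    · apply Subtype.ext; simp [r, balLerp]
  have hrk : ∀ t k, r (t, sphIncl _ k) = foldMap m (sphIncl _ k) := fun t k => by
    refine Prod.ext ?_ ?_
    · simp only [r, ContinuousMap.coe_mk, hRk]; exact lerp_self _ _
    · simp only [r, ContinuousMap.coe_mk, hRk]; exact balLerp_self _ _
  obtain ⟨e, he, hek⟩ := exists_transport hpos hω hvan (h.comp r) (hs.comp r.continuous)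
    (fun t k => by simp only [ContinuousMap.comp_apply, hrk])
    (e'.comp ⟨fun w => (R (foldMap m w)).1,
      continuous_subtype_val.comp (R.continuous.comp (foldMap m).continuous)⟩) (fun w => by
      simp only [ContinuousMap.comp_apply, hr0]
      exact hcup _)
  have hJ : ∀ p : I × Bal (Fin m → ℝ), p.1 = 0 ∨ ‖p.2.1‖ = 1 → e (cylIncl m p) = e' p := by
    intro p hp
    have h1 := hek ⟨(cylIncl m p).1, mem_sphere_zero_iff_norm.2 (norm_cylIncl hp)⟩
    refine h1.trans ?_
    change e' (R (foldMap m (cylIncl m p))).1 = _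
    rw [foldMap_cylIncl, hR ⟨p, hp⟩]
  refine ⟨e.comp (cylIncl m), fun v => ?_, fun t k => ?_, fun p => ?_⟩
  · exact (hJ (0, v) (Or.inl rfl)).trans (he'0 v)
  · exact (hJ (t, sphIncl _ k) (Or.inr k.norm_eq)).trans (he' t k)
  · have := he (cylIncl m p)
    rwa [ContinuousMap.comp_apply, hr1, foldMap_cylIncl] at this

end Transport

/-! ### One-dimensional loops -/

section Loops

variable {Y K : Type*} [TopologicalSpace Y] [TopologicalSpace K] {y₀ : Y}

instance (n : ℕ) : CompactSpace (NCube n) := inferInstanceAs (CompactSpace (Fin n → I))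
instance (n : ℕ) : T2Space (NCube n) := inferInstanceAs (T2Space (Fin n → I))

/-- The family of loops determined by a map on a product with the interval. -/
def NLoop.family (f : C(K × I, Y)) (h0 : ∀ k, f (k, 0) = y₀) (h1 : ∀ k, f (k, 1) = y₀) :
    C(K, NLoop 1 Y y₀) where
  toFun k := ⟨⟨fun t => f (k, (show Fin 1 → I from t) 0), f.continuous.comp
      (continuous_const.prodMk (continuous_apply (0 : Fin 1)))⟩, by
    rintro t ⟨i, hi⟩
    obtain rfl : i = 0 := Subsingleton.elim _ _
    rcases hi with hi | hi
    · exact (congrArg (fun s => f (k, s)) hi).trans (h0 k)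
    · exact (congrArg (fun s => f (k, s)) hi).trans (h1 k)⟩
  continuous_toFun := by
    refine Continuous.subtype_mk ?_ _
    refine ContinuousMap.continuous_of_continuous_uncurry _ ?_
    exact f.continuous.comp (continuous_fst.prodMk ((continuous_apply (0 : Fin 1)).comp
      continuous_snd))

/-- Evaluation of a loop at a time. -/
def NLoop.eval (l : NLoop 1 Y y₀) (t : I) : Y := l.1 (fun _ => t : Fin 1 → I)

theorem NLoop.continuous_eval : Continuous fun p : NLoop 1 Y y₀ × I => NLoop.eval p.1 p.2 := by
  have h : Continuous fun p : NLoop 1 Y y₀ × I =>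
      (p.1.1, (show NCube 1 from (fun _ => p.2 : Fin 1 → I))) :=
    (continuous_subtype_val.comp continuous_fst).prodMk
      (continuous_pi fun _ => continuous_snd)
  exact ContinuousEval.continuous_eval.comp h

@[fun_prop] theorem Continuous.nloop_eval {f : K → NLoop 1 Y y₀} {g : K → I} (hf : Continuous f)
    (hg : Continuous g) : Continuous fun k => NLoop.eval (f k) (g k) :=
  NLoop.continuous_eval.comp (hf.prodMk hg)

@[simp] theorem NLoop.eval_family (f : C(K × I, Y)) (h0 : ∀ k, f (k, 0) = y₀)
    (h1 : ∀ k, f (k, 1) = y₀) (k : K) (t : I) : NLoop.eval (NLoop.family f h0 h1 k) t = f (k, t) :=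
  rfl

theorem NLoop.ext {l l' : NLoop 1 Y y₀} (h : ∀ t, NLoop.eval l t = NLoop.eval l' t) : l = l' := by
  apply Subtype.ext
  ext t
  have : t = (fun _ => (show Fin 1 → I from t) 0 : Fin 1 → I) := by
    funext i
    rw [Subsingleton.elim i 0]
  rw [this]
  exact h _

@[simp] theorem NLoop.eval_zero (l : NLoop 1 Y y₀) : NLoop.eval l 0 = y₀ :=
  l.2 _ ⟨0, Or.inl rfl⟩

@[simp] theorem NLoop.eval_one (l : NLoop 1 Y y₀) : NLoop.eval l 1 = y₀ :=
  l.2 _ ⟨0, Or.inr rfl⟩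

end Loops

/-! ### Reparametrizing levels -/

/-- A reparametrization of the levels which is bounded below and doubles nonnegative levels. -/
def stretch (s : ℝ) : ℝ := 2 * (max s 0 + (Real.exp (min s 0) - 1))

@[fun_prop] theorem continuous_stretch : Continuous stretch := by unfold stretch; fun_prop

theorem stretch_of_nonneg {s : ℝ} (h : 0 ≤ s) : stretch s = 2 * s := by
  simp [stretch, h]

theorem stretch_strictMono : StrictMono stretch := by
  intro a b h
  unfold stretch
  have h1 : max a 0 ≤ max b 0 := max_le_max_right _ h.le
  have h2 : Real.exp (min a 0) ≤ Real.exp (min b 0) := Real.exp_le_exp.2 (min_le_min_right _ h.le)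
  rcases le_or_gt b 0 with hb | hb
  · have : Real.exp (min a 0) < Real.exp (min b 0) := by
      rw [min_eq_left hb, min_eq_left (h.le.trans hb)]
      exact Real.exp_lt_exp.2 h
    linarith
  · have : max a 0 < max b 0 := by
      rw [max_eq_left hb.le]
      exact max_lt h hb
    linarith

theorem neg_two_lt_stretch (s : ℝ) : -2 < stretch s := by
  unfold stretch
  have := Real.exp_pos (min s 0)
  have := le_max_right s 0
  linarith

theorem stretch_lt {s b : ℝ} (hb : 0 ≤ b) (h : s < b) : stretch s < 2 * b :=
  stretch_of_nonneg hb ▸ stretch_strictMono h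

theorem le_of_stretch_le {s b : ℝ} (hb : 0 ≤ b) (h : stretch s ≤ 2 * b) : s ≤ b := by
  by_contra! hs
  have := stretch_strictMono hs
  rw [stretch_of_nonneg hb] at this
  linarith

section Scan

variable {A Q : Type*} [TopologicalSpace A] [TopologicalSpace Q] [T2Space Q]
  {pos : A → Q} {ω : A → ℝ} {T : Type*} [TopologicalSpace T]

theorem mem_levelMap {w w' : ℝ × A → ℝ} {θ : ℝ → ℝ} (hθ : StrictMono θ) {c : Conf (lpos pos) w}
    {z : ℝ × A} : z ∈ (levelMap θ c w').pts ↔ 0 < w' z ∧ ∃ s, (s, z.2) ∈ c.pts ∧ θ s = z.1 := by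
  rw [levelMap_pts hθ.injective.injOn]
  constructor
  · rintro ⟨⟨x, hx, rfl⟩, h⟩
    exact ⟨h, x.1, hx, rfl⟩
  · rintro ⟨h, s, hs, hz⟩
    exact ⟨⟨_, hs, Prod.ext hz rfl⟩, h⟩

theorem continuous_levelMap {w w' : ℝ × A → ℝ} (hpos : Continuous pos) (hw : Continuous w)
    (hw' : Continuous w') {θ : T → ℝ → ℝ} {c : T → Conf (lpos pos) w}
    (hc : Continuous c) (hθ : Continuous fun p : T × ℝ => θ p.1 p.2) (hm : ∀ t, StrictMono (θ t))
    (hctl : ∀ δ > 0, ∃ δ' > 0, ∀ t, ∀ z : ℝ × A, δ ≤ w' (θ t z.1, z.2) → δ' ≤ w z) :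
    Continuous fun t => levelMap (θ t) (c t) w' := by
  refine continuous_iff_continuousAt.2 fun t => continuousAt_levelMap hpos hw hw' hc.continuousAt
    (fun z _ => hθ.continuousAt) (fun t => (hm t).injective.injOn) fun δ hδ => ?_
  obtain ⟨δ', hδ', h⟩ := hctl δ hδ
  exact ⟨δ', hδ', Filter.Eventually.of_forall h⟩

/-- The scanning window at height `q`. -/
def window (e : EConf pos ω) (q : ℝ) : YConf pos ω :=
  levelMap (fun s => stretch s + max q (-1)) e (wY ω)

theorem mem_window {e : EConf pos ω} {q : ℝ} {z : ℝ × A} : z ∈ (window e q).pts ↔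
    0 < wY ω z ∧ ∃ s, (s, z.2) ∈ e.pts ∧ stretch s + max q (-1) = z.1 :=
  mem_levelMap (stretch_strictMono.add_const _)

theorem continuous_window (hpos : Continuous pos) (hω : Continuous ω) :
    Continuous fun p : EConf pos ω × ℝ => window p.1 p.2 := by
  refine continuous_levelMap hpos (continuous_wE hω) (continuous_wY hω)
    (θ := fun (p : EConf pos ω × ℝ) s => stretch s + max p.2 (-1)) (c := fun p => p.1)
    (by fun_prop) (by fun_prop) (fun p => stretch_strictMono.add_const _) fun δ hδ => ?_
  refine ⟨δ / 2, by positivity, fun p z h => ?_⟩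
  obtain ⟨h1, h2, h3⟩ := (le_min_iff.trans (and_congr_right fun _ => le_min_iff)).1 h
  simp only at h1 h2 h3
  refine le_min (by linarith) ?_
  have := le_max_right p.2 (-1)
  have := le_of_stretch_le (s := z.1) (b := 1 - δ / 2) (by linarith) (by linarith)
  linarith

@[fun_prop] theorem Continuous.window (hpos : Continuous pos) (hω : Continuous ω)
    {f : T → EConf pos ω} {g : T → ℝ} (hf : Continuous f) (hg : Continuous g) :
    Continuous fun t => window (f t) (g t) :=
  (continuous_window hpos hω).comp (hf.prodMk hg)

/-- Zooming in at the top. -/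
def zoom (y : YConf pos ω) (l : I) : YConf pos ω :=
  levelMap (fun s => (1 + l) * s - l) y (wY ω)

theorem zoom_strictMono (l : I) : StrictMono fun s : ℝ => (1 + l) * s - l := by
  intro a b h
  have := l.2.1
  simp only
  nlinarith

theorem mem_zoom {y : YConf pos ω} {l : I} {z : ℝ × A} : z ∈ (zoom y l).pts ↔
    0 < wY ω z ∧ ∃ s, (s, z.2) ∈ y.pts ∧ (1 + l) * s - l = z.1 :=
  mem_levelMap (zoom_strictMono l)

theorem continuous_zoom (hpos : Continuous pos) (hω : Continuous ω) :
    Continuous fun p : YConf pos ω × I => zoom p.1 p.2 := by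
  refine continuous_levelMap hpos (continuous_wY hω) (continuous_wY hω)
    (θ := fun (p : YConf pos ω × I) s => (1 + p.2) * s - p.2) (c := fun p => p.1)
    (by fun_prop) (by fun_prop) (fun p => zoom_strictMono _) fun δ hδ => ?_
  refine ⟨δ / 2, by positivity, fun p z h => ?_⟩
  obtain ⟨h1, h2, h3⟩ := (le_min_iff.trans (and_congr_right fun _ => le_min_iff)).1 h
  simp only at h1 h2 h3
  have h4 := p.2.2.1
  have h5 := p.2.2.2
  refine le_min (by linarith) (le_min ?_ ?_) <;> nlinarith

@[fun_prop] theorem Continuous.zoom (hpos : Continuous pos) (hω : Continuous ω)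
    {f : T → YConf pos ω} {g : T → I} (hf : Continuous f) (hg : Continuous g) :
    Continuous fun t => zoom (f t) (g t) :=
  (continuous_zoom hpos hω).comp (hf.prodMk hg)

/-- The partially scanned configuration. -/
def scanE (c : CConf pos ω) (p : ℝ) : EConf pos ω :=
  levelMap (fun s => stretch s + (3 - 4 * p)) c (wE ω)

theorem mem_scanE {c : CConf pos ω} {p : ℝ} {z : ℝ × A} : z ∈ (scanE c p).pts ↔
    0 < wE ω z ∧ ∃ s, (s, z.2) ∈ c.pts ∧ stretch s + (3 - 4 * p) = z.1 :=
  mem_levelMap (stretch_strictMono.add_const _)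

theorem continuous_scanE (hpos : Continuous pos) (hω : Continuous ω) :
    Continuous fun p : CConf pos ω × ℝ => scanE p.1 p.2 :=
  continuous_levelMap hpos (continuous_wC hω) (continuous_wE hω)
    (θ := fun (p : CConf pos ω × ℝ) s => stretch s + (3 - 4 * p.2)) (c := fun p => p.1)
    (by fun_prop) (by fun_prop) (fun p => stretch_strictMono.add_const _) fun δ hδ =>
    ⟨δ, hδ, fun _ _ h => h.trans (min_le_left _ _)⟩

@[fun_prop] theorem Continuous.scanE (hpos : Continuous pos) (hω : Continuous ω)
    {f : T → CConf pos ω} {g : T → ℝ} (hf : Continuous f) (hg : Continuous g) :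
    Continuous fun t => scanE (f t) (g t) :=
  (continuous_scanE hpos hω).comp (hf.prodMk hg)

/-- Configurations of low levels, as configurations relative to the top. -/
def inclE (c : CConf pos ω) : EConf pos ω := levelMap (fun s => s) c (wE ω)

theorem mem_inclE {c : CConf pos ω} {z : ℝ × A} : z ∈ (inclE c).pts ↔ 0 < wE ω z ∧ z ∈ c.pts := by
  rw [inclE, mem_levelMap (θ := fun s => s) strictMono_id]
  simp

theorem continuous_inclE (hpos : Continuous pos) (hω : Continuous ω) :
    Continuous fun p : CConf pos ω => inclE p :=
  continuous_levelMap hpos (continuous_wC hω) (continuous_wE hω)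
    (θ := fun (p : CConf pos ω) s => s) (c := fun p => p)
    (by fun_prop) (by fun_prop) (fun p => strictMono_id) fun δ hδ =>
    ⟨δ, hδ, fun _ _ h => h.trans (min_le_left _ _)⟩

theorem window_three (e : EConf pos ω) : window e 3 = Conf.empty := by
  apply Conf.ext
  refine eq_empty_of_forall_notMem fun z hz => ?_
  obtain ⟨h, s, -, hs⟩ := mem_window.1 hz
  have h2 := (lt_min_iff.1 (lt_min_iff.1 h).2).2
  rw [max_eq_left (by norm_num)] at hs
  have := neg_two_lt_stretch s
  linarith

theorem window_neg_one {e : EConf pos ω} (h : ∀ z ∈ e.pts, z.1 ≤ 1 / 2) :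
    window e (-1) = Conf.empty := by
  apply Conf.ext
  refine eq_empty_of_forall_notMem fun z hz => ?_
  obtain ⟨h', s, hm, hs⟩ := mem_window.1 hz
  have h2 := (lt_min_iff.1 (lt_min_iff.1 h').2).1
  rw [max_self] at hs
  have h3 : s ≤ 1 / 2 := h _ hm
  have := stretch_strictMono.monotone h3
  rw [stretch_of_nonneg (show (0 : ℝ) ≤ 1 / 2 by norm_num)] at this
  linarith

theorem zoom_zero (y : YConf pos ω) : zoom y 0 = y := by
  apply Conf.ext
  ext z
  rw [mem_zoom]
  simp only [Set.Icc.coe_zero]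
  constructor
  · rintro ⟨-, s, hs, h⟩
    obtain rfl : s = z.1 := by linarith
    exact hs
  · exact fun h => ⟨y.wpos z h, z.1, h, by ring⟩

theorem zoom_empty (l : I) : zoom (Conf.empty : YConf pos ω) l = Conf.empty := by
  apply Conf.ext
  refine eq_empty_of_forall_notMem fun z hz => ?_
  obtain ⟨-, s, h, -⟩ := mem_zoom.1 hz
  exact h

theorem zoom_one {e : EConf pos ω} {y : YConf pos ω} (h : Lifts (1 / 4) e.pts y.pts) :
    zoom y 1 = window e (-1) := by
  apply Conf.ext
  ext z
  rw [mem_zoom, mem_window, max_self]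
  simp only [Set.Icc.coe_one]
  refine and_congr_right fun hz => ?_
  have hz0 := (lt_min_iff.1 (lt_min_iff.1 hz).2).1
  constructor
  · rintro ⟨s, hs, hsz⟩
    refine ⟨s, (h (s, z.2) (by show 1 / 4 < s; linarith)).2 hs, ?_⟩
    rw [stretch_of_nonneg (by linarith)]
    linarith
  · rintro ⟨s, hs, hsz⟩
    have : 1 / 2 < s := by
      by_contra! hs'
      have := stretch_strictMono.monotone hs'
      rw [stretch_of_nonneg (show (0 : ℝ) ≤ 1 / 2 by norm_num)] at this
      linarith
    refine ⟨s, (h (s, z.2) (by show 1 / 4 < s; linarith)).1 hs, ?_⟩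
    rw [stretch_of_nonneg (by linarith)] at hsz
    linarith

theorem scanE_lifts {c : CConf pos ω} (hc : ∀ z ∈ c.pts, z.1 < 1 / 2) {p : ℝ} (hp : p ≤ 1) :
    Lifts 0 (scanE c p).pts (window (inclE c) (3 - 4 * p)).pts := by
  intro z hz
  rw [mem_scanE, mem_window, max_eq_left (by linarith)]
  constructor
  · rintro ⟨h, s, hs, hsz⟩
    obtain ⟨h1, h2⟩ := lt_min_iff.1 h
    refine ⟨lt_min h1 (lt_min hz h2), s, mem_inclE.2 ⟨lt_min h1 ?_, hs⟩, hsz⟩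
    have : s < 1 / 2 := hc _ hs
    show 0 < 1 - s
    linarith
  · rintro ⟨h, s, hs, hsz⟩
    exact ⟨wE_pos_of_wY h, s, (mem_inclE.1 hs).2, hsz⟩

theorem scanE_zero (c : CConf pos ω) : scanE c 0 = Conf.empty := by
  apply Conf.ext
  refine eq_empty_of_forall_notMem fun z hz => ?_
  obtain ⟨h, s, hm, hs⟩ := mem_scanE.1 hz
  have h2 := (lt_min_iff.1 h).2
  have := neg_two_lt_stretch s
  linarith

theorem scanE_one_lt {c : CConf pos ω} (hc : ∀ z ∈ c.pts, z.1 < 1 / 2) {z : ℝ × A}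
    (hz : z ∈ (scanE c 1).pts) : z.1 < 0 := by
  obtain ⟨h, s, hm, hs⟩ := mem_scanE.1 hz
  have := stretch_lt (by norm_num) (hc _ hm)
  simp only at this
  linarith

variable (pos ω) in
/-- The scanning map. -/
def scan (hpos : Continuous pos) (hω : Continuous ω) :
    C(BConf pos ω (1 / 2), NLoop 1 (YConf pos ω) Conf.empty) :=
  NLoop.family ⟨fun p => window (inclE p.1.1) (3 - 4 * p.2), (continuous_window hpos hω).comp
    (((continuous_inclE hpos hω).comp (by fun_prop)).prodMk (by fun_prop))⟩
    (fun c => by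
      simp only [ContinuousMap.coe_mk, Set.Icc.coe_zero, mul_zero, sub_zero]
      exact window_three _)
    (fun c => by
      simp only [ContinuousMap.coe_mk, Set.Icc.coe_one, mul_one]
      norm_num only
      exact window_neg_one fun z hz => (c.2 z (mem_inclE.1 hz).2).le)

@[simp] theorem eval_scan (hpos : Continuous pos) (hω : Continuous ω) (c : BConf pos ω (1 / 2))
    (t : I) : NLoop.eval (scan pos ω hpos hω c) t = window (inclE c.1) (3 - 4 * t) := rfl

/-! ### Enlarging labels -/

/-- The configuration obtained by applying `χ` to labels. -/
def labelMap {w : ℝ × A → ℝ} (χ : A → A) (c : Conf (lpos pos) w) (w' : ℝ × A → ℝ) :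
    Conf (lpos pos) w' :=
  Conf.ofSet _ _ ((fun z : ℝ × A => (z.1, χ z.2)) '' {z ∈ c.pts | 0 < w' (z.1, χ z.2)})

/-- A deformation enlarging the labels until those of small weight disappear. -/
structure Enlarging (pos : A → Q) (ω : A → ℝ) (ψ : C(I × A, A)) : Prop where
  zero : ∀ a, ψ (0, a) = a
  pos_eq : ∀ τ a b, 0 < ω (ψ (τ, a)) → 0 < ω (ψ (τ, b)) → pos (ψ (τ, a)) = pos (ψ (τ, b)) →
    pos a = pos b
  le : ∀ τ a, ω (ψ (τ, a)) ≤ ω a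
  large : ∃ θ > 0, ∀ a, 0 < ω (ψ (1, a)) → θ ≤ ω a

variable {ψ : C(I × A, A)}

theorem mem_labelMap (h : Enlarging pos ω ψ) {w w' : ℝ × A → ℝ} (hw' : ∀ z, w' z ≤ ω z.2) {τ : I}
    {c : Conf (lpos pos) w} {z : ℝ × A} : z ∈ (labelMap (fun a => ψ (τ, a)) c w').pts ↔
      0 < w' z ∧ ∃ a, (z.1, a) ∈ c.pts ∧ ψ (τ, a) = z.2 := by
  rw [labelMap, Conf.ofSet_pts ((c.fin.subset fun _ h => h.1).image _)]
  · constructor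
    · rintro ⟨⟨x, hx, rfl⟩, h⟩
      exact ⟨h, x.2, hx.1, rfl⟩
    · rintro ⟨h, a, ha, hz⟩
      refine ⟨⟨_, ⟨ha, ?_⟩, Prod.ext rfl hz⟩, h⟩
      rw [hz]
      exact h
  · rintro _ ⟨a, ⟨ha, ha'⟩, rfl⟩ _ ⟨b, ⟨hb, hb'⟩, rfl⟩ hab
    obtain ⟨h1, h2⟩ := Prod.ext_iff.1
      (show (a.1, pos (ψ (τ, a.2))) = (b.1, pos (ψ (τ, b.2))) from hab)
    have := h.pos_eq τ a.2 b.2 (ha'.trans_le (hw' _)) (hb'.trans_le (hw' _)) h2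
    rw [c.inj ha hb (Prod.ext h1 this)]

theorem continuous_labelMap (hpos : Continuous pos) (h : Enlarging pos ω ψ) {w : ℝ × A → ℝ}
    (hw : Continuous w) (hwω : ∀ z, w z ≤ ω z.2)
    (hle : ∀ s a a', ω a ≤ ω a' → w (s, a) ≤ w (s, a')) {τ : T → I} {c : T → Conf (lpos pos) w}
    (hτ : Continuous τ) (hc : Continuous c) :
    Continuous fun t => labelMap (fun a => ψ (τ t, a)) (c t) w := by
  refine continuous_iff_continuousAt.2 fun t => ?_
  refine Conf.continuousAt_push (ψ := fun t z => (z.1, ψ (τ t, z.2)))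
    (v := fun t z => w (z.1, ψ (τ t, z.2))) (continuous_lpos hpos) hw hc.continuousAt ?_
    (fun _ _ _ _ => rfl) ?_ ?_ ?_ ?_
  · intro t
    ext z
    rw [mem_labelMap h hwω]
    constructor
    · rintro ⟨hz, a, ha, haz⟩
      refine ⟨(z.1, a), ⟨ha, ?_⟩, Prod.ext rfl haz⟩
      simp only [haz]
      exact hz
    · rintro ⟨x, ⟨hx, hx'⟩, rfl⟩
      exact ⟨hx', x.2, hx, rfl⟩
  · rintro a ⟨ha, ha'⟩ b ⟨hb, hb'⟩ hab
    obtain ⟨h1, h2⟩ := Prod.ext_iff.1 hab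
    have := h.pos_eq _ a.2 b.2 (ha'.trans_le (hwω _)) (hb'.trans_le (hwω _)) (congrArg pos h2)
    exact (c t).inj ha hb (Prod.ext h1 this)
  · intro z _ _
    exact Continuous.continuousAt (by fun_prop)
  · intro z _
    exact Continuous.continuousAt (by fun_prop)
  · exact fun δ hδ => ⟨δ, hδ, Filter.Eventually.of_forall fun t z hz =>
      hz.trans (hle _ _ _ (h.le _ _))⟩

theorem labelMap_zero (h : Enlarging pos ω ψ) {w : ℝ × A → ℝ} (hwω : ∀ z, w z ≤ ω z.2)
    (c : Conf (lpos pos) w) : labelMap (fun a => ψ (0, a)) c w = c := by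
  apply Conf.ext
  ext z
  rw [mem_labelMap h hwω]
  constructor
  · rintro ⟨-, a, ha, haz⟩
    rw [h.zero] at haz
    subst haz
    exact ha
  · exact fun hz => ⟨c.wpos z hz, z.2, hz, h.zero _⟩

theorem sparse_labelMap (hω : Continuous ω) (h : Enlarging pos ω ψ) {y : T → YConf pos ω}
    (hy : Continuous y) : Sparse fun t => labelMap (fun a => ψ (1, a)) (y t) (wY ω) := by
  obtain ⟨θ, hθ, hlarge⟩ := h.large
  intro p a b ha hab hb
  obtain ⟨L, hL, hLn⟩ := (Ioo_infinite hab).exists_notMem_finite ((y p).fin.image Prod.fst)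
  refine ⟨L, hL.1, hL.2, ?_⟩
  have hcl : IsClosed {z : ℝ × A | z.1 = L ∧ θ ≤ ω z.2} :=
    (isClosed_eq continuous_fst continuous_const).inter
      (isClosed_le continuous_const (hω.comp continuous_snd))
  have := hy.continuousAt.eventually (Conf.eventually_disjoint (c₀ := y p) hcl
    (δ := min θ (min L (1 - L))) (lt_min hθ (lt_min (by linarith [hL.1]) (by linarith [hL.2])))
    (fun z hz => by
      obtain ⟨rfl, hz⟩ := hz
      exact min_le_min_right _ hz)
    (eq_empty_of_forall_notMem fun z hz => hLn ⟨z, hz.1, hz.2.1⟩))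
  filter_upwards [this] with q hq z hz hzL
  obtain ⟨hz0, a', ha', hza⟩ := (mem_labelMap h fun z => min_le_left _ _).1 hz
  have : ((z.1, a') : ℝ × A) ∈ (y q).pts ∩ {z : ℝ × A | z.1 = L ∧ θ ≤ ω z.2} :=
    ⟨ha', hzL, hlarge _ (by rw [hza]; exact (lt_min_iff.1 hz0).1)⟩
  rw [hq] at this
  exact this

theorem labelMap_window (h : Enlarging pos ω ψ) {c : CConf pos ω}
    (τ : I) (q : ℝ) : labelMap (fun a => ψ (τ, a)) (window (inclE c) q) (wY ω) =
      window (inclE (labelMap (fun a => ψ (τ, a)) c (wC ω))) q := by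
  apply Conf.ext
  ext z
  rw [mem_labelMap h (fun z => min_le_left _ _), mem_window]
  refine and_congr_right fun hz => ?_
  obtain ⟨h1, h2⟩ := lt_min_iff.1 hz
  simp only [mem_window, mem_inclE, mem_labelMap h (w' := wC ω) fun z => le_refl (ω z.2)]
  constructor
  · rintro ⟨a, ⟨-, s, ⟨hs, hs'⟩, hsz⟩, haz⟩
    exact ⟨s, ⟨lt_min h1 (lt_min_iff.1 hs).2, h1, a, hs', haz⟩, hsz⟩
  · rintro ⟨s, ⟨hs, -, a, hs', haz⟩, hsz⟩
    have : 0 < ω a := h1.trans_le (haz ▸ h.le τ a)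
    exact ⟨a, ⟨lt_min this h2, s, ⟨lt_min this (lt_min_iff.1 hs).2, hs'⟩, hsz⟩, haz⟩

end Scan

section ScanFills

variable {A Q : Type*} [TopologicalSpace A] [TopologicalSpace Q] [T2Space Q]
  {pos : A → Q} {ω : A → ℝ} {V : Type*} [NormedAddCommGroup V] [NormedSpace ℝ V]

/-- A constant family of maps. -/
def constFam (V : Type*) [NormedAddCommGroup V] {F₁ F₂ : Type*} [TopologicalSpace F₁]
    [TopologicalSpace F₂] (f : C(F₁, F₂)) : C(Bal V × F₁, F₂) := f.comp ContinuousMap.snd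

@[simp] theorem constFam_apply {F₁ F₂ : Type*} [TopologicalSpace F₁]
    [TopologicalSpace F₂] (f : C(F₁, F₂)) (p : Bal V × F₁) : constFam V f p = f p.2 := rfl

theorem Fillable.of_constFam_comp {F₁ F₂ F₃ : Type*} [TopologicalSpace F₁] [TopologicalSpace F₂]
    [TopologicalSpace F₃] {f : C(F₁, F₂)} (g : C(F₂, F₃)) {a : C(Sph V, F₁)} {b : C(Bal V, F₂)}
    (h : Fillable (constFam V f) a b) : Fillable (constFam V (g.comp f)) a (g.comp b) := by
  obtain ⟨a', Γ, h1, h2, h3, h4⟩ := h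
  exact ⟨a', g.comp Γ, h1, fun v => congrArg g (h2 v), fun v => congrArg g (h3 v),
    fun t k => congrArg g (h4 t k)⟩

theorem Fillable.congr {F₁ F₂ : Type*} [TopologicalSpace F₁] [TopologicalSpace F₂]
    {f f' : C(Bal V × F₁, F₂)} {a a' : C(Sph V, F₁)} {b b' : C(Bal V, F₂)} (h : Fillable f a b)
    (hf : ∀ p, f' p = f p) (ha : ∀ k, a' k = a k) (hb : ∀ v, b' v = b v) : Fillable f' a' b' := by
  rwa [ContinuousMap.ext hf, ContinuousMap.ext ha, ContinuousMap.ext hb]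

theorem Fills.of_deformation {F : Type*} [TopologicalSpace F] (α : C(I × F, F))
    (h : ∀ x, α (0, x) = x) : Fills (constFam V (slice α 1)) := by
  have := Fills.of_homotopy (V := V) (α.comp
    ⟨fun p : I × Bal V × F => (unitInterval.symm p.1, p.2.2),
    by fun_prop⟩) (by
      have h := Fills.of_homeomorph (V := V) (Homeomorph.refl F)
      convert h using 1
      ext p
      simp [*])
  convert this using 1
  ext p
  simp

/-- Compressing low configurations. -/
def compress (c : CConf pos ω) (l : I) : CConf pos ω :=
  levelMap (fun s => (1 - l) * s + l * (stretch s - 1)) c (wC ω)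

theorem compress_strictMono (l : I) :
    StrictMono fun s : ℝ => (1 - l) * s + l * (stretch s - 1) := by
  intro a b h
  have h1 := l.2.1
  have h2 := l.2.2
  have h3 := stretch_strictMono h
  simp only
  rcases h1.eq_or_lt with h0 | h0
  · rw [← h0]; linarith
  · nlinarith

theorem mem_compress {c : CConf pos ω} {l : I} {z : ℝ × A} : z ∈ (compress c l).pts ↔
    0 < wC ω z ∧ ∃ s, (s, z.2) ∈ c.pts ∧ (1 - l) * s + l * (stretch s - 1) = z.1 :=
  mem_levelMap (compress_strictMono l)

theorem compress_lt {c : CConf pos ω} (h : ∀ z ∈ c.pts, z.1 < 1 / 2) (l : I) {z : ℝ × A}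
    (hz : z ∈ (compress c l).pts) : z.1 < 1 / 2 := by
  obtain ⟨-, s, hs, hsz⟩ := mem_compress.1 hz
  have hs1 : s < 1 / 2 := h _ hs
  have h1 := stretch_lt (by norm_num) hs1
  have h2 := l.2.1
  have h3 := l.2.2
  rcases h2.eq_or_lt with h0 | h0
  · rw [← h0] at hsz; linarith
  · nlinarith

theorem continuous_compress (hpos : Continuous pos) (hω : Continuous ω) :
    Continuous fun p : I × CConf pos ω => compress p.2 p.1 :=
  continuous_levelMap hpos (continuous_wC hω) (continuous_wC hω)
    (θ := fun (p : I × CConf pos ω) s => (1 - p.1) * s + p.1 * (stretch s - 1)) (c := fun p => p.2)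
    (by fun_prop) (by fun_prop) (fun p => compress_strictMono _) fun δ hδ =>
    ⟨δ, hδ, fun _ _ h => h⟩

theorem window_empty (q : ℝ) : window (Conf.empty : EConf pos ω) q = Conf.empty := by
  apply Conf.ext
  refine eq_empty_of_forall_notMem fun z hz => ?_
  obtain ⟨-, s, h, -⟩ := mem_window.1 hz
  exact h

theorem Fillable.scan_of_sparse (hpos : Continuous pos) (hω : Continuous ω)
    (hvan : Vanishes pos ω) {m : ℕ} (a : C(Sph (Fin m → ℝ), BConf pos ω (1 / 2)))
    (b : C(Bal (Fin m → ℝ), NLoop 1 (YConf pos ω) Conf.empty))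
    (hab : ∀ k, b (sphIncl _ k) = scan pos ω hpos hω (a k))
    (hs : Sparse fun p : I × Bal (Fin m → ℝ) => NLoop.eval (b p.2) p.1) :
    Fillable (constFam _ (scan pos ω hpos hω)) a b := by
  let h : C(I × Bal (Fin m → ℝ), YConf pos ω) := ⟨fun p => NLoop.eval (b p.2) p.1, by fun_prop⟩
  let g : C(I × Sph (Fin m → ℝ), EConf pos ω) := ⟨fun p => scanE (a p.2).1 p.1, by fun_prop⟩
  obtain ⟨e, he0, hek, he⟩ := exists_cyl_lift hpos hω hvan h hs
    ⟨fun _ => Conf.empty, continuous_const⟩ g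
    (fun v z _ => by simp [h]) (fun k => scanE_zero _)
    (fun t k => by
      simp only [ContinuousMap.coe_mk, h, g, hab, eval_scan]
      exact scanE_lifts (a k).2 t.2.2)
  simp only [ContinuousMap.coe_mk, h, g] at he0 hek he
  have heE : ∀ v, ∀ z ∈ (e (1, v)).pts, z.1 ≤ 1 / 4 := by
    intro v z hz
    by_contra! h
    have := (he (1, v) z h).1 hz
    simp at this
  let α : C(I × BConf pos ω (1 / 2), BConf pos ω (1 / 2)) :=
    ⟨fun p => ⟨compress p.2.1 p.1, fun z hz => compress_lt p.2.2 p.1 hz⟩,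
      ((continuous_compress hpos hω).comp (continuous_fst.prodMk
        (continuous_subtype_val.comp continuous_snd))).subtype_mk _⟩
  let c : C(Bal (Fin m → ℝ), BConf pos ω (1 / 2)) :=
    ⟨fun v => ⟨cutBelow (1 / 2) (e (1, v)), fun z hz => hz.2.1⟩,
      Continuous.subtype_mk (continuous_iff_continuousAt.2 fun v =>
        continuousAt_cutBelow hpos hω (by norm_num) (e := fun v => e (1, v))
          (Continuous.continuousAt (by fun_prop)) fun z hz h => by
            have := heE v z hz
            rw [h] at this
            norm_num at this) _⟩
  have hα : Fillable (constFam (Fin m → ℝ) (slice α 1)) a c := by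
    refine Fills.of_deformation _ ?_ _ _ ?_
    · intro c
      apply Subtype.ext
      apply Conf.ext
      ext z
      simp only [α, ContinuousMap.coe_mk, mem_compress, Set.Icc.coe_zero]
      constructor
      · rintro ⟨-, s, hs, h⟩
        obtain rfl : s = z.1 := by linarith
        exact hs
      · exact fun h => ⟨c.1.wpos z h, z.1, h, by ring⟩
    · intro k
      apply Subtype.ext
      apply Conf.ext
      ext z
      simp only [α, c, ContinuousMap.coe_mk, constFam_apply, slice_apply, mem_compress,
        Set.Icc.coe_one,
        cutBelow, Conf.mem_restrict, hek, mem_scanE, mem_ofPred_eq]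
      constructor
      · rintro ⟨⟨h1, s, hs, hsz⟩, h3, h4⟩
        exact ⟨h4, s, hs, by linarith⟩
      · rintro ⟨h, s, hs, hsz⟩
        have h5 := stretch_lt (by norm_num) ((a k).2 _ hs)
        simp only at h5
        exact ⟨⟨lt_min h (by linarith), s, hs, by linarith⟩, by linarith, h⟩
  have h4 := hα.of_constFam_comp (scan pos ω hpos hω)
  have hmid : ∀ c : BConf pos ω (1 / 2), window (scanE c.1 1) (-1) = Conf.empty := fun c =>
    window_neg_one fun z hz => (scanE_one_lt c.2 hz).le.trans (by norm_num)
  have hmide : ∀ v, window (e (1, v)) (-1) = Conf.empty := fun v =>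
    window_neg_one fun z hz => (heE v z hz).trans (by norm_num)
  let f₃ : C(I × Bal (Fin m → ℝ) × BConf pos ω (1 / 2), NLoop 1 (YConf pos ω) Conf.empty) :=
    NLoop.family ⟨fun p => window (scanE p.1.2.2.1 (p.1.1 + (1 - p.1.1) * p.2)) (3 - 4 * p.2),
      by fun_prop⟩ (fun k => by simp [window_three]) (fun k => by
      simp only [ContinuousMap.coe_mk, Set.Icc.coe_one]
      norm_num only [mul_one, add_sub_cancel]
      exact hmid _)
  let b₃ : C(I × Bal (Fin m → ℝ), NLoop 1 (YConf pos ω) Conf.empty) :=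
    NLoop.family ⟨fun p => window (e (unitInterval.lerp p.1.1 p.2 1, p.1.2)) (3 - 4 * p.2),
      by fun_prop⟩ (fun k => by simp [window_three]) (fun k => by
      simp only [ContinuousMap.coe_mk, Set.Icc.coe_one, lerp_self]
      norm_num only [mul_one, add_sub_cancel]
      exact hmide _)
  have h3 : Fillable (slice f₃ 0) a (slice b₃ 0) := by
    refine Fillable.of_square f₃ (a.comp ⟨fun p => p.2, by fun_prop⟩) b₃ ?_ ?_
    · intro t k
      refine NLoop.ext fun s => ?_
      change window _ _ = window _ _
      rw [hek]
      refine congrArg₂ window (congrArg (scanE _) ?_) rfl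
      simp only [unitInterval.lerp, Set.Icc.coe_one]
      ring
    · refine h4.congr (fun p => NLoop.ext fun s => ?_) (fun k => rfl) fun v => NLoop.ext fun s => ?_
      · change window _ _ = window _ _
        refine congrArg₂ window (Conf.ext (Set.ext fun z => ?_)) rfl
        simp only [mem_inclE, mem_scanE, α, slice_apply, ContinuousMap.coe_mk, mem_compress,
          Set.Icc.coe_one]
        constructor
        · rintro ⟨h, s, hs, hsz⟩
          exact ⟨h, (lt_min_iff.1 h).1, s, hs, by linarith⟩
        · rintro ⟨h, -, s, hs, hsz⟩
          exact ⟨h, s, hs, by linarith⟩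
      · change window _ _ = window _ _
        refine congrArg₂ window (Conf.ext (Set.ext fun z => ?_)) rfl
        simp only [mem_inclE, c, ContinuousMap.coe_mk, cutBelow, Conf.mem_restrict,
          mem_ofPred_eq]
        rw [unitInterval.lerp_one]
        refine ⟨fun h => ?_, fun h => h.2.1⟩
        · have h5 := (e (1, v)).wpos z h
          have h6 := heE v z h
          exact ⟨h5, h, by linarith, (lt_min_iff.1 h5).1⟩
  let f₂ : C(I × Bal (Fin m → ℝ) × BConf pos ω (1 / 2), NLoop 1 (YConf pos ω) Conf.empty) :=
    NLoop.family ⟨fun p => window (scanE p.1.2.2.1 p.2) (4 * p.1.1 * (1 - p.2) - 1),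
      by fun_prop⟩ (fun k => by simp [scanE_zero, window_empty]) (fun k => by
      simp [hmid])
  let b₂ : C(I × Bal (Fin m → ℝ), NLoop 1 (YConf pos ω) Conf.empty) :=
    NLoop.family ⟨fun p => window (e (p.2, p.1.2)) (4 * p.1.1 * (1 - p.2) - 1),
      by fun_prop⟩ (fun k => by simp [he0, window_empty]) (fun k => by
      simp [hmide])
  have h2 : Fillable (slice f₂ 0) a (slice b₂ 0) := by
    refine Fillable.of_square f₂ (a.comp ⟨fun p => p.2, by fun_prop⟩) b₂ ?_ ?_
    · intro t k
      refine NLoop.ext fun s => ?_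
      change window _ _ = window _ _
      rw [hek]
      rfl
    · refine h3.congr (fun p => NLoop.ext fun s => ?_) (fun k => rfl) fun v => NLoop.ext fun s => ?_
      · change window (scanE p.2.1 s) (4 * ((1 : I) : ℝ) * (1 - s) - 1) =
          window (scanE p.2.1 (((0 : I) : ℝ) + (1 - ((0 : I) : ℝ)) * s)) (3 - 4 * s)
        simp only [Set.Icc.coe_zero, Set.Icc.coe_one]
        refine congrArg₂ window (congrArg (scanE _) ?_) ?_ <;> ring
      · change window (e (s, v)) (4 * ((1 : I) : ℝ) * (1 - s) - 1) =
          window (e (unitInterval.lerp 0 s 1, v)) (3 - 4 * s)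
        simp only [unitInterval.lerp_zero, Set.Icc.coe_one]
        refine congrArg (window _) ?_
        ring
  let f₁ : C(I × Bal (Fin m → ℝ) × BConf pos ω (1 / 2), NLoop 1 (YConf pos ω) Conf.empty) :=
    NLoop.family ⟨fun p => zoom (NLoop.eval (scan pos ω hpos hω p.1.2.2) p.2) p.1.1,
      by fun_prop⟩ (fun k => by simp only [ContinuousMap.coe_mk, NLoop.eval_zero, zoom_empty])
      (fun k => by
      simp only [ContinuousMap.coe_mk, NLoop.eval_one, zoom_empty])
  let b₁ : C(I × Bal (Fin m → ℝ), NLoop 1 (YConf pos ω) Conf.empty) :=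
    NLoop.family ⟨fun p => zoom (NLoop.eval (b p.1.2) p.2) p.1.1,
      by fun_prop⟩ (fun k => by simp only [ContinuousMap.coe_mk, NLoop.eval_zero, zoom_empty])
      (fun k => by
      simp only [ContinuousMap.coe_mk, NLoop.eval_one, zoom_empty])
  have h1 : Fillable (slice f₁ 0) a (slice b₁ 0) := by
    refine Fillable.of_square f₁ (a.comp ⟨fun p => p.2, by fun_prop⟩) b₁ ?_ ?_
    · intro t k
      refine NLoop.ext fun s => ?_
      change zoom _ _ = zoom _ _
      rw [hab]
      rfl
    · refine h2.congr (fun p => NLoop.ext fun s => ?_) (fun k => rfl) fun v => NLoop.ext fun s => ?_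
      · change zoom (window _ _) 1 = window (scanE p.2.1 s) (4 * ((0 : I) : ℝ) * (1 - s) - 1)
        simp only [Set.Icc.coe_zero, mul_zero, zero_mul, zero_sub]
        exact zoom_one fun z hz => scanE_lifts p.2.2 s.2.2 z (lt_trans (by norm_num) hz)
      · change zoom _ 1 = window (e (s, v)) (4 * ((0 : I) : ℝ) * (1 - s) - 1)
        simp only [Set.Icc.coe_zero, mul_zero, zero_mul, zero_sub]
        exact zoom_one (he (s, v))
  refine h1.congr (fun p => NLoop.ext fun s => (zoom_zero _).symm) (fun k => rfl)
    fun v => NLoop.ext fun s => (zoom_zero _).symm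

theorem labelMap_empty {ψ : C(I × A, A)} (h : Enlarging pos ω ψ) (τ : I) {w : ℝ × A → ℝ}
    (hwω : ∀ z, w z ≤ ω z.2) :
    labelMap (fun a => ψ (τ, a)) (Conf.empty : Conf (lpos pos) w) w = Conf.empty := by
  apply Conf.ext
  refine eq_empty_of_forall_notMem fun z hz => ?_
  obtain ⟨-, s, h, -⟩ := (mem_labelMap h hwω).1 hz
  exact h

theorem Fills.constFam_scan (hpos : Continuous pos) (hω : Continuous ω)
    (hvan : Vanishes pos ω) {ψ : C(I × A, A)} (hψ : Enlarging pos ω ψ) (m : ℕ) :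
    Fills (constFam (Fin m → ℝ) (scan pos ω hpos hω)) := by
  intro a b hab
  have hle : ∀ s : ℝ, ∀ a a' : A, ω a ≤ ω a' → wY ω (s, a) ≤ wY ω (s, a') :=
    fun s a a' h => min_le_min_right _ h
  let aψ : C(I × Sph (Fin m → ℝ), BConf pos ω (1 / 2)) :=
    ⟨fun p => ⟨labelMap (fun a => ψ (p.1, a)) (a p.2).1 (wC ω), fun z hz => by
      obtain ⟨-, x, hx, -⟩ := (mem_labelMap hψ fun z => le_refl (ω z.2)).1 hz
      exact (a p.2).2 (z.1, x) hx⟩,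
      Continuous.subtype_mk (continuous_labelMap hpos hψ (continuous_wC hω)
        (fun z => le_rfl) (fun _ _ _ h => h) (by fun_prop) (by fun_prop)) _⟩
  let bψ : C(I × Bal (Fin m → ℝ), NLoop 1 (YConf pos ω) Conf.empty) :=
    NLoop.family ⟨fun p => labelMap (fun a => ψ (p.1.1, a)) (NLoop.eval (b p.1.2) p.2) (wY ω),
      continuous_labelMap hpos hψ (continuous_wY hω) (fun z => min_le_left _ _) hle
        (by fun_prop) (by fun_prop)⟩
      (fun k => by
        simp only [ContinuousMap.coe_mk, NLoop.eval_zero]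
        exact labelMap_empty hψ _ fun z => min_le_left _ _)
      (fun k => by
        simp only [ContinuousMap.coe_mk, NLoop.eval_one]
        exact labelMap_empty hψ _ fun z => min_le_left _ _)
  have key : ∀ t k, bψ (t, sphIncl _ k) = scan pos ω hpos hω (aψ (t, k)) := by
    intro t k
    refine NLoop.ext fun s => ?_
    change labelMap (fun a => ψ (t, a)) (NLoop.eval (b (sphIncl _ k)) s) (wY ω) =
      window (inclE (labelMap (fun a => ψ (t, a)) (a k).1 (wC ω))) (3 - 4 * s)
    have : b (sphIncl _ k) = scan pos ω hpos hω (a k) := hab k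
    rw [this]
    exact labelMap_window hψ t _
  have h1 : Fillable (constFam (Fin m → ℝ) (scan pos ω hpos hω)) (slice aψ 1) (slice bψ 1) :=
    Fillable.scan_of_sparse hpos hω hvan _ _ (key 1)
      (sparse_labelMap hω hψ (y := fun p : I × Bal (Fin m → ℝ) => NLoop.eval (b p.2) p.1)
        (by fun_prop))
  have h0 := Fillable.of_square (constFam (Fin m → ℝ) (scan pos ω hpos hω)|>.comp
    ⟨fun p : I × Bal (Fin m → ℝ) × BConf pos ω (1 / 2) => p.2, by fun_prop⟩) aψ bψ key h1
  refine h0.congr (fun p => rfl) (fun k => Subtype.ext ?_) fun v => NLoop.ext fun s => ?_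
  · exact (labelMap_zero hψ (fun z => le_rfl) _).symm
  · exact (labelMap_zero hψ (fun z => min_le_left _ _) _).symm

end ScanFills

section Weak

variable {F₁ F₂ F₃ : Type*} [TopologicalSpace F₁] [TopologicalSpace F₂] [TopologicalSpace F₃]

/-- The affine identification of the ball of the supremum norm with the cube. -/
def balToCube (m : ℕ) : C(Bal (Fin m → ℝ), Fin m → I) where
  toFun v i := ⟨(v.1 i + 1) / 2, by
    obtain ⟨h1, h2⟩ := abs_le.1 (v.abs_le i)
    constructor <;> linarith⟩
  continuous_toFun := continuous_pi fun i => Continuous.subtype_mk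
    (((Bal.continuous_coord continuous_id i).add_const 1).div_const 2) _

/-- The affine identification of the cube with the ball of the supremum norm. -/
def cubeToBal (m : ℕ) : C(Fin m → I, Bal (Fin m → ℝ)) where
  toFun t := Bal.mk' (fun i => 2 * (t i : ℝ) - 1) fun i => by
    have h1 := (t i).2.1
    have h2 := (t i).2.2
    exact abs_le.2 ⟨by linarith, by linarith⟩
  continuous_toFun := Continuous.subtype_mk (by fun_prop) _

theorem balToCube_cubeToBal {m : ℕ} (t : Fin m → I) : balToCube m (cubeToBal m t) = t := by
  funext i
  apply Subtype.ext
  simp [balToCube, cubeToBal, Bal.mk']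

theorem cubeToBal_balToCube {m : ℕ} (v : Bal (Fin m → ℝ)) : cubeToBal m (balToCube m v) = v := by
  apply Subtype.ext
  funext i
  simp only [balToCube, cubeToBal, Bal.mk', ContinuousMap.coe_mk]
  ring

theorem cubeToBal_norm {m : ℕ} (t : Fin m → I) :
    ‖(cubeToBal m t).1‖ = 1 ↔ t ∈ Cube.boundary (Fin m) := by
  rw [Bal.norm_eq_one_iff]
  refine exists_congr fun i => ?_
  simp only [cubeToBal, Bal.mk', ContinuousMap.coe_mk, Subtype.ext_iff, Set.Icc.coe_zero,
    Set.Icc.coe_one]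
  rw [abs_eq zero_le_one, or_comm]
  constructor <;> rintro (h | h) <;> [left; right; left; right] <;> linarith

theorem Fills.exists_cube {m : ℕ} {f : C(F₁, F₂)} (hf : Fills (constFam (Fin m → ℝ) f))
    (a : C(Cube.boundary (Fin m), F₁)) (b : C(Fin m → I, F₂)) (hab : ∀ t, b t.1 = f (a t)) :
    ∃ (a' : C(Fin m → I, F₁)) (Γ : C(I × (Fin m → I), F₂)), (∀ t, a' t.1 = a t) ∧
      (∀ t, Γ (0, t) = b t) ∧ (∀ t, Γ (1, t) = f (a' t)) ∧
      ∀ s, ∀ t ∈ Cube.boundary (Fin m), Γ (s, t) = b t := by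
  have hS : ∀ k : Sph (Fin m → ℝ), balToCube m (sphIncl _ k) ∈ Cube.boundary (Fin m) := fun k => by
    rw [← cubeToBal_norm, cubeToBal_balToCube]
    exact k.norm_eq
  obtain ⟨a', Γ, h1, h2, h3, h4⟩ := hf
    (a.comp ⟨fun k => ⟨balToCube m (sphIncl _ k), hS k⟩, by fun_prop⟩) (b.comp (balToCube m))
    (fun k => hab ⟨_, hS k⟩)
  have hB : ∀ t ∈ Cube.boundary (Fin m), ∃ k : Sph (Fin m → ℝ), sphIncl _ k = cubeToBal m t :=
    fun t ht => ⟨⟨_, mem_sphere_zero_iff_norm.2 ((cubeToBal_norm t).2 ht)⟩, rfl⟩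
  refine ⟨a'.comp (cubeToBal m), Γ.comp ⟨fun p => (p.1, cubeToBal m p.2), by fun_prop⟩,
    fun t => ?_, fun t => ?_, fun t => h3 _, fun s t ht => ?_⟩
  · obtain ⟨k, hk⟩ := hB t.1 t.2
    simp only [ContinuousMap.comp_apply, ← hk, h1]
    refine congrArg a (Subtype.ext ?_)
    simp only [ContinuousMap.coe_mk, hk, balToCube_cubeToBal]
  · refine (h2 _).trans ?_
    simp [balToCube_cubeToBal]
  · obtain ⟨k, hk⟩ := hB t ht
    simp only [ContinuousMap.comp_apply, ContinuousMap.coe_mk, ← hk, h4]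
    rw [hk, balToCube_cubeToBal]

theorem Fills.exists_homotopy {n : ℕ} {f : C(F₁, F₂)}
    (hf : Fills (constFam (Fin (n + 1) → ℝ) f)) (α₀ α₁ : C(Fin n → I, F₁))
    (hα : ∀ t ∈ Cube.boundary (Fin n), α₀ t = α₁ t) (H : C(I × (Fin n → I), F₂))
    (h0 : ∀ t, H (0, t) = f (α₀ t)) (h1 : ∀ t, H (1, t) = f (α₁ t))
    (hH : ∀ s, ∀ t ∈ Cube.boundary (Fin n), H (s, t) = f (α₀ t)) :
    ∃ G : C(I × (Fin n → I), F₁), (∀ t, G (0, t) = α₀ t) ∧ (∀ t, G (1, t) = α₁ t) ∧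
      ∀ s, ∀ t ∈ Cube.boundary (Fin n), G (s, t) = α₀ t := by
  classical
  have htail : ∀ t ∈ Cube.boundary (Fin (n + 1)), t 0 ≠ 0 → t 0 ≠ 1 →
      Fin.tail t ∈ Cube.boundary (Fin n) := by
    rintro t ⟨i, hi⟩ h0 h1
    induction i using Fin.cases with
    | zero => exact absurd hi (by simp [h0, h1])
    | succ i => exact ⟨i, hi⟩
  have hct : Continuous fun t : Fin (n + 1) → I => Fin.tail t :=
    continuous_pi fun i => continuous_apply _
  let a : C(Cube.boundary (Fin (n + 1)), F₁) :=
    ⟨fun t => if (t.1 0 : ℝ) ≤ 1 / 2 then α₀ (Fin.tail t.1) else α₁ (Fin.tail t.1), by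
      refine Continuous.if_le (α₀.continuous.comp (hct.comp continuous_subtype_val))
        (α₁.continuous.comp (hct.comp continuous_subtype_val))
        (continuous_subtype_val.comp ((continuous_apply 0).comp continuous_subtype_val))
        continuous_const ?_
      intro t ht
      refine hα _ (htail _ t.2 ?_ ?_) <;> intro h <;> rw [h] at ht <;> norm_num at ht⟩
  obtain ⟨a', -, ha', -, -, -⟩ := hf.exists_cube a
    (H.comp ⟨fun t => (t 0, Fin.tail t), (continuous_apply 0).prodMk hct⟩) (by
      intro t
      simp only [ContinuousMap.comp_apply, ContinuousMap.coe_mk, a]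
      by_cases ht0 : t.1 0 = 0
      · simp [ht0, h0]
      by_cases ht1 : t.1 0 = 1
      · rw [ht1, h1, if_neg (by norm_num)]
      rw [hH _ _ (htail _ t.2 ht0 ht1)]
      split_ifs
      · rfl
      · rw [hα _ (htail _ t.2 ht0 ht1)])
  have hG : ∀ s t, Fin.cons s t ∈ Cube.boundary (Fin (n + 1)) →
      a' (Fin.cons s t : Fin (n + 1) → I) = if (s : ℝ) ≤ 1 / 2 then α₀ t else α₁ t :=
    fun s t h => (ha' ⟨_, h⟩).trans (by simp [a])
  refine ⟨a'.comp ⟨fun p => (Fin.cons p.1 p.2 : Fin (n + 1) → I), ?_⟩, fun t => ?_, fun t => ?_,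
    fun s t ht => ?_⟩
  · refine continuous_pi fun i => ?_
    induction i using Fin.cases with
    | zero => exact continuous_fst
    | succ i => exact (continuous_apply i).comp continuous_snd
  · simp only [ContinuousMap.comp_apply, ContinuousMap.coe_mk]
    rw [hG _ _ ⟨0, Or.inl rfl⟩, if_pos (by norm_num)]
  · simp only [ContinuousMap.comp_apply, ContinuousMap.coe_mk]
    rw [hG _ _ ⟨0, Or.inr rfl⟩, if_neg (by norm_num)]
  · obtain ⟨i, hi⟩ := ht
    simp only [ContinuousMap.comp_apply, ContinuousMap.coe_mk]
    rw [hG _ _ ⟨i.succ, hi⟩, hα _ ⟨i, hi⟩, ite_self]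

/-- A map with the lifting property of balls relative to spheres is a weak homotopy equivalence. -/
theorem IsWeakHomotopyEquiv.of_fills {f : C(F₁, F₂)}
    (hf : ∀ m, Fills (constFam (Fin m → ℝ) f)) : IsWeakHomotopyEquiv f := by
  refine ⟨⟨?_, ?_⟩, fun n x => ⟨?_, ?_⟩⟩
  · intro a b
    refine Quotient.inductionOn₂ a b fun x y hxy => ?_
    obtain ⟨p⟩ : Joined (f x) (f y) := Quotient.exact hxy
    obtain ⟨G, hG0, hG1, -⟩ := (hf 1).exists_homotopy (ContinuousMap.const _ x)
      (ContinuousMap.const _ y) (fun t ⟨i, _⟩ => i.elim0) ⟨fun q => p q.1, by fun_prop⟩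
      (fun t => by simp) (fun t => by simp) (fun s t ⟨i, _⟩ => i.elim0)
    exact Quotient.sound ⟨⟨⟨fun s => G (s, fun _ => 0), by fun_prop⟩, hG0 _, hG1 _⟩⟩
  · intro b
    refine Quotient.inductionOn b fun y => ?_
    obtain ⟨a', Γ, -, h0, h1, -⟩ := (hf 0).exists_cube ⟨fun t => t.2.choose.elim0, by
      have : IsEmpty (Cube.boundary (Fin 0)) := ⟨fun t => t.2.choose.elim0⟩
      exact continuous_of_discreteTopology⟩ (ContinuousMap.const _ y)
      (fun t => t.2.choose.elim0)
    refine ⟨Quotient.mk _ (a' fun _ => 0), Quotient.sound ?_⟩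
    exact Joined.symm ⟨⟨⟨fun s => Γ (s, fun _ => 0), by fun_prop⟩, h0 _, h1 _⟩⟩
  · intro a b
    refine Quotient.inductionOn₂ a b fun p q hpq => ?_
    obtain ⟨H⟩ : GenLoop.Homotopic _ _ := Quotient.exact hpq
    obtain ⟨G, hG0, hG1, hG⟩ := (hf (n + 1)).exists_homotopy p.1 q.1
      (fun t ht => (p.2 t ht).trans (q.2 t ht).symm) H.toContinuousMap
      (fun t => H.apply_zero t) (fun t => H.apply_one t) (fun s t ht => H.prop' s t ht)
    exact Quotient.sound ⟨⟨⟨G, hG0, hG1⟩, hG⟩⟩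
  · intro b
    refine Quotient.inductionOn b fun q => ?_
    obtain ⟨a', Γ, ha, h0, h1, h⟩ := (hf n).exists_cube (ContinuousMap.const _ x) q.1
      (fun t => q.2 t.1 t.2)
    refine ⟨Quotient.mk _ ⟨a', fun t ht => ha ⟨t, ht⟩⟩, Quotient.sound ?_⟩
    exact GenLoop.Homotopic.symm ⟨⟨⟨Γ, h0, h1⟩, h⟩⟩

theorem ZerothHomotopy.inducedMap_comp (g : C(F₂, F₃)) (f : C(F₁, F₂)) :
    ZerothHomotopy.inducedMap (g.comp f) =
      ZerothHomotopy.inducedMap g ∘ ZerothHomotopy.inducedMap f := by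
  funext a
  exact Quotient.inductionOn a fun _ => rfl

theorem HomotopyGroup.inducedMap_comp (N : Type*) (g : C(F₂, F₃)) (f : C(F₁, F₂)) (x : F₁) :
    HomotopyGroup.inducedMap N x (g.comp f) =
      HomotopyGroup.inducedMap N (f x) g ∘ HomotopyGroup.inducedMap N x f := by
  funext a
  exact Quotient.inductionOn a fun _ => rfl

theorem IsWeakHomotopyEquiv.comp {g : C(F₂, F₃)} {f : C(F₁, F₂)} (hg : IsWeakHomotopyEquiv g)
    (hf : IsWeakHomotopyEquiv f) : IsWeakHomotopyEquiv (g.comp f) :=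
  ⟨ZerothHomotopy.inducedMap_comp g f ▸ hg.1.comp hf.1, fun n x =>
    HomotopyGroup.inducedMap_comp (Fin n) g f x ▸ (hg.2 n (f x)).comp (hf.2 n x)⟩

theorem IsWeakHomotopyEquiv.of_comp_of_comp {g : C(F₂, F₁)} {f : C(F₁, F₂)}
    (h : IsWeakHomotopyEquiv (g.comp f)) (h' : IsWeakHomotopyEquiv (f.comp g)) :
    IsWeakHomotopyEquiv f := by
  refine ⟨⟨?_, ?_⟩, fun n x => ?_⟩
  · have := h.1.1
    rw [ZerothHomotopy.inducedMap_comp] at this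
    exact this.of_comp
  · have := h'.1.2
    rw [ZerothHomotopy.inducedMap_comp] at this
    exact this.of_comp
  · have h1 := h.2 n x
    have h2 := h'.2 n (f x)
    rw [HomotopyGroup.inducedMap_comp] at h1 h2
    have hg : Function.Bijective (HomotopyGroup.inducedMap (Fin n) (f x) g) :=
      ⟨h2.1.of_comp, h1.2.of_comp⟩
    exact (Function.Bijective.of_comp_iff' hg _).1 h1

theorem IsWeakHomotopyEquiv.of_deformation (α : C(I × F₁, F₁)) (h : ∀ x, α (0, x) = x) :
    IsWeakHomotopyEquiv (slice α 1) :=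
  .of_fills fun _ => Fills.of_deformation α h

theorem IsWeakHomotopyEquiv.of_homotopyInverse (f : C(F₁, F₂)) (g : C(F₂, F₁))
    (α : C(I × F₁, F₁)) (hα0 : ∀ x, α (0, x) = x) (hα1 : ∀ x, α (1, x) = g (f x))
    (β : C(I × F₂, F₂)) (hβ0 : ∀ x, β (0, x) = x) (hβ1 : ∀ x, β (1, x) = f (g x)) :
    IsWeakHomotopyEquiv f := by
  refine .of_comp_of_comp (g := g) ?_ ?_
  · convert IsWeakHomotopyEquiv.of_deformation α hα0 using 1
    ext x
    exact (hα1 x).symm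
  · convert IsWeakHomotopyEquiv.of_deformation β hβ0 using 1
    ext x
    exact (hβ1 x).symm

/-- The map of loop spaces induced by a based map. -/
def NLoop.map {y₁ : F₁} {y₂ : F₂} (f : C(F₁, F₂)) (hf : f y₁ = y₂) :
    C(NLoop 1 F₁ y₁, NLoop 1 F₂ y₂) :=
  NLoop.family ⟨fun p => f (NLoop.eval p.1 p.2), by fun_prop⟩ (fun k => by simp [hf])
    (fun k => by simp [hf])

theorem IsWeakHomotopyEquiv.nloopMap {y₁ : F₁} {y₂ : F₂} (f : C(F₁, F₂)) (hf : f y₁ = y₂)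
    (g : C(F₂, F₁)) (hg : g y₂ = y₁)
    (α : C(I × F₁, F₁)) (hα0 : ∀ x, α (0, x) = x) (hα1 : ∀ x, α (1, x) = g (f x))
    (hα : ∀ t, α (t, y₁) = y₁)
    (β : C(I × F₂, F₂)) (hβ0 : ∀ x, β (0, x) = x) (hβ1 : ∀ x, β (1, x) = f (g x))
    (hβ : ∀ t, β (t, y₂) = y₂) :
    IsWeakHomotopyEquiv (NLoop.map f hf) :=
  .of_homotopyInverse _ (NLoop.map g hg)
    (NLoop.family ⟨fun p => α (p.1.1, NLoop.eval p.1.2 p.2), by fun_prop⟩ (fun k => by simp [hα])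
      (fun k => by simp [hα]))
    (fun l => NLoop.ext fun t => hα0 _) (fun l => NLoop.ext fun t => hα1 _)
    (NLoop.family ⟨fun p => β (p.1.1, NLoop.eval p.1.2 p.2), by fun_prop⟩ (fun k => by simp [hβ])
      (fun k => by simp [hβ]))
    (fun l => NLoop.ext fun t => hβ0 _) (fun l => NLoop.ext fun t => hβ1 _)

end Weak

/-! ### Relative labelled configuration spaces as spaces of finite sets -/

namespace RelConfig

variable {M X M' X' T Z D : Type*} [TopologicalSpace M] [TopologicalSpace X] [TopologicalSpace M']
  [TopologicalSpace X'] [TopologicalSpace T] [TopologicalSpace Z] [TopologicalSpace D]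
  {N : Set M} {x₀ : X} {N' : Set M'} {x₀' : X'}

/-- The labelled points not forgotten in `C⁰(M,N;X)`. -/
def Visible (N : Set M) (x₀ : X) : Set (M × X) := {p | p.1 ∉ N ∧ p.2 ≠ x₀}

/-- The labelled points of a pre-configuration. -/
def trace (a : LabelPre M X) : Set (M × X) := range fun j => (a.2.1.1 j, a.2.2 j)

theorem labelAt_eq (a : LabelPre M X) (j : Fin a.1) : labelAt x₀ a (a.2.1.1 j) = a.2.2 j := by
  have h : ∃ i, a.2.1.1 i = a.2.1.1 j := ⟨j, rfl⟩
  rw [labelAt, dif_pos h, a.2.1.2 h.choose_spec]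

theorem mem_trace_iff {a : LabelPre M X} {p : M × X} (hp : p.2 ≠ x₀) :
    p ∈ trace a ↔ labelAt x₀ a p.1 = p.2 := by
  constructor
  · rintro ⟨j, rfl⟩
    exact labelAt_eq a j
  · intro h
    by_cases h' : ∃ i, a.2.1.1 i = p.1
    · obtain ⟨i, hi⟩ := h'
      rw [← hi, labelAt_eq] at h
      exact ⟨i, Prod.ext hi h⟩
    · rw [labelAt, dif_neg h'] at h
      exact (hp h.symm).elim

theorem trace_inter_of_rel {a b : LabelPre M X} (h : LabelRel M X x₀ a b) :
    trace a ∩ Visible N x₀ = trace b ∩ Visible N x₀ := by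
  induction h with
  | perm c l e =>
    congr 1
    exact (e.surjective.range_comp fun j => (c.1 j, l j)).symm
  | delete c l i h =>
    ext p
    refine and_congr_left fun hp => ⟨?_, ?_⟩
    · rintro ⟨j, rfl⟩
      obtain rfl | ⟨j, rfl⟩ := i.eq_self_or_eq_succAbove j
      · exact (hp.2 h).elim
      · exact ⟨j, rfl⟩
    · rintro ⟨j, rfl⟩
      exact ⟨i.succAbove j, rfl⟩

/-- The visible labelled points of a relative configuration. -/
def vis : RelConfig M N X x₀ → Set (M × X) :=
  Quot.lift (Quot.lift (fun a => trace a ∩ Visible N x₀) fun _ _ => trace_inter_of_rel) (by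
    rintro _ _ ⟨a, b, rfl, rfl, h⟩
    ext p
    refine and_congr_left fun hp => ?_
    rw [mem_trace_iff hp.2, mem_trace_iff hp.2, h _ hp.1])

/-- The relative configuration represented by a pre-configuration. -/
def mk (N : Set M) (x₀ : X) (a : LabelPre M X) : RelConfig M N X x₀ := Quot.mk _ (Quot.mk _ a)

theorem isQuotientMap_mk : Topology.IsQuotientMap (mk (X := X) N x₀) :=
  Topology.IsQuotientMap.comp isQuotientMap_quot_mk isQuotientMap_quot_mk

theorem vis_mk (a : LabelPre M X) : (mk N x₀ a).vis = trace a ∩ Visible N x₀ := rfl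

theorem vis_injective : Function.Injective (vis : RelConfig M N X x₀ → Set (M × X)) := by
  intro c d h
  obtain ⟨a, rfl⟩ := isQuotientMap_mk.surjective c
  obtain ⟨b, rfl⟩ := isQuotientMap_mk.surjective d
  refine Quot.sound ⟨a, b, rfl, rfl, fun m hm => ?_⟩
  have key : ∀ {a b : LabelPre M X}, (mk N x₀ a).vis ⊆ (mk N x₀ b).vis →
      labelAt x₀ a m ≠ x₀ → labelAt x₀ b m = labelAt x₀ a m := by
    intro a b h ha
    have : (m, labelAt x₀ a m) ∈ (mk N x₀ a).vis := ⟨(mem_trace_iff ha).2 rfl, hm, ha⟩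
    exact (mem_trace_iff ha).1 (h this).1
  by_cases ha : labelAt x₀ a m = x₀
  · by_contra hb
    exact hb (key h.ge fun h' => hb (ha.trans h'.symm))
  · exact (key h.le ha).symm

theorem vis_subset (c : RelConfig M N X x₀) : c.vis ⊆ Visible N x₀ := by
  obtain ⟨a, rfl⟩ := isQuotientMap_mk.surjective c
  exact inter_subset_right

theorem finite_vis (c : RelConfig M N X x₀) : c.vis.Finite := by
  obtain ⟨a, rfl⟩ := isQuotientMap_mk.surjective c
  exact (finite_range _).inter_of_left _

theorem injOn_vis (c : RelConfig M N X x₀) : InjOn Prod.fst c.vis := by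
  obtain ⟨a, rfl⟩ := isQuotientMap_mk.surjective c
  rintro _ ⟨⟨i, rfl⟩, -⟩ _ ⟨⟨j, rfl⟩, -⟩ h
  rw [a.2.1.2 h]

theorem vis_base : (RelConfig.base M N X x₀).vis = ∅ :=
  eq_empty_of_forall_notMem fun _ h => h.1.choose.elim0

/-- The pre-configuration given by a finite family of labelled points. -/
def ofFamily {ι : Type*} {k : ℕ} (e : ι ≃ Fin k)
    (z : {z : ι → M × X // Function.Injective fun j => (z j).1}) : LabelPre M X :=
  ⟨k, ⟨⟨fun j => (z.1 (e.symm j)).1, z.2.comp e.symm.injective⟩, fun j => (z.1 (e.symm j)).2⟩⟩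

theorem continuous_ofFamily {ι : Type*} {k : ℕ} (e : ι ≃ Fin k) :
    Continuous (ofFamily (M := M) (X := X) e) := by
  have h : Continuous (fun q : OrdConfig M k × (Fin k → X) => (⟨k, q⟩ : LabelPre M X)) :=
    @continuous_sigmaMk ℕ (fun k => OrdConfig M k × (Fin k → X)) _ k
  exact h.comp (Continuous.prodMk (Continuous.subtype_mk (continuous_pi fun j =>
    continuous_fst.comp ((continuous_apply _).comp continuous_subtype_val)) _)
    (continuous_pi fun j => continuous_snd.comp ((continuous_apply _).comp continuous_subtype_val)))

theorem vis_mk_ofFamily {ι : Type*} {k : ℕ} (e : ι ≃ Fin k)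
    (z : {z : ι → M × X // Function.Injective fun j => (z j).1}) :
    (mk N x₀ (ofFamily e z)).vis = range z.1 ∩ Visible N x₀ := by
  rw [vis_mk]
  congr 1
  exact e.symm.surjective.range_comp z.1

open Classical in
/-- The relative configuration with a given set of visible points. -/
def ofSet (N : Set M) (x₀ : X) (S : Set (M × X)) : RelConfig M N X x₀ :=
  if h : ∃ c : RelConfig M N X x₀, c.vis = S then h.choose else base M N X x₀

theorem vis_ofSet {S : Set (M × X)} (hf : S.Finite) (hi : InjOn Prod.fst S)
    (hS : S ⊆ Visible N x₀) : (ofSet N x₀ S).vis = S := by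
  have : ∃ c : RelConfig M N X x₀, c.vis = S := by
    have := hf.to_subtype
    exact ⟨mk N x₀ (ofFamily (Finite.equivFin S) ⟨fun z => z, fun a b h =>
      Subtype.ext (hi a.2 b.2 h)⟩), by rw [vis_mk_ofFamily, Subtype.range_coe, inter_eq_left.2 hS]⟩
  rw [ofSet, dif_pos this]
  exact this.choose_spec

/-- A family of relative configurations is continuous where its visible points are among finitely
many points moving continuously without collisions. -/
theorem continuousAt_of_track [T2Space M] {f : T → RelConfig M N X x₀} {t₀ : T} {ι : Type*}
    [Finite ι] (z₀ : ι → M × X) (hz₀ : Function.Injective fun j => (z₀ j).1)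
    (h₀ : (f t₀).vis = range z₀ ∩ Visible N x₀)
    (h : ∀ U : ι → Set (M × X), (∀ j, U j ∈ 𝓝 (z₀ j)) → ∀ᶠ t in 𝓝 t₀, ∃ z : ι → M × X,
      (∀ j, z j ∈ U j) ∧ (f t).vis = range z ∩ Visible N x₀) : ContinuousAt f t₀ := by
  intro O hO
  obtain ⟨O', hO', hOo, hmO⟩ := mem_nhds_iff.1 hO
  have e := Finite.equivFin ι
  obtain ⟨V, hV, hVd⟩ := (finite_range fun j => (z₀ j).1).t2_separation
  have hS := hOo.preimage (isQuotientMap_mk.continuous.comp (continuous_ofFamily (X := X) e))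
  have := hS.mem_nhds (x := ⟨z₀, hz₀⟩) (by
    change mk N x₀ (ofFamily e ⟨z₀, hz₀⟩) ∈ O'
    convert hmO
    exact vis_injective (by rw [h₀, vis_mk_ofFamily]))
  obtain ⟨W, hW, hWS⟩ := (mem_nhds_induced _ _ _).1 this
  rw [nhds_pi, Filter.mem_pi'] at hW
  obtain ⟨J, U, hU, hUW⟩ := hW
  rw [Filter.mem_map]
  filter_upwards [h (fun j => U j ∩ Prod.fst ⁻¹' V (z₀ j).1) fun j => Filter.inter_mem (hU j)
    (((hV _).2.preimage continuous_fst).mem_nhds (hV _).1)] with t ⟨z, hzU, hz⟩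
  have hinj : Function.Injective fun j => (z j).1 := by
    intro i j hij
    by_contra hne
    refine Set.disjoint_left.1 (hVd ⟨i, rfl⟩ ⟨j, rfl⟩ fun h => hne (hz₀ h)) (hzU i).2 ?_
    have h1 : (z j).1 ∈ V (z₀ j).1 := (hzU j).2
    rwa [← show (z i).1 = (z j).1 from hij] at h1
  apply hO'
  have h1 : mk N x₀ (ofFamily e ⟨z, hinj⟩) ∈ O' := hWS (hUW fun j _ => (hzU j).1)
  convert h1
  exact vis_injective (by rw [hz, vis_mk_ofFamily])

/-- The map `E` is suitable for pushing relative configurations: away from the collapsed set,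
points do not collide. -/
structure Pushing (N : Set M) (N' : Set M') (E : C(T × M, M')) : Prop where
  maps : ∀ t, ∀ m ∈ N, E (t, m) ∈ N'
  inj : ∀ t, ∃ G : Set M, InjOn (fun m => E (t, m)) G ∧ ∀ m ∉ G, ∀ᶠ q in 𝓝 (t, m), E q ∈ N'

/-- Push the points of a relative configuration along `E` and the labels along `Λ`. -/
def push (N' : Set M') (x₀' : X') (E : C(T × M, M')) (Λ : C(T × X, X'))
    (p : T × RelConfig M N X x₀) : RelConfig M' N' X' x₀' :=
  ofSet N' x₀' ((fun z => (E (p.1, z.1), Λ (p.1, z.2))) '' p.2.vis ∩ Visible N' x₀')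

theorem vis_push {E : C(T × M, M')} (hE : Pushing N N' E) (Λ : C(T × X, X'))
    (p : T × RelConfig M N X x₀) : (push N' x₀' E Λ p).vis =
      (fun z => (E (p.1, z.1), Λ (p.1, z.2))) '' p.2.vis ∩ Visible N' x₀' := by
  refine vis_ofSet ((p.2.finite_vis.image _).inter_of_left _) ?_ inter_subset_right
  rintro _ ⟨⟨a, ha, rfl⟩, ha'⟩ _ ⟨⟨b, hb, rfl⟩, hb'⟩ h
  obtain ⟨G, hG, hG'⟩ := hE.inj p.1
  have key : ∀ m, E (p.1, m) ∉ N' → m ∈ G := fun m hm => by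
    by_contra h
    exact hm (hG' m h).self_of_nhds
  rw [p.2.injOn_vis ha hb (hG (key _ ha'.1) (key _ hb'.1) h)]

theorem vis_push_mk {E : C(T × M, M')} (hE : Pushing N N' E) {Λ : C(T × X, X')}
    (hΛ : ∀ t, Λ (t, x₀) = x₀') (t : T) (a : LabelPre M X) :
    (push N' x₀' E Λ (t, mk N x₀ a)).vis =
      (range fun j => (E (t, a.2.1.1 j), Λ (t, a.2.2 j))) ∩ Visible N' x₀' := by
  rw [vis_push hE, vis_mk]
  ext z
  refine and_congr_left fun hz => ⟨?_, ?_⟩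
  · rintro ⟨_, ⟨⟨j, rfl⟩, -⟩, rfl⟩
    exact ⟨j, rfl⟩
  · rintro ⟨j, rfl⟩
    refine ⟨_, ⟨⟨j, rfl⟩, fun h => hz.1 (hE.maps t _ h), fun h => hz.2 ?_⟩, rfl⟩
    exact (congrArg (fun x => Λ (t, x)) h).trans (hΛ t)

theorem continuous_push [T2Space M'] [LocallyCompactSpace T] {E : C(T × M, M')}
    (hE : Pushing N N' E) {Λ : C(T × X, X')} (hΛ : ∀ t, Λ (t, x₀) = x₀') :
    Continuous (push (N := N) (x₀ := x₀) N' x₀' E Λ) := by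
  refine isQuotientMap_mk.continuous_lift_prod_right (continuous_iff_continuousAt.2 ?_)
  rintro ⟨t₀, k, q₀⟩
  have hopen := Topology.IsOpenEmbedding.id (X := T) |>.prodMap
    (@Topology.IsOpenEmbedding.sigmaMk ℕ (fun k => OrdConfig M k × (Fin k → X)) _ k)
  refine (hopen.continuousAt_iff (x := (t₀, q₀))).1 ?_
  obtain ⟨G, hG, hG'⟩ := hE.inj t₀
  have hEc : ∀ j, Continuous fun p : T × (OrdConfig M k × (Fin k → X)) =>
      ((p.1, p.2.1.1 j) : T × M) := fun j => continuous_fst.prodMk ((continuous_apply j).comp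
        (continuous_subtype_val.comp (continuous_fst.comp continuous_snd)))
  have key : ∀ᶠ p in 𝓝 (t₀, q₀), ∀ j : Fin k, q₀.1.1 j ∉ G → E (p.1, p.2.1.1 j) ∈ N' := by
    refine Filter.eventually_all.2 fun j => ?_
    by_cases hj : q₀.1.1 j ∈ G
    · exact Filter.Eventually.of_forall fun _ h => (h hj).elim
    · filter_upwards [(hEc j).continuousAt.eventually (hG' _ hj)] with p hp _
      exact hp
  have hvis : ∀ p : T × (OrdConfig M k × (Fin k → X)),
      (∀ j : Fin k, q₀.1.1 j ∉ G → E (p.1, p.2.1.1 j) ∈ N') →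
      (push N' x₀' E Λ (p.1, mk N x₀ ⟨k, p.2⟩)).vis =
        (range fun j : {j : Fin k // q₀.1.1 j ∈ G} => (E (p.1, p.2.1.1 j), Λ (p.1, p.2.2 j))) ∩
          Visible N' x₀' := by
    intro p hp
    refine (vis_push_mk hE hΛ p.1 ⟨k, p.2⟩).trans ?_
    ext z
    refine and_congr_left fun hz => ⟨?_, ?_⟩
    · rintro ⟨j, rfl⟩
      by_cases hj : q₀.1.1 j ∈ G
      · exact ⟨⟨j, hj⟩, rfl⟩
      · exact (hz.1 (hp j hj)).elim
    · rintro ⟨j, rfl⟩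
      exact ⟨j, rfl⟩
  refine continuousAt_of_track
    (fun j : {j : Fin k // q₀.1.1 j ∈ G} => (E (t₀, q₀.1.1 j), Λ (t₀, q₀.2 j))) ?_
    (hvis (t₀, q₀) key.self_of_nhds) fun U hU => ?_
  · intro i j hij
    exact Subtype.ext (q₀.1.2 (hG i.2 j.2 hij))
  · have hc : ∀ j : {j : Fin k // q₀.1.1 j ∈ G}, ∀ᶠ p in 𝓝 (t₀, q₀),
        (E (p.1, p.2.1.1 j), Λ (p.1, p.2.2 j)) ∈ U j := fun j =>
      (Continuous.prodMk (E.continuous.comp (hEc j)) (Λ.continuous.comp (by fun_prop))).continuousAt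
        |>.eventually (hU j)
    filter_upwards [key, Filter.eventually_all.2 hc] with p h1 h2
    exact ⟨_, h2, hvis p h1⟩

end RelConfig

/-! ### Comparing the two models of configurations -/

section Comparison

variable {M X Z D T : Type*} [TopologicalSpace M] [TopologicalSpace X]
  [TopologicalSpace T] [TopologicalSpace Z] [TopologicalSpace D]
  {N : Set M} {x₀ : X} {pos : Z → D} {w : Z → ℝ}

namespace Conf

/-- The map `F` realizes the points of `Z` as labelled points of `M`: points of small weight become
invisible, and points do not collide away from the collapsed set. -/
structure Realizing (pos : Z → D) (w : Z → ℝ) (N : Set M) (x₀ : X) (F : C(Z, M × X)) : Prop where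
  large : ∃ δ > 0, ∀ z, F z ∈ RelConfig.Visible N x₀ → δ ≤ w z
  inj : ∃ G : Set Z, (∀ z ∈ G, ∀ z' ∈ G, (F z).1 = (F z').1 → pos z = pos z') ∧
    ∀ z ∉ G, ∀ᶠ z' in 𝓝 z, F z' ∉ RelConfig.Visible N x₀

/-- The relative labelled configuration realizing a configuration. -/
def toRel (N : Set M) (x₀ : X) (F : C(Z, M × X)) (c : Conf pos w) : RelConfig M N X x₀ :=
  RelConfig.ofSet N x₀ (F '' c.pts ∩ RelConfig.Visible N x₀)

theorem vis_toRel {F : C(Z, M × X)} (hF : Realizing pos w N x₀ F) (c : Conf pos w) :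
    (toRel N x₀ F c).vis = F '' c.pts ∩ RelConfig.Visible N x₀ := by
  refine RelConfig.vis_ofSet ((c.fin.image _).inter_of_left _) ?_ inter_subset_right
  rintro _ ⟨⟨a, ha, rfl⟩, ha'⟩ _ ⟨⟨b, hb, rfl⟩, hb'⟩ h
  obtain ⟨G, hG, hG'⟩ := hF.inj
  have key : ∀ z, F z ∈ RelConfig.Visible N x₀ → z ∈ G := fun z hz => by
    by_contra h
    exact (hG' z h).self_of_nhds hz
  rw [c.inj ha hb (hG _ (key _ ha') _ (key _ hb') h)]

theorem continuous_toRel [T2Space D] [T2Space M] (hpos : Continuous pos) (hw : Continuous w)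
    {F : C(Z, M × X)} (hF : Realizing pos w N x₀ F) :
    Continuous (toRel (pos := pos) (w := w) N x₀ F) := by
  refine continuous_iff_continuousAt.2 fun c₀ => ?_
  obtain ⟨δ₀, hδ₀, hl⟩ := hF.large
  obtain ⟨G, hG, hG'⟩ := hF.inj
  obtain ⟨δ, hδ, hδ0, hδn⟩ := exists_small_ne (c₀.fin.image w) hδ₀
  let S : Set Z := c₀.pts ∩ {z | δ ≤ w z}
  have hS : S.Finite := c₀.fin.inter_of_left _
  have : Finite {z : S // (z : Z) ∈ G} := by
    have := hS.to_subtype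
    infer_instance
  have hvis : ∀ (c : Conf pos w) (g : Z → Z), c.pts ∩ {z | δ ≤ w z} = g '' S →
      (∀ z ∈ S, z ∉ G → F (g z) ∉ RelConfig.Visible N x₀) → (toRel N x₀ F c).vis =
      (range fun z : {z : S // (z : Z) ∈ G} => F (g z)) ∩ RelConfig.Visible N x₀ := by
    intro c g hg hgG
    rw [vis_toRel hF]
    ext x
    refine and_congr_left fun hx => ⟨?_, ?_⟩
    · rintro ⟨y, hy, rfl⟩
      have : y ∈ g '' S := hg ▸ ⟨hy, hδ0.le.trans (hl y hx)⟩
      obtain ⟨z, hz, rfl⟩ := this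
      by_cases hzG : z ∈ G
      · exact ⟨⟨⟨z, hz⟩, hzG⟩, rfl⟩
      · exact (hgG z hz hzG hx).elim
    · rintro ⟨z, rfl⟩
      have : g z ∈ c.pts ∩ {z | δ ≤ w z} := hg ▸ mem_image_of_mem g z.1.2
      exact ⟨_, this.1, rfl⟩
  refine RelConfig.continuousAt_of_track (fun z : {z : S // (z : Z) ∈ G} => F z) ?_
    (hvis c₀ id (image_id S).symm fun z _ h => (hG' z h).self_of_nhds) fun U hU => ?_
  · intro a b h
    exact Subtype.ext (Subtype.ext (c₀.inj a.1.2.1 b.1.2.1 (hG _ a.2 _ b.2 h)))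
  · have hN : ∀ z : Z, ∃ B ∈ 𝓝 z, (∀ (h : z ∈ S) (h' : z ∈ G), ∀ x ∈ B, F x ∈ U ⟨⟨z, h⟩, h'⟩) ∧
        (z ∉ G → ∀ x ∈ B, F x ∉ RelConfig.Visible N x₀) := by
      intro z
      by_cases hz : z ∈ G
      · by_cases hzS : z ∈ S
        · exact ⟨_, F.continuous.continuousAt.eventually (hU ⟨⟨z, hzS⟩, hz⟩), fun _ _ _ hx => hx,
            fun h => (h hz).elim⟩
        · exact ⟨univ, Filter.univ_mem, fun h => (hzS h).elim, fun h => (h hz).elim⟩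
      · exact ⟨_, hG' z hz, fun _ h => (hz h).elim, fun _ _ hx => hx⟩
    choose B hB hBU hBV using hN
    filter_upwards [eventually_track hpos hw c₀ hδ (fun z hz h => hδn ⟨z, hz, h⟩) B
      fun z _ => hB z] with c ⟨g, hg, hgB⟩
    exact ⟨fun z => F (g z), fun z => hBU z.1 z.1.2 z.2 _ (hgB z.1 z.1.2),
      hvis c g hg fun z hz hzG => hBV z hzG _ (hgB z hz)⟩

/-- A homotopy moving the points of configurations and decreasing their weights. -/
structure Moving (pos : Z → D) (w : Z → ℝ) (H : C(I × Z, Z)) : Prop where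
  le : ∀ τ z, w (H (τ, z)) ≤ w z
  inj : ∀ τ z z', 0 < w (H (τ, z)) → 0 < w (H (τ, z')) → pos (H (τ, z)) = pos (H (τ, z')) →
    pos z = pos z'

/-- Move the points of a configuration along `H`. -/
def move (H : C(I × Z, Z)) (p : I × Conf pos w) : Conf pos w :=
  ofSet pos w ((fun z => H (p.1, z)) '' p.2.pts ∩ {z | 0 < w z})

theorem move_pts {H : C(I × Z, Z)} (hH : Moving pos w H) (p : I × Conf pos w) :
    (move H p).pts = (fun z => H (p.1, z)) '' p.2.pts ∩ {z | 0 < w z} := by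
  rw [move, ofSet_pts ((p.2.fin.image _).inter_of_left _)]
  · exact inter_eq_left.2 inter_subset_right
  · rintro _ ⟨⟨a, ha, rfl⟩, ha'⟩ _ ⟨⟨b, hb, rfl⟩, hb'⟩ h
    rw [p.2.inj ha hb (hH.inj _ _ _ ha' hb' h)]

theorem continuous_move [T2Space D] (hpos : Continuous pos) (hw : Continuous w) {H : C(I × Z, Z)}
    (hH : Moving pos w H) : Continuous (move (pos := pos) (w := w) H) := by
  refine continuous_iff_continuousAt.2 fun p => ?_
  refine continuousAt_push (u := Prod.snd) (ψ := fun t z => H (t.1, z))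
    (v := fun t z => w (H (t.1, z))) hpos hw continuousAt_snd ?_ (fun _ _ _ _ => rfl) ?_ ?_ ?_ ?_
  · intro t
    rw [move_pts hH]
    ext z
    constructor
    · rintro ⟨⟨x, hx, rfl⟩, h⟩
      exact ⟨x, ⟨hx, h⟩, rfl⟩
    · rintro ⟨x, ⟨hx, h⟩, rfl⟩
      exact ⟨⟨x, hx, rfl⟩, h⟩
  · rintro a ⟨ha, ha'⟩ b ⟨hb, hb'⟩ h
    exact p.2.inj ha hb (hH.inj _ _ _ ha' hb' (congrArg pos h))
  · intro z _ _
    fun_prop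
  · intro z _
    fun_prop
  · exact fun δ hδ => ⟨δ, hδ, Filter.Eventually.of_forall fun t z h => h.trans (hH.le _ _)⟩

end Conf

namespace RelConfig

/-- The map `F` turns labelled points into points of `Z`, visible points being those of positive
weight. -/
structure Charting (pos : Z → D) (w : Z → ℝ) (N : Set M) (x₀ : X) (F : C(M × X, Z)) : Prop where
  vis_iff : ∀ p, p ∈ Visible N x₀ ↔ 0 < w (F p)
  inj : ∀ p q, pos (F p) = pos (F q) → p.1 = q.1

/-- The configuration associated with a relative labelled configuration. -/
def toConf (pos : Z → D) (w : Z → ℝ) (F : C(M × X, Z)) (c : RelConfig M N X x₀) : Conf pos w :=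
  Conf.ofSet pos w (F '' c.vis)

theorem toConf_pts {F : C(M × X, Z)} (hF : Charting pos w N x₀ F) (c : RelConfig M N X x₀) :
    (toConf pos w F c).pts = F '' c.vis := by
  rw [toConf, Conf.ofSet_pts (c.finite_vis.image _)]
  · refine inter_eq_left.2 ?_
    rintro _ ⟨p, hp, rfl⟩
    exact (hF.vis_iff p).1 (c.vis_subset hp)
  · rintro _ ⟨a, ha, rfl⟩ _ ⟨b, hb, rfl⟩ h
    rw [c.injOn_vis ha hb (hF.inj _ _ h)]

theorem continuous_toConf (hw : Continuous w) {F : C(M × X, Z)} (hF : Charting pos w N x₀ F) :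
    Continuous (toConf (N := N) (x₀ := x₀) pos w F) := by
  classical
  refine isQuotientMap_mk.continuous_iff.2 (continuous_iff_continuousAt.2 ?_)
  rintro ⟨k, q₀⟩
  refine ((@Topology.IsOpenEmbedding.sigmaMk ℕ (fun k => OrdConfig M k × (Fin k → X)) _
    k).continuousAt_iff (x := q₀)).1 ?_
  let z : Fin k → OrdConfig M k × (Fin k → X) → Z := fun j q => F (q.1.1 j, q.2 j)
  have hz : ∀ j, Continuous (z j) := fun j => F.continuous.comp (Continuous.prodMk
    ((continuous_apply j).comp (continuous_subtype_val.comp continuous_fst)) (by fun_prop))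
  have hpts : ∀ q : OrdConfig M k × (Fin k → X), (toConf pos w F (mk N x₀ ⟨k, q⟩)).pts =
      {x | ∃ j, z j q = x ∧ 0 < w x} := by
    intro q
    rw [toConf_pts hF]
    ext x
    constructor
    · rintro ⟨_, ⟨⟨j, rfl⟩, h⟩, rfl⟩
      exact ⟨j, rfl, (hF.vis_iff _).1 h⟩
    · rintro ⟨j, rfl, h⟩
      exact ⟨_, ⟨⟨j, rfl⟩, (hF.vis_iff _).2 h⟩, rfl⟩
  have hzinj : ∀ i j, z i q₀ = z j q₀ → i = j := fun i j h =>
    q₀.1.2 (hF.inj _ _ (congrArg pos h))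
  refine Conf.continuousAt_of_track fun δ₀ hδ₀ => ?_
  obtain ⟨δ, hδ, hδ0, hδn⟩ := Conf.exists_small_ne (finite_range fun j => w (z j q₀)) hδ₀
  refine ⟨δ, hδ, hδ0, fun V hV => ?_⟩
  have e : ∀ᶠ q in 𝓝 q₀, ∀ j, (δ ≤ w (z j q) ↔ δ ≤ w (z j q₀)) ∧
      (δ ≤ w (z j q₀) → z j q ∈ V (z j q₀)) := by
    refine Filter.eventually_all.2 fun j => ?_
    have hwz := (hw.comp (hz j)).continuousAt (x := q₀)
    rcases lt_or_gt_of_ne (fun h => hδn ⟨j, h⟩ : w (z j q₀) ≠ δ) with h | h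
    · filter_upwards [hwz.eventually (gt_mem_nhds h)] with q hq
      exact ⟨⟨fun h' => absurd hq (not_lt.2 h'), fun h' => absurd h (not_lt.2 h')⟩,
        fun h' => absurd h (not_lt.2 h')⟩
    · have hj : z j q₀ ∈ (toConf pos w F (mk N x₀ ⟨k, q₀⟩)).pts := by
        rw [hpts]
        exact ⟨j, rfl, hδ.trans h⟩
      filter_upwards [hwz.eventually (lt_mem_nhds h),
        (hz j).continuousAt.eventually (hV _ hj)] with q hq hq'
      exact ⟨⟨fun _ => h.le, fun _ => le_of_lt hq⟩, fun _ => hq'⟩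
  filter_upwards [e] with q hq
  have key : ∀ q, (toConf pos w F (mk N x₀ ⟨k, q⟩)).pts ∩ {x | δ ≤ w x} =
      {x | ∃ j, z j q = x ∧ δ ≤ w x} := by
    intro q
    rw [hpts]
    ext x
    constructor
    · rintro ⟨⟨j, hj, -⟩, h⟩
      exact ⟨j, hj, h⟩
    · rintro ⟨j, hj, h⟩
      exact ⟨⟨j, hj, hδ.trans_le h⟩, h⟩
  let g : Z → Z := fun x => if h : ∃ j, z j q₀ = x then z h.choose q else x
  have hg : ∀ j, g (z j q₀) = z j q := by
    intro j
    have h : ∃ i, z i q₀ = z j q₀ := ⟨j, rfl⟩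
    simp only [g]
    rw [dif_pos h, hzinj _ _ h.choose_spec]
  refine ⟨g, ?_, ?_⟩
  · refine (key q).trans (Eq.trans ?_ (congrArg (image g) (key q₀).symm))
    ext x
    constructor
    · rintro ⟨j, rfl, h⟩
      exact ⟨_, ⟨j, rfl, (hq j).1.1 h⟩, hg j⟩
    · rintro ⟨_, ⟨j, rfl, h⟩, rfl⟩
      rw [hg]
      exact ⟨j, rfl, (hq j).1.2 h⟩
  · intro x hx
    obtain ⟨j, rfl, h⟩ := (key q₀).le hx
    rw [hg]
    exact (hq j).2 h

end RelConfig

end Comparison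

/-! ### Attaching a whisker at the base point -/

/-- The space `X` with a whisker attached at `x₀`. -/
def Whisker {X : Type*} (x₀ : X) : Type _ := {p : X × I // p.2 = 0 ∨ p.1 = x₀}

namespace Whisker

variable {X : Type*} [TopologicalSpace X] {x₀ : X}

instance : TopologicalSpace (Whisker x₀) :=
  inferInstanceAs (TopologicalSpace {p : X × I // p.2 = 0 ∨ p.1 = x₀})

theorem continuous_val : Continuous fun p : Whisker x₀ => p.1 := continuous_subtype_val

/-- The end of the whisker. -/
def tip (x₀ : X) : Whisker x₀ := ⟨(x₀, 1), Or.inr rfl⟩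

/-- The distance to the end of the whisker. -/
def weight (p : Whisker x₀) : ℝ := 1 - p.1.2

theorem continuous_weight : Continuous (weight : Whisker x₀ → ℝ) :=
  continuous_const.sub (continuous_subtype_val.comp (continuous_snd.comp continuous_val))

theorem weight_pos_iff {p : Whisker x₀} : 0 < p.weight ↔ p ≠ tip x₀ := by
  rw [← not_iff_not, not_not, weight, sub_pos, not_lt]
  constructor
  · intro h
    have h1 : p.1.2 = 1 := le_antisymm p.1.2.2.2 h
    refine Subtype.ext (Prod.ext (p.2.resolve_left fun h0 => ?_) h1)
    exact zero_ne_one (h0.symm.trans h1)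
  · rintro rfl
    exact le_rfl

/-- The deformation of the whisker absorbing a neighbourhood of its end. -/
def absorb (x₀ : X) : C(I × Whisker x₀, Whisker x₀) where
  toFun p := ⟨(p.2.1.1, projIcc 0 1 zero_le_one ((1 + p.1) * p.2.1.2)), p.2.2.imp (fun h => by
    simp only [h, Set.Icc.coe_zero, mul_zero]
    exact projIcc_left _) id⟩
  continuous_toFun := by
    have h : Continuous fun p : I × Whisker x₀ => p.2.1 := continuous_val.comp continuous_snd
    exact Continuous.subtype_mk (Continuous.prodMk (by fun_prop)
      (continuous_projIcc.comp (by fun_prop))) _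

theorem absorb_zero (p : Whisker x₀) : absorb x₀ (0, p) = p := by
  refine Subtype.ext (Prod.ext rfl ?_)
  change projIcc 0 1 zero_le_one ((1 + ((0 : I) : ℝ)) * p.1.2) = p.1.2
  rw [Set.Icc.coe_zero, add_zero, one_mul, projIcc_val]

theorem weight_absorb (τ : I) (p : Whisker x₀) :
    (absorb x₀ (τ, p)).weight = max 0 (1 - (1 + (τ : ℝ)) * (p.1.2 : ℝ)) := by
  change 1 - (projIcc (0 : ℝ) 1 zero_le_one ((1 + (τ : ℝ)) * p.1.2) : ℝ) = _
  have h : 0 ≤ (1 + (τ : ℝ)) * p.1.2 := mul_nonneg (by linarith [τ.2.1]) p.1.2.2.1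
  rw [coe_projIcc, max_eq_right (le_min zero_le_one h), ← max_sub_sub_left, sub_self]

theorem weight_absorb_le (τ : I) (p : Whisker x₀) : (absorb x₀ (τ, p)).weight ≤ p.weight := by
  rw [weight_absorb, weight]
  exact max_le (by linarith [p.1.2.2.2]) (by nlinarith [mul_nonneg τ.2.1 p.1.2.2.1])

theorem le_weight_of_absorb {p : Whisker x₀} (h : 0 < (absorb x₀ (1, p)).weight) :
    1 / 2 ≤ p.weight := by
  rw [weight_absorb, lt_max_iff, Set.Icc.coe_one] at h
  rw [weight]
  rcases h with h | h <;> linarith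

theorem absorb_tip (τ : I) : absorb x₀ (τ, tip x₀) = tip x₀ := by
  by_contra h
  have := weight_absorb_le τ (tip x₀)
  have h1 : (tip x₀).weight = 0 := by simp [weight, tip]
  linarith [weight_pos_iff.2 h]

/-- The projection collapsing the whisker. -/
def collapse (x₀ : X) : C(Whisker x₀, X) := ⟨fun p => p.1.1, continuous_fst.comp continuous_val⟩

theorem exists_homotopy (h : IsWellPointed X x₀) : ∃ (j : C(X, Whisker x₀)) (G : C(I × X, X))
    (K : C(I × Whisker x₀, Whisker x₀)), j x₀ = tip x₀ ∧
      (∀ x, G (0, x) = x) ∧ (∀ x, G (1, x) = collapse x₀ (j x)) ∧ (∀ t, G (t, x₀) = x₀) ∧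
      (∀ p, K (0, p) = p) ∧ (∀ p, K (1, p) = j (collapse x₀ p)) ∧
      ∀ t, K (t, tip x₀) = tip x₀ := by
  let e : C(X, Whisker x₀) :=
    ⟨fun x => ⟨(x, 0), Or.inl rfl⟩,
      Continuous.subtype_mk (continuous_id.prodMk continuous_const) fun _ => Or.inl rfl⟩
  let l : C(I, Whisker x₀) :=
    ⟨fun t => ⟨(x₀, t), Or.inr rfl⟩,
      Continuous.subtype_mk (continuous_const.prodMk continuous_id) fun _ => Or.inr rfl⟩
  obtain ⟨G, hG0, hG⟩ := h (Whisker x₀) inferInstance e l rfl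
  have hG' : ∀ t, G (t, x₀) = ⟨(x₀, t), Or.inr rfl⟩ := hG
  have hval : Continuous fun q : I × Whisker x₀ => (G (q.1, collapse x₀ q.2)).1 :=
    continuous_val.comp <| G.continuous.comp <|
      continuous_fst.prodMk ((collapse x₀).continuous.comp continuous_snd)
  have hval' : Continuous fun q : I × Whisker x₀ => q.2.1 := continuous_val.comp continuous_snd
  have hmem : ∀ q : I × Whisker x₀, max (G (q.1, collapse x₀ q.2)).1.2 q.2.1.2 = 0 ∨
      (G (q.1, collapse x₀ q.2)).1.1 = x₀ := fun q => by
    rcases q.2.2 with h2 | h2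
    · rcases (G (q.1, collapse x₀ q.2)).2 with h1 | h1
      · left
        rw [h1, h2, max_self]
      · exact Or.inr h1
    · right
      change (G (q.1, q.2.1.1)).1.1 = x₀
      rw [h2, hG']
  let K : C(I × Whisker x₀, Whisker x₀) :=
    ⟨fun q => ⟨((G (q.1, collapse x₀ q.2)).1.1, max (G (q.1, collapse x₀ q.2)).1.2 q.2.1.2),
      hmem q⟩, Continuous.subtype_mk (Continuous.prodMk (continuous_fst.comp hval)
        ((continuous_snd.comp hval).max (continuous_snd.comp hval'))) hmem⟩
  refine ⟨⟨fun x => G (1, x), by fun_prop⟩, (collapse x₀).comp G, K, hG' 1,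
    fun x => congrArg (collapse x₀) (hG0 x), fun x => rfl, fun t => congrArg (collapse x₀) (hG' t),
    fun p => ?_, fun p => ?_, fun t => ?_⟩
  · refine Subtype.ext ?_
    change ((G (0, p.1.1)).1.1, max (G (0, p.1.1)).1.2 p.1.2) = p.1
    rw [hG0]
    exact Prod.ext rfl (max_eq_right p.1.2.2.1)
  · refine Subtype.ext ?_
    change ((G (1, p.1.1)).1.1, max (G (1, p.1.1)).1.2 p.1.2) = (G (1, p.1.1)).1
    refine Prod.ext rfl ?_
    rcases p.2 with h | h
    · rw [h]
      exact max_eq_left (G (1, p.1.1)).1.2.2.1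
    · rw [h, hG']
      exact max_eq_left p.1.2.2.2
  · refine Subtype.ext ?_
    change ((G (t, x₀)).1.1, max (G (t, x₀)).1.2 1) = (x₀, 1)
    rw [hG']
    exact Prod.ext rfl (max_eq_right t.2.2)

end Whisker

/-! ### Moving points of the cube -/

namespace NCube

variable {n : ℕ} {i j : Fin n} {k : ℕ}

instance : T2Space (NCube n) := inferInstanceAs (T2Space (Fin n → I))

theorem continuous_coord (j : Fin n) : Continuous fun q : NCube n => q j :=
  continuous_apply (A := fun _ : Fin n => I) j

theorem notMem_partialBoundary {q : NCube n} :
    q ∉ PartialBoundary n k ↔ ∀ j : Fin n, (j : ℕ) < k → (q j : ℝ) ∈ Ioo (0 : ℝ) 1 := by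
  have key : ∀ x : I, (x : ℝ) ∈ Ioo (0 : ℝ) 1 ↔ ¬(x = 0 ∨ x = 1) := fun x => by
    rw [not_or, ← ne_eq, ← ne_eq, ← unitInterval.pos_iff_ne_zero, ← unitInterval.lt_one_iff_ne_one]
    exact Iff.rfl
  simp only [PartialBoundary, mem_ofPred_eq, not_exists, not_and, key]

/-- The point of the cube closest to a vector. -/
def clip (v : Fin n → ℝ) : NCube n := fun j => projIcc 0 1 zero_le_one (v j)

theorem continuous_clip : Continuous (clip : (Fin n → ℝ) → NCube n) :=
  continuous_pi fun j => continuous_projIcc.comp (continuous_apply j)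

theorem coe_clip_of_mem {v : Fin n → ℝ} (h : v j ∈ Icc (0 : ℝ) 1) : (clip v j : ℝ) = v j :=
  congrArg Subtype.val (projIcc_of_mem zero_le_one h)

theorem clip_coe (q : NCube n) : clip (fun j => (q j : ℝ)) = q :=
  funext fun _ => projIcc_val _ _

theorem clip_mem_Ioo {v : Fin n → ℝ} : (clip v j : ℝ) ∈ Ioo (0 : ℝ) 1 ↔ v j ∈ Ioo (0 : ℝ) 1 := by
  rw [clip, coe_projIcc, mem_Ioo, mem_Ioo, lt_max_iff, max_lt_iff, lt_min_iff, min_lt_iff]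
  constructor
  · rintro ⟨h | h, -, h2 | h2⟩
    · exact (lt_irrefl _ h).elim
    · exact (lt_irrefl _ h).elim
    · exact (lt_irrefl _ h2).elim
    · exact ⟨h.2, h2⟩
  · rintro ⟨h1, h2⟩
    exact ⟨Or.inr ⟨one_pos, h1⟩, one_pos, Or.inr h2⟩

theorem clip_notMem {v : Fin n → ℝ} :
    clip v ∉ PartialBoundary n k ↔ ∀ j : Fin n, (j : ℕ) < k → v j ∈ Ioo (0 : ℝ) 1 := by
  simp only [notMem_partialBoundary, clip_mem_Ioo]

theorem eventually_clip_mem {T : Type*} [TopologicalSpace T] {v : T → Fin n → ℝ}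
    (hv : Continuous v) {t : T} (hj : (j : ℕ) < k) (h : v t j ∉ Icc (0 : ℝ) 1) :
    ∀ᶠ t' in 𝓝 t, clip (v t') ∈ PartialBoundary n k := by
  filter_upwards [(((continuous_apply j).comp hv).isOpen_preimage _
    isClosed_Icc.isOpen_compl).mem_nhds h] with t' ht'
  by_contra h'
  exact ht' (Ioo_subset_Icc_self (clip_notMem.1 h' j hj))

theorem clip_injective {v v' : Fin n → ℝ} (hv : ∀ j, v j ∈ Icc (0 : ℝ) 1)
    (hv' : ∀ j, v' j ∈ Icc (0 : ℝ) 1) (h : clip v = clip v') : v = v' := by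
  funext j
  rw [← coe_clip_of_mem (hv j), ← coe_clip_of_mem (hv' j), h]

/-- Expand the first `i` coordinates away from the centre and replace the next one by `u`. -/
def expand (i : Fin n) (τ : ℝ) (q : NCube n) (u : ℝ) : Fin n → ℝ := fun j =>
  if j = i then u else if j < i then 1 / 2 + (1 + τ) * (q j - 1 / 2) else q j

theorem expand_self (i : Fin n) (τ : ℝ) (q : NCube n) (u : ℝ) : expand i τ q u i = u := if_pos rfl

theorem expand_lt (h : j < i) (τ : ℝ) (q : NCube n) (u : ℝ) :
    expand i τ q u j = 1 / 2 + (1 + τ) * (q j - 1 / 2) := by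
  rw [expand, if_neg h.ne, if_pos h]

theorem expand_gt (h : i < j) (τ : ℝ) (q : NCube n) (u : ℝ) : expand i τ q u j = q j := by
  rw [expand, if_neg h.ne', if_neg h.not_gt]

theorem expand_zero (i : Fin n) (q : NCube n) : expand i 0 q (q i) = fun j => (q j : ℝ) := by
  funext j
  rcases lt_trichotomy j i with h | rfl | h
  · rw [expand_lt h]
    ring
  · exact expand_self ..
  · exact expand_gt h ..

theorem continuous_expand {T : Type*} [TopologicalSpace T] (i : Fin n) {τ u : T → ℝ}
    {q : T → NCube n} (hτ : Continuous τ) (hq : Continuous q) (hu : Continuous u) :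
    Continuous fun t => expand i (τ t) (q t) (u t) := by
  refine continuous_pi fun j => ?_
  have hqj : Continuous fun t => (q t j : ℝ) :=
    continuous_subtype_val.comp ((continuous_coord j).comp hq)
  rcases lt_trichotomy j i with h | rfl | h
  · simp only [expand_lt h]
    fun_prop
  · simpa only [expand_self] using hu
  · simpa only [expand_gt h] using hqj

theorem coord_eq_of_expand {τ : ℝ} (hτ : 0 ≤ τ) {q q' : NCube n} {u u' : ℝ} (hj : j ≠ i)
    (h : expand i τ q u j = expand i τ q' u' j) : q j = q' j := by
  refine Subtype.ext ?_
  rcases hj.lt_or_gt with h' | h'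
  · rw [expand_lt h', expand_lt h'] at h
    have : (1 + τ) * ((q j : ℝ) - q' j) = 0 := by linear_combination h
    have := (mul_eq_zero.1 this).resolve_left (by positivity)
    linarith
  · rwa [expand_gt h', expand_gt h'] at h

theorem lt_of_expand_notMem {τ u : ℝ} {q : NCube n} (hi : (i : ℕ) ≤ k)
    (hu : k ≤ i → u ∈ Icc (0 : ℝ) 1) (h : expand i τ q u j ∉ Icc (0 : ℝ) 1) : (j : ℕ) < k := by
  rcases lt_trichotomy j i with h' | rfl | h'
  · exact lt_of_lt_of_le h' hi
  · by_contra hk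
    rw [expand_self] at h
    exact h (hu (not_lt.1 hk))
  · rw [expand_gt h'] at h
    exact (h (q j).2).elim

/-- The image of a point under projection along the `i`-th coordinate. -/
def flatten (i : Fin n) (q : NCube n) : NCube n := fun j => if j = i then 0 else q j

theorem continuous_flatten (i : Fin n) : Continuous (flatten i) := by
  refine continuous_pi fun j => ?_
  by_cases hj : j = i
  · simp only [flatten, if_pos hj]
    exact continuous_const
  · simp only [flatten, if_neg hj]
    exact continuous_coord j

theorem flatten_eq_iff {q q' : NCube n} : flatten i q = flatten i q' ↔ ∀ j ≠ i, q j = q' j := by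
  constructor
  · intro h j hj
    have := congrFun h j
    simpa only [flatten, if_neg hj] using this
  · intro h
    funext j
    by_cases hj : j = i
    · simp only [flatten, if_pos hj]
    · simpa only [flatten, if_neg hj] using h j hj

/-- The depth of a point with respect to the boundary in the coordinates before the `i`-th. -/
def depth (i : Fin n) (q : NCube n) : ℝ := ∏ j ∈ Finset.Iio i, ((q j : ℝ) * (1 - q j))

theorem continuous_depth (i : Fin n) : Continuous (depth i) := by
  refine continuous_finsetProd _ fun j _ => ?_
  have hqj : Continuous fun q : NCube n => (q j : ℝ) :=
    continuous_subtype_val.comp (continuous_coord j)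
  fun_prop

theorem coord_mul_nonneg (q : NCube n) (j : Fin n) : 0 ≤ (q j : ℝ) * (1 - q j) :=
  mul_nonneg (q j).2.1 (sub_nonneg.2 (q j).2.2)

theorem coord_mul_pos_iff {q : NCube n} :
    0 < (q j : ℝ) * (1 - q j) ↔ (q j : ℝ) ∈ Ioo (0 : ℝ) 1 := by
  rw [(q.coord_mul_nonneg j).lt_iff_ne, ne_comm, mul_ne_zero_iff, sub_ne_zero,
    ne_comm (a := (1 : ℝ)), mem_Ioo, (q j).2.1.lt_iff_ne, (q j).2.2.lt_iff_ne,
    ne_comm (a := (0 : ℝ))]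

theorem depth_pos_iff {q : NCube n} :
    0 < depth i q ↔ ∀ j < i, (q j : ℝ) ∈ Ioo (0 : ℝ) 1 := by
  have h0 : 0 ≤ depth i q := Finset.prod_nonneg fun j _ => q.coord_mul_nonneg j
  rw [h0.lt_iff_ne, ne_comm, depth, Finset.prod_ne_zero_iff]
  refine forall_congr' fun j => ?_
  rw [Finset.mem_Iio, ← coord_mul_pos_iff, (q.coord_mul_nonneg j).lt_iff_ne, ne_comm]

theorem depth_pos_iff_notMem {q : NCube n} : 0 < depth i q ↔ q ∉ PartialBoundary n i := by
  rw [depth_pos_iff, notMem_partialBoundary]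
  rfl

theorem depth_clip_expand_le {τ : ℝ} (hτ : 0 ≤ τ) (q : NCube n) (u : ℝ) :
    depth i (clip (expand i τ q u)) ≤ depth i q := by
  refine Finset.prod_le_prod (fun j _ => coord_mul_nonneg _ j) fun j hj => ?_
  by_cases h : expand i τ q u j ∈ Ioo (0 : ℝ) 1
  · rw [coe_clip_of_mem (Ioo_subset_Icc_self h), expand_lt (Finset.mem_Iio.1 hj)]
    nlinarith [mul_nonneg hτ (sq_nonneg ((q j : ℝ) - 1 / 2)),
      mul_nonneg (mul_nonneg hτ hτ) (sq_nonneg ((q j : ℝ) - 1 / 2))]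
  · exact (not_lt.1 fun h1 => h (clip_mem_Ioo.1 (coord_mul_pos_iff.1 h1))).trans
      (q.coord_mul_nonneg j)

theorem exists_le_depth (i : Fin n) : ∃ δ > 0, ∀ (q : NCube n) (u : ℝ),
    (∀ j < i, expand i 1 q u j ∈ Ioo (0 : ℝ) 1) → δ ≤ depth i q := by
  refine ⟨∏ j ∈ Finset.Iio i, (3 / 16 : ℝ), Finset.prod_pos fun _ _ => by norm_num,
    fun q u h => Finset.prod_le_prod (fun _ _ => by norm_num) fun j hj => ?_⟩
  obtain ⟨h1, h2⟩ := h j (Finset.mem_Iio.1 hj)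
  rw [expand_lt (Finset.mem_Iio.1 hj)] at h1 h2
  nlinarith

end NCube

/-! ### Labelled points of the cube -/

section Points

variable {n : ℕ} {X : Type*} [TopologicalSpace X] {x₀ : X} {k : ℕ}

/-- Projection of the labelled points of the cube along the `i`-th coordinate. -/
def labelPos (i : Fin n) (a : NCube n × Whisker x₀) : NCube n := NCube.flatten i a.1

/-- The weight of the labelled points of the cube. -/
def labelWeight (i : Fin n) (a : NCube n × Whisker x₀) : ℝ :=
  min (NCube.depth i a.1) a.2.weight

/-- Expanding the cube and absorbing a part of the whisker. -/
def expandLabel (i : Fin n) {T : Type*} [TopologicalSpace T] (τ : C(T, I)) (u : C(T, ℝ))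
    (a : C(T, NCube n × Whisker x₀)) : C(T, NCube n × Whisker x₀) :=
  ⟨fun t => (NCube.clip (NCube.expand i (τ t) (a t).1 (u t)), Whisker.absorb x₀ (τ t, (a t).2)),
    (NCube.continuous_clip.comp (NCube.continuous_expand i (by fun_prop) (by fun_prop)
      u.continuous)).prodMk (by fun_prop)⟩

variable {i : Fin n}

theorem continuous_labelPos : Continuous (labelPos (x₀ := x₀) i) :=
  (NCube.continuous_flatten i).comp continuous_fst

theorem continuous_labelWeight : Continuous (labelWeight (x₀ := x₀) i) :=
  ((NCube.continuous_depth i).comp continuous_fst).min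
    (Whisker.continuous_weight.comp continuous_snd)

theorem labelWeight_pos_iff {a : NCube n × Whisker x₀} : 0 < labelWeight i a ↔
    a ∈ RelConfig.Visible (PartialBoundary n i) (Whisker.tip x₀) := by
  rw [labelWeight, lt_min_iff, NCube.depth_pos_iff_notMem, Whisker.weight_pos_iff]
  rfl

section

variable {T : Type*} [TopologicalSpace T] {τ : C(T, I)} {u : C(T, ℝ)}
  {a : C(T, NCube n × Whisker x₀)}

theorem expandLabel_zero {t : T} (hτ : τ t = 0) (hu : u t = (a t).1 i) :
    expandLabel i τ u a t = a t := by
  refine Prod.ext ?_ ?_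
  · change NCube.clip (NCube.expand i (τ t) (a t).1 (u t)) = _
    rw [hu, hτ, Set.Icc.coe_zero, NCube.expand_zero, NCube.clip_coe]
  · change Whisker.absorb x₀ (τ t, (a t).2) = _
    rw [hτ, Whisker.absorb_zero]

theorem labelWeight_expandLabel_le (t : T) :
    labelWeight i (expandLabel i τ u a t) ≤ labelWeight i (a t) :=
  min_le_min (NCube.depth_clip_expand_le (τ t).2.1 _ _) (Whisker.weight_absorb_le _ _)

theorem exists_le_labelWeight (i : Fin n) : ∃ δ > 0, ∀ (T : Type _) (_ : TopologicalSpace T)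
    (τ : C(T, I)) (u : C(T, ℝ)) (a : C(T, NCube n × Whisker x₀)) (t : T), τ t = 1 →
    0 < labelWeight i (expandLabel i τ u a t) → δ ≤ labelWeight i (a t) := by
  obtain ⟨δ, hδ, h⟩ := NCube.exists_le_depth i
  refine ⟨min δ (1 / 2), lt_min hδ (by norm_num), fun T _ τ u a t hτ ht => ?_⟩
  obtain ⟨h1, h2⟩ := lt_min_iff.1 ht
  refine min_le_min (h _ (u t) fun j hj => ?_) (Whisker.le_weight_of_absorb ?_)
  · have := NCube.clip_mem_Ioo.1 (NCube.depth_pos_iff.1 h1 j hj)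
    rwa [hτ, Set.Icc.coe_one] at this
  · rwa [← hτ]

theorem labelPos_eq_of_expandLabel {t t' : T} (hτ : τ t = τ t')
    (h : 0 < labelWeight i (expandLabel i τ u a t))
    (h' : 0 < labelWeight i (expandLabel i τ u a t'))
    (he : labelPos i (expandLabel i τ u a t) = labelPos i (expandLabel i τ u a t')) :
    labelPos i (a t) = labelPos i (a t') := by
  refine NCube.flatten_eq_iff.2 fun j hj => ?_
  have hj' := NCube.flatten_eq_iff.1 he j hj
  change NCube.clip (NCube.expand i (τ t) (a t).1 (u t)) j =
    NCube.clip (NCube.expand i (τ t') (a t').1 (u t')) j at hj'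
  have key : ∀ t, 0 < labelWeight i (expandLabel i τ u a t) →
      NCube.expand i (τ t) (a t).1 (u t) j ∈ Icc (0 : ℝ) 1 := fun t ht => by
    rcases hj.lt_or_gt with hl | hl
    · exact Ioo_subset_Icc_self
        (NCube.clip_mem_Ioo.1 (NCube.depth_pos_iff.1 (lt_min_iff.1 ht).1 j hl))
    · rw [NCube.expand_gt hl]
      exact ((a t).1 j).2
  refine NCube.coord_eq_of_expand (τ t).2.1 hj (u := u t) (u' := u t') ?_
  rw [← NCube.coe_clip_of_mem (key t h), hj', NCube.coe_clip_of_mem (key t' h'), hτ]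

end

theorem enlarging_expandLabel (i : Fin n) : Enlarging (labelPos (x₀ := x₀) i) (labelWeight i)
    (expandLabel i ⟨Prod.fst, continuous_fst⟩ ⟨fun p => (p.2.1 i : ℝ), continuous_subtype_val.comp
      ((NCube.continuous_coord i).comp (continuous_fst.comp continuous_snd))⟩
      ⟨Prod.snd, continuous_snd⟩) where
  zero a := expandLabel_zero rfl rfl
  pos_eq τ a b ha hb h := labelPos_eq_of_expandLabel (t := (τ, a)) (t' := (τ, b)) rfl ha hb h
  le τ a := labelWeight_expandLabel_le (τ, a)
  large := by
    obtain ⟨δ, hδ, h⟩ := exists_le_labelWeight (x₀ := x₀) i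
    exact ⟨δ, hδ, fun a => h _ _ _ _ _ (1, a) rfl⟩

end Points

section Points

variable {n : ℕ} {X : Type*} [TopologicalSpace X] {x₀ : X} {i j : Fin n}

/-- Translate the `j`-th coordinate upwards. -/
def raise (j : Fin n) (p : I × ℝ × NCube n × Whisker x₀) : ℝ × NCube n × Whisker x₀ :=
  (p.2.1, NCube.clip (fun l => p.2.2.1 l + if l = j then 1 - (p.1 : ℝ) else 0), p.2.2.2)

theorem continuous_raise (j : Fin n) : Continuous (raise (x₀ := x₀) j) := by
  refine (continuous_fst.comp continuous_snd).prodMk ((NCube.continuous_clip.comp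
    (continuous_pi fun l => ?_)).prodMk (by fun_prop))
  have h : Continuous fun p : I × ℝ × NCube n × Whisker x₀ => (p.2.2.1 l : ℝ) :=
    continuous_subtype_val.comp ((NCube.continuous_coord l).comp (by fun_prop))
  refine h.add ?_
  by_cases hl : l = j
  · simp only [if_pos hl]
    fun_prop
  · simp only [if_neg hl]
    fun_prop

theorem raise_one (z : ℝ × NCube n × Whisker x₀) : raise j (1, z) = z := by
  refine Prod.ext rfl (Prod.ext ?_ rfl)
  change NCube.clip (fun l => z.2.1 l + if l = j then 1 - ((1 : I) : ℝ) else 0) = z.2.1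
  simp only [Set.Icc.coe_one, sub_self, ite_self, add_zero, NCube.clip_coe]

theorem labelWeight_raise_zero (hj : j < i) (z : ℝ × NCube n × Whisker x₀) :
    ¬0 < labelWeight i (raise j (0, z)).2 := by
  intro h
  have := NCube.clip_mem_Ioo.1 (NCube.depth_pos_iff.1 (lt_min_iff.1 h).1 j hj)
  simp only [if_pos, Set.Icc.coe_zero] at this
  linarith [this.2, (z.2.1 j).2.1]

theorem lpos_eq_of_raise (hj : j < i) {τ : I} {z z' : ℝ × NCube n × Whisker x₀}
    (hz : 0 < labelWeight i (raise j (τ, z)).2) (hz' : 0 < labelWeight i (raise j (τ, z')).2)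
    (h : lpos (labelPos i) (raise j (τ, z)) = lpos (labelPos i) (raise j (τ, z'))) :
    lpos (labelPos i) z = lpos (labelPos i) z' := by
  obtain ⟨h1, h2⟩ := Prod.ext_iff.1 h
  refine Prod.ext h1 (NCube.flatten_eq_iff.2 fun l hl => ?_)
  have h3 := NCube.flatten_eq_iff.1 h2 l hl
  have key : ∀ z : ℝ × NCube n × Whisker x₀, 0 < labelWeight i (raise j (τ, z)).2 →
      (z.2.1 l + if l = j then 1 - (τ : ℝ) else 0) ∈ Icc (0 : ℝ) 1 := fun z hz => by
    by_cases hlj : l = j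
    · rw [hlj]
      exact Ioo_subset_Icc_self (NCube.clip_mem_Ioo.1
        (NCube.depth_pos_iff.1 (lt_min_iff.1 hz).1 j hj))
    · rw [if_neg hlj, add_zero]
      exact (z.2.1 l).2
  have h4 : ((raise j (τ, z)).2.1 l : ℝ) = _ := NCube.coe_clip_of_mem (key z hz)
  have h5 : ((raise j (τ, z')).2.1 l : ℝ) = _ := NCube.coe_clip_of_mem (key z' hz')
  have h6 := h4.symm.trans ((congrArg Subtype.val h3).trans h5)
  exact Subtype.ext (add_right_cancel h6)

theorem vanishes_labelPos (hj : j < i) :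
    Vanishes (labelPos (x₀ := x₀) i) (labelWeight i) := by
  intro c
  have hpts : ∀ τ : I, (Conf.ofSet (lpos (labelPos (x₀ := x₀) i)) (wC (labelWeight i))
      ((fun z => raise j (τ, z)) '' {z ∈ c.pts | 0 < labelWeight i (raise j (τ, z)).2})).pts =
      (fun z => raise j (τ, z)) '' {z ∈ c.pts | 0 < labelWeight i (raise j (τ, z)).2} := by
    intro τ
    rw [Conf.ofSet_pts ((c.fin.subset fun _ h => h.1).image _)]
    · refine sep_eq_self_iff_mem_true.2 ?_
      rintro _ ⟨z, hz, rfl⟩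
      exact hz.2
    · rintro _ ⟨z, hz, rfl⟩ _ ⟨z', hz', rfl⟩ h
      rw [c.inj hz.1 hz'.1 (lpos_eq_of_raise hj hz.2 hz'.2 h)]
  let u : Conf (lpos (labelPos (x₀ := x₀) i)) (fun _ => 1) :=
    ⟨c.pts, c.fin, c.inj, fun _ _ => one_pos⟩
  refine ⟨⟨fun τ => Conf.ofSet _ _ _, continuous_iff_continuousAt.2 fun τ =>
    Conf.continuousAt_push (u := fun _ => u) (v := fun τ z => labelWeight i (raise j (τ, z)).2)
      (continuous_lpos continuous_labelPos) continuous_const continuousAt_const hpts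
      (fun _ _ _ _ => rfl) ?_ (fun _ _ _ => (continuous_raise j).continuousAt)
      (fun _ _ => (continuous_labelWeight.comp
        (continuous_snd.comp (continuous_raise j))).continuousAt)
      fun δ _ => ⟨1, one_pos, Filter.Eventually.of_forall fun _ _ _ => le_rfl⟩⟩, ?_, ?_, ?_⟩
  · rintro z hz z' hz' h
    exact c.inj hz.1 hz'.1 (lpos_eq_of_raise hj hz.2 hz'.2 (congrArg _ h))
  · refine (hpts 0).trans (image_eq_empty.2 (eq_empty_of_forall_notMem fun z hz => ?_))
    exact labelWeight_raise_zero hj z hz.2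
  · refine Conf.ext ((hpts 1).trans ?_)
    simp only [raise_one, image_id']
    exact sep_eq_self_iff_mem_true.2 fun z hz => c.wpos z hz
  · intro τ z hz
    obtain ⟨z', hz', rfl⟩ := (hpts τ).subset hz
    exact ⟨z', hz'.1, rfl⟩

end Points

/-! ### Comparing configurations in the cube with configurations in a product with the line -/

section Leveling

variable {n : ℕ} {X : Type*} [TopologicalSpace X] {x₀ : X} {i : Fin n} {k : ℕ} {lam rho : C(ℝ, ℝ)}
  {w : ℝ × NCube n × Whisker x₀ → ℝ}

/-- The maps `lam` and `rho` translate between the `i`-th coordinate of a point of the cube and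
the level of a point of a product with the line. -/
structure Leveling (i : Fin n) (k : ℕ) (lam rho : C(ℝ, ℝ)) (w : ℝ × NCube n × Whisker x₀ → ℝ) :
    Prop where
  strictMono_lam : StrictMono lam
  strictMono_rho : StrictMono rho
  continuous : Continuous w
  le : (i : ℕ) ≤ k
  mem_Icc : k ≤ i → ∀ s, lam s ∈ Icc (0 : ℝ) 1
  zero : (i : ℕ) < k → lam (rho 0) ≤ 0
  one : (i : ℕ) < k → 1 ≤ lam (rho 1)
  pos_iff : ∀ a : NCube n × Whisker x₀, a ∈ RelConfig.Visible (PartialBoundary n k)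
    (Whisker.tip x₀) ↔ 0 < w (rho (a.1 i), a)
  labelWeight_pos : ∀ z, 0 < w z → 0 < labelWeight i z.2
  mem_of_pos : ∀ s a, 0 < w (rho (lam s), a) → lam s ∈ Icc (0 : ℝ) 1
  weight_le : ∀ (τ : I) (s : ℝ) (a a' : NCube n × Whisker x₀), labelWeight i a' ≤ labelWeight i a →
    w ((1 - (τ : ℝ)) * s + τ * rho (lam s), a') ≤ w (s, a)
  large : ∀ ε > 0, ∃ δ > 0, ∀ s a, ε ≤ labelWeight i a → ((i : ℕ) < k → lam s ∈ Ioo (0 : ℝ) 1) →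
    δ ≤ w (s, a)

/-- Regard a labelled point of the cube as a point of a product with the line. -/
def chart (x₀ : X) (i : Fin n) (rho : C(ℝ, ℝ)) :
    C(NCube n × Whisker x₀, ℝ × NCube n × Whisker x₀) :=
  ⟨fun a => (rho (a.1 i), a), (rho.continuous.comp (continuous_subtype_val.comp
    ((NCube.continuous_coord i).comp continuous_fst))).prodMk continuous_id⟩

/-- Regard a point of a product with the line as a labelled point of the cube. -/
def realize (x₀ : X) (i : Fin n) (lam : C(ℝ, ℝ)) :
    C(ℝ × NCube n × Whisker x₀, NCube n × Whisker x₀) :=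
  expandLabel i (.const _ 1) (lam.comp ⟨Prod.fst, continuous_fst⟩) ⟨Prod.snd, continuous_snd⟩

/-- The homotopy from the identity to the first composite, on points. -/
def chartRealize (i : Fin n) (lam rho : C(ℝ, ℝ)) : C(I × NCube n, NCube n) :=
  ⟨fun p => NCube.clip (NCube.expand i p.1 p.2
      ((1 - (p.1 : ℝ)) * (p.2 i : ℝ) + p.1 * lam (rho (p.2 i)))), by
    have h : Continuous fun p : I × NCube n => (p.2 i : ℝ) :=
      continuous_subtype_val.comp ((NCube.continuous_coord i).comp continuous_snd)
    exact NCube.continuous_clip.comp (NCube.continuous_expand i (by fun_prop) (by fun_prop)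
      (by fun_prop))⟩

/-- The homotopy from the identity to the second composite. -/
def realizeChart (x₀ : X) (i : Fin n) (lam rho : C(ℝ, ℝ)) :
    C(I × ℝ × NCube n × Whisker x₀, ℝ × NCube n × Whisker x₀) :=
  ⟨fun p => ((1 - (p.1 : ℝ)) * p.2.1 + p.1 * rho (lam p.2.1),
      expandLabel i ⟨Prod.fst, continuous_fst⟩
        ⟨fun p : I × ℝ × NCube n × Whisker x₀ =>
          (1 - (p.1 : ℝ)) * (p.2.2.1 i : ℝ) + p.1 * lam p.2.1, by
          have h : Continuous fun p : I × ℝ × NCube n × Whisker x₀ => (p.2.2.1 i : ℝ) :=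
            continuous_subtype_val.comp ((NCube.continuous_coord i).comp (by fun_prop))
          fun_prop⟩
        ⟨fun p => p.2.2, by fun_prop⟩ p), by fun_prop⟩

namespace Leveling

theorem notMem_of_notMem {q : NCube n} (h : Leveling i k lam rho w)
    (hq : q ∉ PartialBoundary n k) : q ∉ PartialBoundary n i :=
  fun ⟨j, hj, hj'⟩ => hq ⟨j, hj.trans_le h.le, hj'⟩

theorem mem_Ioo_of_clip_notMem {q : NCube n} {τ u : ℝ}
    (hq : NCube.clip (NCube.expand i τ q u) ∉ PartialBoundary n k) (hk : (i : ℕ) < k) :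
    u ∈ Ioo (0 : ℝ) 1 := by
  have := NCube.clip_notMem.1 hq i hk
  rwa [NCube.expand_self] at this

theorem convex_mem_Icc (h : Leveling i k lam rho w) (hk : k ≤ i) (τ x : I) (s : ℝ) :
    (1 - (τ : ℝ)) * x + τ * lam s ∈ Icc (0 : ℝ) 1 :=
  convex_Icc (0 : ℝ) 1 x.2 (h.mem_Icc hk s) (sub_nonneg.2 τ.2.2) τ.2.1 (sub_add_cancel 1 _)

theorem strictMono_mix {f : ℝ → ℝ} (hf : StrictMono f) (τ : I) :
    StrictMono fun x : ℝ => (1 - (τ : ℝ)) * x + τ * f x := by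
  intro x y hxy
  have h1 := hf hxy
  rcases τ.2.1.eq_or_lt with h0 | h0
  · simpa only [← h0, sub_zero, one_mul, zero_mul, add_zero] using hxy
  · have := mul_lt_mul_of_pos_left h1 h0
    have := mul_le_mul_of_nonneg_left hxy.le (sub_nonneg.2 τ.2.2)
    change (1 - (τ : ℝ)) * x + τ * f x < (1 - (τ : ℝ)) * y + τ * f y
    linarith

theorem pushing_chartRealize (h : Leveling i k lam rho w) :
    RelConfig.Pushing (PartialBoundary n k) (PartialBoundary n k) (chartRealize i lam rho) where
  maps τ q := by
    rintro ⟨j, hj, hj'⟩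
    have hj' : (q j : ℝ) = 0 ∨ (q j : ℝ) = 1 :=
      hj'.imp (fun h => congrArg Subtype.val h) (fun h => congrArg Subtype.val h)
    by_contra hq
    obtain ⟨h1, h2⟩ := NCube.clip_notMem.1 hq j hj
    have hτ := τ.2.1
    rcases lt_trichotomy j i with hl | rfl | hl
    · rw [NCube.expand_lt hl] at h1 h2
      dsimp only at h1 h2
      rcases hj' with h0 | h0 <;> rw [h0] at h1 h2 <;> linarith
    · rw [NCube.expand_self] at h1 h2
      dsimp only at h1 h2
      rcases hj' with h0 | h0 <;> rw [h0] at h1 h2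
      · nlinarith [h.zero hj]
      · nlinarith [h.one hj]
    · rw [NCube.expand_gt hl] at h1 h2
      rcases hj' with h0 | h0
      · exact h1.ne' h0
      · exact h2.ne h0
  inj τ := by
    let v : I × NCube n → Fin n → ℝ := fun p => NCube.expand i p.1 p.2
      ((1 - (p.1 : ℝ)) * (p.2 i : ℝ) + p.1 * lam (rho (p.2 i)))
    have hv : Continuous v := by
      have h : Continuous fun p : I × NCube n => (p.2 i : ℝ) :=
        continuous_subtype_val.comp ((NCube.continuous_coord i).comp continuous_snd)
      exact NCube.continuous_expand i (by fun_prop) (by fun_prop) (by fun_prop)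
    refine ⟨{q | ∀ j, v (τ, q) j ∈ Icc (0 : ℝ) 1}, fun q hq q' hq' he => ?_, fun q hq => ?_⟩
    · have hvv : v (τ, q) = v (τ, q') := NCube.clip_injective hq hq' he
      funext j
      by_cases hj : j = i
      · have hvi := congrFun hvv i
        simp only [v, NCube.expand_self] at hvi
        rw [hj]
        exact Subtype.ext ((strictMono_mix (h.strictMono_lam.comp h.strictMono_rho) τ).injective
          hvi)
      · exact NCube.coord_eq_of_expand τ.2.1 hj (congrFun hvv j)
    · obtain ⟨j, hj⟩ := not_forall.1 hq
      exact NCube.eventually_clip_mem hv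
        (NCube.lt_of_expand_notMem h.le (fun hk => h.convex_mem_Icc hk _ _ _) hj) hj

theorem charting (h : Leveling i k lam rho w) :
    RelConfig.Charting (lpos (labelPos i)) w (PartialBoundary n k) (Whisker.tip x₀) (chart x₀ i rho) where
  vis_iff := h.pos_iff
  inj p q hpq := by
    obtain ⟨h1, h2⟩ := Prod.ext_iff.1 hpq
    funext j
    by_cases hj : j = i
    · rw [hj]
      exact Subtype.ext (h.strictMono_rho.injective h1)
    · exact NCube.flatten_eq_iff.1 h2 j hj

theorem labelWeight_pos_of_visible {a : NCube n × Whisker x₀} (h : Leveling i k lam rho w)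
    (ha : a ∈ RelConfig.Visible (PartialBoundary n k) (Whisker.tip x₀)) : 0 < labelWeight i a :=
  labelWeight_pos_iff.2 ⟨h.notMem_of_notMem ha.1, ha.2⟩

theorem realizing (h : Leveling i k lam rho w) :
    Conf.Realizing (lpos (labelPos i)) w (PartialBoundary n k)
      (Whisker.tip x₀) (realize x₀ i lam) where
  large := by
    obtain ⟨ε, hε, hle⟩ := exists_le_labelWeight (x₀ := x₀) i
    obtain ⟨δ, hδ, hl⟩ := h.large ε hε
    exact ⟨δ, hδ, fun z hz => hl _ _ (hle _ _ _ _ _ z rfl (h.labelWeight_pos_of_visible hz))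
      fun hk => mem_Ioo_of_clip_notMem hz.1 hk⟩
  inj := by
    let v : ℝ × NCube n × Whisker x₀ → Fin n → ℝ := fun z =>
      NCube.expand i ((1 : I) : ℝ) z.2.1 (lam z.1)
    have hv : Continuous v :=
      NCube.continuous_expand i (by fun_prop) (by fun_prop) (by fun_prop)
    refine ⟨{z | ∀ j, v z j ∈ Icc (0 : ℝ) 1}, fun z hz z' hz' he => ?_, fun z hz => ?_⟩
    · have hvv : v z = v z' := NCube.clip_injective hz hz' he
      refine Prod.ext (h.strictMono_lam.injective ?_) (NCube.flatten_eq_iff.2 fun j hj =>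
        NCube.coord_eq_of_expand (1 : I).2.1 hj (congrFun hvv j))
      have hvi := congrFun hvv i
      simpa only [v, NCube.expand_self] using hvi
    · obtain ⟨j, hj⟩ := not_forall.1 hz
      filter_upwards [NCube.eventually_clip_mem hv
        (NCube.lt_of_expand_notMem h.le (fun hk => h.mem_Icc hk _) hj) hj] with z' hz' hvis
      exact hvis.1 hz'

theorem moving (h : Leveling i k lam rho w) :
    Conf.Moving (lpos (labelPos i)) w (realizeChart x₀ i lam rho) where
  le τ z := h.weight_le τ _ _ _ (labelWeight_expandLabel_le _)
  inj τ z z' hz hz' he := by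
    obtain ⟨h1, h2⟩ := Prod.ext_iff.1 he
    refine Prod.ext ((strictMono_mix (h.strictMono_rho.comp h.strictMono_lam) τ).injective h1)
      (labelPos_eq_of_expandLabel (t := (τ, z)) (t' := (τ, z')) rfl (h.labelWeight_pos _ hz)
        (h.labelWeight_pos _ hz') h2)

end Leveling
end Leveling

section LevelingHomotopy

variable {n : ℕ} {X : Type*} [TopologicalSpace X] {x₀ : X} {i : Fin n} {k : ℕ} {lam rho : C(ℝ, ℝ)}
  {w : ℝ × NCube n × Whisker x₀ → ℝ}

namespace Leveling

/-- The configuration in the product with the line associated with a configuration in the cube. -/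
def chartMap (h : Leveling i k lam rho w) : C(RelConfig (NCube n) (PartialBoundary n k)
    (Whisker x₀) (Whisker.tip x₀), Conf (lpos (labelPos i)) w) :=
  ⟨RelConfig.toConf _ w (chart x₀ i rho), RelConfig.continuous_toConf h.continuous h.charting⟩

/-- The configuration in the cube associated with a configuration in the product with the line. -/
def realizeMap (h : Leveling i k lam rho w) : C(Conf (lpos (labelPos i)) w,
    RelConfig (NCube n) (PartialBoundary n k) (Whisker x₀) (Whisker.tip x₀)) :=
  ⟨Conf.toRel _ _ (realize x₀ i lam), Conf.continuous_toRel (continuous_lpos continuous_labelPos)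
    h.continuous h.realizing⟩

/-- The homotopy from the identity to `realizeMap ∘ chartMap`. -/
def homotopyCube (h : Leveling i k lam rho w) : C(I × RelConfig (NCube n) (PartialBoundary n k)
    (Whisker x₀) (Whisker.tip x₀), RelConfig (NCube n) (PartialBoundary n k) (Whisker x₀)
    (Whisker.tip x₀)) :=
  ⟨RelConfig.push _ _ (chartRealize i lam rho) (Whisker.absorb x₀),
    RelConfig.continuous_push h.pushing_chartRealize Whisker.absorb_tip⟩

/-- The homotopy from the identity to `chartMap ∘ realizeMap`. -/
def homotopyLine (h : Leveling i k lam rho w) : C(I × Conf (lpos (labelPos (x₀ := x₀) i)) w,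
    Conf (lpos (labelPos i)) w) :=
  ⟨Conf.move (realizeChart x₀ i lam rho), Conf.continuous_move (continuous_lpos continuous_labelPos)
    h.continuous h.moving⟩

theorem vis_homotopyCube (h : Leveling i k lam rho w) (t : I) (c) :
    (h.homotopyCube (t, c)).vis = (fun z => (chartRealize i lam rho (t, z.1),
      Whisker.absorb x₀ (t, z.2))) '' c.vis ∩
        RelConfig.Visible (PartialBoundary n k) (Whisker.tip x₀) :=
  RelConfig.vis_push h.pushing_chartRealize _ _

theorem vis_realizeMap (h : Leveling i k lam rho w) (c) : (h.realizeMap c).vis =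
    realize x₀ i lam '' c.pts ∩ RelConfig.Visible (PartialBoundary n k) (Whisker.tip x₀) :=
  Conf.vis_toRel h.realizing c

theorem pts_chartMap (h : Leveling i k lam rho w) (c) : (h.chartMap c).pts =
    chart x₀ i rho '' c.vis :=
  RelConfig.toConf_pts h.charting c

theorem pts_homotopyLine (h : Leveling i k lam rho w) (t : I) (c) :
    (h.homotopyLine (t, c)).pts = (fun z => realizeChart x₀ i lam rho (t, z)) '' c.pts ∩
      {z | 0 < w z} :=
  Conf.move_pts h.moving _

theorem homotopyCube_zero (h : Leveling i k lam rho w) (c) : h.homotopyCube (0, c) = c := by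
  refine RelConfig.vis_injective ((h.vis_homotopyCube 0 c).trans ?_)
  have hid : ∀ z : NCube n × Whisker x₀,
      (chartRealize i lam rho (0, z.1), Whisker.absorb x₀ (0, z.2)) = z := fun z => by
    refine Prod.ext ?_ (Whisker.absorb_zero _)
    change NCube.clip (NCube.expand i ((0 : I) : ℝ) z.1
      ((1 - ((0 : I) : ℝ)) * (z.1 i : ℝ) + ((0 : I) : ℝ) * _)) = z.1
    rw [Set.Icc.coe_zero, sub_zero, one_mul, zero_mul, add_zero, NCube.expand_zero, NCube.clip_coe]
  simp only [hid, image_id']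
  exact inter_eq_left.2 c.vis_subset

theorem homotopyCube_one (h : Leveling i k lam rho w) (c) :
    h.homotopyCube (1, c) = h.realizeMap (h.chartMap c) := by
  refine RelConfig.vis_injective ?_
  rw [vis_homotopyCube, vis_realizeMap, pts_chartMap, image_image]
  have hid : ∀ z : NCube n × Whisker x₀, (chartRealize i lam rho (1, z.1),
      Whisker.absorb x₀ (1, z.2)) = realize x₀ i lam (chart x₀ i rho z) := fun z => by
    refine Prod.ext ?_ rfl
    change NCube.clip (NCube.expand i _ z.1
      ((1 - ((1 : I) : ℝ)) * (z.1 i : ℝ) + ((1 : I) : ℝ) * _)) = _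
    rw [Set.Icc.coe_one, sub_self, zero_mul, one_mul, zero_add]
    rfl
  simp only [hid]

theorem homotopyCube_base (h : Leveling i k lam rho w) (t : I) :
    h.homotopyCube (t, RelConfig.base _ _ _ _) = RelConfig.base _ _ _ _ := by
  refine RelConfig.vis_injective ?_
  rw [vis_homotopyCube, RelConfig.vis_base, image_empty, empty_inter]

theorem homotopyLine_zero (h : Leveling i k lam rho w) (c) : h.homotopyLine (0, c) = c := by
  refine Conf.ext ((h.pts_homotopyLine 0 c).trans ?_)
  have hid : ∀ z : ℝ × NCube n × Whisker x₀, realizeChart x₀ i lam rho (0, z) = z := fun z => by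
    refine Prod.ext ?_ (expandLabel_zero rfl ?_)
    · change (1 - ((0 : I) : ℝ)) * z.1 + ((0 : I) : ℝ) * _ = z.1
      rw [Set.Icc.coe_zero, sub_zero, one_mul, zero_mul, add_zero]
    · change (1 - ((0 : I) : ℝ)) * (z.2.1 i : ℝ) + ((0 : I) : ℝ) * _ = z.2.1 i
      rw [Set.Icc.coe_zero, sub_zero, one_mul, zero_mul, add_zero]
  simp only [hid, image_id']
  exact inter_eq_left.2 fun z hz => c.wpos z hz

theorem coe_realize_apply (z : ℝ × NCube n × Whisker x₀) (hz : lam z.1 ∈ Icc (0 : ℝ) 1) :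
    ((realize x₀ i lam z).1 i : ℝ) = lam z.1 := by
  change ((NCube.clip (NCube.expand i _ z.2.1 (lam z.1)) i : I) : ℝ) = _
  rw [NCube.coe_clip_of_mem] <;> rw [NCube.expand_self]
  exact hz

theorem chart_realize (z : ℝ × NCube n × Whisker x₀) (hz : lam z.1 ∈ Icc (0 : ℝ) 1) :
    chart x₀ i rho (realize x₀ i lam z) = realizeChart x₀ i lam rho (1, z) := by
  refine Prod.ext ?_ (Prod.ext ?_ rfl)
  · change rho ((realize x₀ i lam z).1 i : ℝ) = (1 - ((1 : I) : ℝ)) * z.1 + ((1 : I) : ℝ) * _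
    rw [coe_realize_apply z hz, Set.Icc.coe_one, sub_self, zero_mul, one_mul, zero_add]
  · change NCube.clip (NCube.expand i _ z.2.1 _) = NCube.clip (NCube.expand i _ z.2.1
      ((1 - ((1 : I) : ℝ)) * (z.2.1 i : ℝ) + ((1 : I) : ℝ) * _))
    rw [Set.Icc.coe_one, sub_self, zero_mul, one_mul, zero_add]
    rfl

theorem homotopyLine_one (h : Leveling i k lam rho w) (c) :
    h.homotopyLine (1, c) = h.chartMap (h.realizeMap c) := by
  refine Conf.ext ?_
  rw [pts_homotopyLine, pts_chartMap, vis_realizeMap]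
  ext z
  constructor
  · rintro ⟨⟨z, hz, rfl⟩, hw⟩
    have hlam : lam z.1 ∈ Icc (0 : ℝ) 1 := by
      refine h.mem_of_pos z.1 (realizeChart x₀ i lam rho (1, z)).2 ?_
      convert mem_ofPred_eq.le hw using 2
      refine Prod.ext ?_ rfl
      change _ = (1 - ((1 : I) : ℝ)) * z.1 + ((1 : I) : ℝ) * _
      rw [Set.Icc.coe_one, sub_self, zero_mul, one_mul, zero_add]
    dsimp only at hw ⊢
    rw [← chart_realize z hlam] at hw ⊢
    exact ⟨_, ⟨⟨z, hz, rfl⟩, (h.pos_iff _).2 hw⟩, rfl⟩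
  · rintro ⟨_, ⟨⟨z, hz, rfl⟩, hv⟩, rfl⟩
    have hlam : lam z.1 ∈ Icc (0 : ℝ) 1 := by
      rcases lt_or_ge (i : ℕ) k with hk | hk
      · exact Ioo_subset_Icc_self (mem_Ioo_of_clip_notMem hv.1 hk)
      · exact h.mem_Icc hk _
    have hw := (h.pos_iff _).1 hv
    exact ⟨⟨z, hz, (chart_realize z hlam).symm⟩, hw⟩

theorem homotopyLine_empty (h : Leveling i k lam rho w) (t : I) :
    h.homotopyLine (t, Conf.empty) = Conf.empty := by
  refine Conf.ext ?_
  rw [pts_homotopyLine, Conf.empty_pts, image_empty, empty_inter]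

theorem realizeMap_empty (h : Leveling i k lam rho w) :
    h.realizeMap Conf.empty = RelConfig.base _ _ _ _ := by
  refine RelConfig.vis_injective ?_
  rw [vis_realizeMap, Conf.empty_pts, RelConfig.vis_base, image_empty, empty_inter]

theorem chartMap_base (h : Leveling i k lam rho w) :
    h.chartMap (RelConfig.base _ _ _ _) = Conf.empty := by
  refine Conf.ext ?_
  rw [pts_chartMap, Conf.empty_pts, RelConfig.vis_base, image_empty]

theorem isWeakHomotopyEquiv_nloopMap (h : Leveling i k lam rho w) :
    IsWeakHomotopyEquiv (NLoop.map h.realizeMap h.realizeMap_empty) :=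
  .nloopMap _ _ h.chartMap h.chartMap_base h.homotopyLine h.homotopyLine_zero h.homotopyLine_one
    h.homotopyLine_empty h.homotopyCube h.homotopyCube_zero h.homotopyCube_one h.homotopyCube_base

end Leveling

theorem leveling_wC (i : Fin n) : Leveling i i ⟨Real.sigmoid, continuous_sigmoid⟩
    ⟨fun u => u - 1, by fun_prop⟩ (wC (labelWeight (x₀ := x₀) i)) where
  strictMono_lam := Real.sigmoid_strictMono
  strictMono_rho _ _ h := sub_lt_sub_right h 1
  continuous := continuous_wC continuous_labelWeight
  le := le_rfl
  mem_Icc _ s := ⟨(Real.sigmoid_pos s).le, (Real.sigmoid_lt_one s).le⟩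
  zero h := (lt_irrefl _ h).elim
  one h := (lt_irrefl _ h).elim
  pos_iff _ := labelWeight_pos_iff.symm
  labelWeight_pos _ h := h
  mem_of_pos s _ _ := ⟨(Real.sigmoid_pos s).le, (Real.sigmoid_lt_one s).le⟩
  weight_le _ _ _ _ h := h
  large ε hε := ⟨ε, hε, fun _ _ h _ => h⟩

theorem leveling_wY (i : Fin n) : Leveling i (i + 1) ⟨fun s => 2 * s - 1 / 2, by fun_prop⟩
    (.id ℝ) (wY (labelWeight (x₀ := x₀) i)) where
  strictMono_lam x y h := by
    change 2 * x - 1 / 2 < 2 * y - 1 / 2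
    linarith
  strictMono_rho := strictMono_id
  continuous := continuous_wY continuous_labelWeight
  le := Nat.le_succ _
  mem_Icc h := (h.not_gt (Nat.lt_succ_self _)).elim
  zero _ := by
    change (2 : ℝ) * 0 - 1 / 2 ≤ 0
    norm_num
  one _ := by
    change (1 : ℝ) ≤ 2 * 1 - 1 / 2
    norm_num
  pos_iff a := by
    change _ ↔ 0 < min _ (min (a.1 i : ℝ) (1 - (a.1 i : ℝ)))
    rw [lt_min_iff, lt_min_iff, sub_pos, labelWeight_pos_iff]
    refine Iff.trans ?_ and_right_comm
    refine and_congr_left' ?_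
    rw [NCube.notMem_partialBoundary, NCube.notMem_partialBoundary]
    constructor
    · exact fun h => ⟨fun j hj => h j (Nat.lt_succ_of_lt hj), h i (Nat.lt_succ_self _)⟩
    · intro h j hj
      rcases (Nat.lt_succ_iff.1 hj).lt_or_eq with hj | hj
      · exact h.1 j hj
      · rw [Fin.ext hj]
        exact h.2
  labelWeight_pos _ h := (lt_min_iff.1 h).1
  mem_of_pos _ _ h := by
    obtain ⟨h1, h2⟩ := lt_min_iff.1 (lt_min_iff.1 h).2
    exact ⟨h1.le, (sub_pos.1 h2).le⟩
  weight_le τ s a a' h := by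
    refine min_le_min h ?_
    change min ((1 - (τ : ℝ)) * s + τ * (2 * s - 1 / 2))
      (1 - ((1 - (τ : ℝ)) * s + τ * (2 * s - 1 / 2))) ≤ min s (1 - s)
    have hτ := τ.2.1
    rcases le_total s (1 / 2) with hs | hs
    · refine (min_le_left _ _).trans (le_min ?_ ?_) <;> nlinarith
    · refine (min_le_right _ _).trans (le_min ?_ ?_) <;> nlinarith
  large ε hε := by
    refine ⟨min ε (1 / 4), lt_min hε (by norm_num), fun s a h hs => min_le_min h ?_⟩
    obtain ⟨h1, h2⟩ := hs (Nat.lt_succ_self _)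
    change 0 < 2 * s - 1 / 2 at h1
    change 2 * s - 1 / 2 < 1 at h2
    exact le_min (by linarith) (by linarith)

/-- Regard a configuration in the cube as a configuration in a product with the line. -/
def chartBConf (x₀ : X) (i : Fin n) : C(RelConfig (NCube n) (PartialBoundary n i) (Whisker x₀)
    (Whisker.tip x₀), BConf (labelPos (x₀ := x₀) i) (labelWeight i) (1 / 2)) :=
  ⟨fun c => ⟨(leveling_wC i).chartMap c, fun z hz => by
    rw [Leveling.pts_chartMap] at hz
    obtain ⟨a, -, rfl⟩ := hz
    change (a.1 i : ℝ) - 1 < 1 / 2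
    linarith [(a.1 i).2.2]⟩, by fun_prop⟩

theorem isWeakHomotopyEquiv_chartBConf (x₀ : X) (i : Fin n) :
    IsWeakHomotopyEquiv (chartBConf x₀ i) := by
  have h := leveling_wC (x₀ := x₀) i
  refine .of_homotopyInverse _ (h.realizeMap.comp ⟨Subtype.val, continuous_subtype_val⟩)
    h.homotopyCube h.homotopyCube_zero h.homotopyCube_one
    ⟨fun p => ⟨h.homotopyLine (p.1, p.2.1), fun z hz => ?_⟩, by fun_prop⟩
    (fun c => Subtype.ext (h.homotopyLine_zero _)) (fun c => Subtype.ext (h.homotopyLine_one _))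
  rw [Leveling.pts_homotopyLine] at hz
  obtain ⟨⟨y, hy, rfl⟩, -⟩ := hz
  have h1 := p.2.2 y hy
  have h2 := Real.sigmoid_lt_one y.1
  have h3 := p.1.2.1
  have h4 := p.1.2.2
  change (1 - (p.1 : ℝ)) * y.1 + p.1 * (Real.sigmoid y.1 - 1) < 1 / 2
  rcases h3.eq_or_lt with h0 | h0
  · rw [← h0]
    linarith
  · nlinarith

end LevelingHomotopy

/-! ### Changing labels -/

namespace RelConfig

variable {M X X' X'' T : Type*} [TopologicalSpace M] [TopologicalSpace X] [TopologicalSpace X']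
  [TopologicalSpace X''] [TopologicalSpace T] {N : Set M} {x₀ : X} {x₀' : X'} {x₀'' : X''}

theorem pushing_snd (N : Set M) : Pushing N N (⟨Prod.snd, continuous_snd⟩ : C(T × M, M)) where
  maps _ _ h := h
  inj _ := ⟨univ, fun _ _ _ _ h => h, fun _ h => (h (mem_univ _)).elim⟩

/-- Change the labels of relative configurations along `Λ`. -/
def relabel [T2Space M] [LocallyCompactSpace T] (N : Set M) (Λ : C(T × X, X'))
    (hΛ : ∀ t, Λ (t, x₀) = x₀') : C(T × RelConfig M N X x₀, RelConfig M N X' x₀') :=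
  ⟨push N x₀' ⟨Prod.snd, continuous_snd⟩ Λ, continuous_push (pushing_snd N) hΛ⟩

variable [T2Space M] [LocallyCompactSpace T]

theorem vis_relabel (Λ : C(T × X, X')) (hΛ : ∀ t, Λ (t, x₀) = x₀') (p : T × RelConfig M N X x₀) :
    (relabel N Λ hΛ p).vis = (fun z => (z.1, Λ (p.1, z.2))) '' p.2.vis ∩ Visible N x₀' :=
  vis_push (pushing_snd N) Λ p

theorem relabel_base (Λ : C(T × X, X')) (hΛ : ∀ t, Λ (t, x₀) = x₀') (t : T) :
    relabel N Λ hΛ (t, base M N X x₀) = base M N X' x₀' := by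
  refine vis_injective ?_
  rw [vis_relabel, vis_base, vis_base, image_empty, empty_inter]

theorem relabel_eq_self {Λ : C(T × X, X)} {hΛ : ∀ t, Λ (t, x₀) = x₀} {t : T}
    (h : ∀ x, Λ (t, x) = x) (c : RelConfig M N X x₀) : relabel N Λ hΛ (t, c) = c := by
  refine vis_injective ?_
  rw [vis_relabel]
  simp only [h, image_id']
  exact inter_eq_left.2 c.vis_subset

/-- Change the labels of relative configurations along a based map. -/
def map (N : Set M) (g : C(X, X')) (hg : g x₀ = x₀') :
    C(RelConfig M N X x₀, RelConfig M N X' x₀') :=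
  (relabel N (g.comp ⟨Prod.snd, continuous_snd⟩ : C(Unit × X, X')) fun _ => hg).comp
    ⟨fun c => ((), c), by fun_prop⟩

theorem vis_map (g : C(X, X')) (hg : g x₀ = x₀') (c : RelConfig M N X x₀) :
    (map N g hg c).vis = (fun z => (z.1, g z.2)) '' c.vis ∩ Visible N x₀' :=
  vis_relabel _ (fun _ => hg) _

theorem map_base (g : C(X, X')) (hg : g x₀ = x₀') : map N g hg (base M N X x₀) = base M N X' x₀' :=
  relabel_base _ (fun _ => hg) _

theorem relabel_eq_map {Λ : C(T × X, X'')} {hΛ : ∀ t, Λ (t, x₀) = x₀''} {t : T} {f : C(X, X')}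
    {hf : f x₀ = x₀'} {g : C(X', X'')} {hg : g x₀' = x₀''} (h : ∀ x, Λ (t, x) = g (f x))
    (c : RelConfig M N X x₀) : relabel N Λ hΛ (t, c) = map N g hg (map N f hf c) := by
  refine vis_injective ?_
  rw [vis_relabel, vis_map, vis_map]
  ext z
  refine and_congr_left fun hz => ⟨?_, ?_⟩
  · rintro ⟨y, hy, rfl⟩
    refine ⟨_, ⟨⟨y, hy, rfl⟩, hz.1, fun h' => hz.2 ?_⟩, Prod.ext rfl (h y.2).symm⟩
    exact (h y.2).trans ((congrArg g h').trans hg)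
  · rintro ⟨_, ⟨⟨y, hy, rfl⟩, -⟩, rfl⟩
    exact ⟨y, hy, Prod.ext rfl (h y.2)⟩

end RelConfig

theorem exists_weakEquiv_scan {n : ℕ} {X : Type*} [TopologicalSpace X] {x₀ : X}
    (hwp : IsWellPointed X x₀) {i j : Fin n} (hj : j < i) :
    ∃ f : C(RelConfig (NCube n) (PartialBoundary n i) X x₀,
        NLoop 1 (RelConfig (NCube n) (PartialBoundary n (i + 1)) X x₀) (RelConfig.base _ _ _ _)),
      IsWeakHomotopyEquiv f := by
  obtain ⟨e, G, K, he, hG0, hG1, hG, hK0, hK1, hK⟩ := Whisker.exists_homotopy hwp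
  have hc : Whisker.collapse x₀ (Whisker.tip x₀) = x₀ := rfl
  have h1 : IsWeakHomotopyEquiv (RelConfig.map (PartialBoundary n i) e he) :=
    .of_homotopyInverse _ (RelConfig.map _ (Whisker.collapse x₀) hc)
      (RelConfig.relabel _ G hG) (RelConfig.relabel_eq_self hG0) (RelConfig.relabel_eq_map hG1)
      (RelConfig.relabel _ K hK) (RelConfig.relabel_eq_self hK0) (RelConfig.relabel_eq_map hK1)
  have h2 : IsWeakHomotopyEquiv (scan (labelPos (x₀ := x₀) i) (labelWeight i) continuous_labelPos
      continuous_labelWeight) :=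
    .of_fills fun m => Fills.constFam_scan _ _ (vanishes_labelPos hj) (enlarging_expandLabel i) m
  have h3 : IsWeakHomotopyEquiv (NLoop.map (RelConfig.map (PartialBoundary n (i + 1))
      (Whisker.collapse x₀) hc) (RelConfig.map_base _ hc)) :=
    .nloopMap _ _ (RelConfig.map _ e he) (RelConfig.map_base _ _)
      (RelConfig.relabel _ K hK) (RelConfig.relabel_eq_self hK0) (RelConfig.relabel_eq_map hK1)
      (RelConfig.relabel_base _ _)
      (RelConfig.relabel _ G hG) (RelConfig.relabel_eq_self hG0) (RelConfig.relabel_eq_map hG1)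
      (RelConfig.relabel_base _ _)
  exact ⟨_, h3.comp ((leveling_wY i).isWeakHomotopyEquiv_nloopMap.comp
    (h2.comp ((isWeakHomotopyEquiv_chartBConf x₀ i).comp h1)))⟩

/-- For `n ≥ 2` and a well-pointed space `(X,x₀)`, set
`B_i(X) = C⁰(Iⁿ, ∂I^i × I^{n-i}; X)`. Then for every `1 ≤ i ≤ n-1` there is a weak homotopy
equivalence (scanning in the `(i+1)`-st coordinate) `B_i(X) → Ω B_{i+1}(X)`. -/
theorem relConfig_scanning_weakEquiv_loop (n : ℕ) (hn : 2 ≤ n)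
    (X : Type*) [TopologicalSpace X] (x₀ : X) (hwp : IsWellPointed X x₀) :
    ∀ i : ℕ, 1 ≤ i → i ≤ n - 1 →
      ∃ f : C(RelConfig (NCube n) (PartialBoundary n i) X x₀,
          NLoop 1 (RelConfig (NCube n) (PartialBoundary n (i + 1)) X x₀)
            (RelConfig.base (NCube n) (PartialBoundary n (i + 1)) X x₀)),
        IsWeakHomotopyEquiv f := by
  intro i hi hin
  exact exists_weakEquiv_scan hwp (i := ⟨i, by omega⟩) (j := ⟨0, by omega⟩) hi

end
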